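/- arXiv:math/0303165 — 2 statements merged into one kernel-verified Lean document; each statement's English description precedes it below -/
import Mathlib

section
/- Let n be an odd positive integer. Then no point p ∈ k⁸ satisfies simultaneously: g(p) = 0 for every g ∈ J, the product of the x-coordinate and the c-coordinate of p is zero, and αⁿ(p) = p. (That is, αⁿ has no fixed points in S = V′ ∩ V(xc).) -/
open MvPolynomial

noncomputable section

/-- The polynomial ring `R = 𝔽₂[a,b,c,d,v,w,x,y]`, with variables indexed
`a = X 0, b = X 1, c = X 2, d = X 3, v = X 4, w = X 5, x = X 6, y = X 7`. -/
abbrev SuzukiRing := MvPolynomial (Fin 8) (ZMod 2)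

/-- The 4×4 anti-diagonal permutation matrix `T`. -/
def Tmat : Matrix (Fin 4) (Fin 4) SuzukiRing :=
  !![0, 0, 0, 1; 0, 0, 1, 0; 0, 1, 0, 0; 1, 0, 0, 0]

/-- The lower unitriangular matrix `S(α, β, α₀, β₀)`. -/
def Smat (α β α₀ β₀ : SuzukiRing) : Matrix (Fin 4) (Fin 4) SuzukiRing :=
  !![1, 0, 0, 0;
     α, 1, 0, 0;
     α * α₀ + β, α₀, 1, 0;
     α ^ 2 * α₀ + α * β + β₀, β, α, 1]

/-- `X = T · S(a, b, v, w)`. -/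
def Xmat : Matrix (Fin 4) (Fin 4) SuzukiRing := Tmat * Smat (X 0) (X 1) (X 4) (X 5)

/-- `Y = T · S(c, d, x, y)`. -/
def Ymat : Matrix (Fin 4) (Fin 4) SuzukiRing := Tmat * Smat (X 2) (X 3) (X 6) (X 7)

/-- The ideal `I_V ⊆ R` generated by the 16 entries of
`X⁻¹YX⁻¹Y⁻¹X² − YX⁻²Y⁻¹XY⁻¹` (the inverses being the adjugates, since both
matrices have determinant 1). -/
def IV : Ideal SuzukiRing :=
  Ideal.span (Set.range fun p : Fin 4 × Fin 4 =>
    (Xmat.adjugate * Ymat * Xmat.adjugate * Ymat.adjugate * Xmat * Xmat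
      - Ymat * Xmat.adjugate * Xmat.adjugate * Ymat.adjugate * Xmat * Ymat.adjugate)
      p.1 p.2)



/-- The operator `α : k⁸ → k⁸`, `α(a,b,c,d,v,w,x,y) = (v,w,x,y,a²,b²,c²,d²)`. -/
def alphaOp {k : Type*} [CommRing k] (p : Fin 8 → k) : Fin 8 → k :=
  ![p 4, p 5, p 6, p 7, p 0 ^ 2, p 1 ^ 2, p 2 ^ 2, p 3 ^ 2]

/-! ### A small checker for polynomial identities in characteristic two

Monomials in the eight variables are coded by positive integers (the variables
`a,b,c,d,v,w,x,y` being the primes `2,3,5,7,11,13,17,19`), and polynomials by lists of codes. -/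

/-- Value of a monomial code under an assignment of ring elements to primes. -/
def evM {S : Type*} [CommRing S] (r : ℕ → S) (m : ℕ) : S :=
  if m = 0 then 0 else m.factorization.prod fun q e => r q ^ e

/-- Value of a polynomial code. -/
def evP {S : Type*} [CommRing S] (r : ℕ → S) (P : List ℕ) : S := (P.map (evM r)).sum

theorem evM_mul {S : Type*} [CommRing S] (r : ℕ → S) (m n : ℕ) :
    evM r (m * n) = evM r m * evM r n := by
  unfold evM
  by_cases hm : m = 0
  · simp [hm]
  by_cases hn : n = 0
  · simp [hn]
  simp only [mul_eq_zero, hm, hn, or_self, if_false]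
  rw [Nat.factorization_mul hm hn, Finsupp.prod_add_index']
  · simp
  · intro a b c; exact pow_add _ _ _

theorem evM_one {S : Type*} [CommRing S] (r : ℕ → S) : evM r 1 = 1 := by simp [evM]

theorem evM_prime {S : Type*} [CommRing S] (r : ℕ → S) {q : ℕ} (hq : q.Prime) :
    evM r q = r q := by
  simp [evM, hq.ne_zero, hq.factorization]

theorem map_evM {S S' : Type*} [CommRing S] [CommRing S'] (f : S →+* S') (r : ℕ → S) (m : ℕ) :
    f (evM r m) = evM (fun q => f (r q)) m := by
  unfold evM
  split_ifs
  · simp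
  · rw [map_finsuppProd]; simp

theorem map_evP {S S' : Type*} [CommRing S] [CommRing S'] (f : S →+* S') (r : ℕ → S)
    (P : List ℕ) : f (evP r P) = evP (fun q => f (r q)) P := by
  unfold evP
  rw [map_list_sum, List.map_map]
  congr 1
  apply List.map_congr_left
  intro m _
  exact map_evM f r m

/-- Symmetric difference (sum in characteristic two) of two sorted lists. -/
def mg (P : List ℕ) : List ℕ → List ℕ :=
  List.rec (motive := fun _ => List ℕ → List ℕ) (fun Q => Q)
    (fun a p ih => fun Q =>
      List.rec (motive := fun _ => List ℕ) (a :: p)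
        (fun b q ih2 => bif Nat.beq a b then ih q
          else bif Nat.ble a b then a :: ih (b :: q) else b :: ih2) Q) P

theorem evP_nil {S : Type*} [CommRing S] (r : ℕ → S) : evP r [] = 0 := rfl

theorem evP_cons {S : Type*} [CommRing S] (r : ℕ → S) (m : ℕ) (P : List ℕ) :
    evP r (m :: P) = evM r m + evP r P := by simp [evP]

theorem mg_nil (Q : List ℕ) : mg [] Q = Q := rfl
theorem mg_cons_nil (a : ℕ) (P : List ℕ) : mg (a :: P) [] = a :: P := rfl
theorem mg_cons_cons (a b : ℕ) (P Q : List ℕ) : mg (a :: P) (b :: Q) =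
    bif Nat.beq a b then mg P Q
      else bif Nat.ble a b then a :: mg P (b :: Q) else b :: mg (a :: P) Q := rfl

theorem evP_mg {S : Type*} [CommRing S] [CharP S 2] (r : ℕ → S) (P Q : List ℕ) :
    evP r (mg P Q) = evP r P + evP r Q := by
  induction P generalizing Q with
  | nil => simp [mg_nil, evP_nil]
  | cons a P ih =>
    induction Q with
    | nil => simp [mg_cons_nil, evP_nil]
    | cons b Q ih2 =>
      rw [mg_cons_cons]
      rcases h : Nat.beq a b with _ | _
      · rcases h' : Nat.ble a b with _ | _
        · simp only [cond_false, evP_cons, ih2]; ring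
        · simp only [cond_false, cond_true, evP_cons, ih]; ring
      · have : a = b := Nat.eq_of_beq_eq_true h
        subst this
        simp only [cond_true, evP_cons, ih]
        have := CharTwo.add_self_eq_zero (evM r a)
        linear_combination -this

/-- One round of pairwise summation. -/
def pairUp : List (List ℕ) → List (List ℕ)
  | a :: b :: l => mg a b :: pairUp l
  | [a] => [a]
  | [] => []

/-- Sum of a list of polynomials. -/
def sumP (l : List (List ℕ)) : List ℕ :=
  (pairUp (pairUp (pairUp (pairUp (pairUp (pairUp (pairUp (pairUp (pairUp l))))))))).foldr mg []

/-- Sum of few polynomials. -/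
def sumQ (l : List (List ℕ)) : List ℕ :=
  (pairUp (pairUp l)).foldr mg []

theorem evP_pairUp {S : Type*} [CommRing S] [CharP S 2] (r : ℕ → S) (l : List (List ℕ)) :
    ((pairUp l).map (evP r)).sum = (l.map (evP r)).sum := by
  induction l using pairUp.induct with
  | case1 a b l ih => simp [pairUp, ih, evP_mg, add_assoc]
  | case2 a => simp [pairUp]
  | case3 => simp [pairUp]

theorem evP_foldr {S : Type*} [CommRing S] [CharP S 2] (r : ℕ → S) (l : List (List ℕ)) :
    evP r (l.foldr mg []) = (l.map (evP r)).sum := by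
  induction l with
  | nil => simp [evP_nil]
  | cons a l ih => simp [evP_mg, ih]

theorem evP_sumP {S : Type*} [CommRing S] [CharP S 2] (r : ℕ → S) (l : List (List ℕ)) :
    evP r (sumP l) = (l.map (evP r)).sum := by
  simp only [sumP, evP_foldr, evP_pairUp]

theorem evP_sumQ {S : Type*} [CommRing S] [CharP S 2] (r : ℕ → S) (l : List (List ℕ)) :
    evP r (sumQ l) = (l.map (evP r)).sum := by
  simp only [sumQ, evP_foldr, evP_pairUp]

/-- The list of all `m * Q` for `m` in `P`. -/
def shifts (P Q : List ℕ) : List (List ℕ) := P.map fun m => Q.map fun n => Nat.mul m n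

theorem evP_shift {S : Type*} [CommRing S] (r : ℕ → S) (m : ℕ) (Q : List ℕ) :
    evP r (Q.map fun n => Nat.mul m n) = evM r m * evP r Q := by
  induction Q with
  | nil => simp [evP_nil]
  | cons n Q ih =>
    rw [List.map_cons, evP_cons, evP_cons, ih, mul_add, ← evM_mul]
    rfl

theorem evP_shifts {S : Type*} [CommRing S] (r : ℕ → S) (P Q : List ℕ) :
    ((shifts P Q).map (evP r)).sum = evP r P * evP r Q := by
  induction P with
  | nil => simp [shifts, evP_nil]
  | cons m P ih =>
    have : shifts (m :: P) Q = (Q.map fun n => Nat.mul m n) :: shifts P Q := rfl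
    rw [this, List.map_cons, List.sum_cons, ih, evP_cons, evP_shift]
    ring

/-- Product of polynomials. -/
def mulP (P Q : List ℕ) : List ℕ := sumQ (shifts P Q)

theorem evP_mulP {S : Type*} [CommRing S] [CharP S 2] (r : ℕ → S) (P Q : List ℕ) :
    evP r (mulP P Q) = evP r P * evP r Q := by
  rw [mulP, evP_sumQ, evP_shifts]

/-- Check that `t = ∑ h * f` over the pairs `(h, f)` of the list. -/
def certOK (t : List ℕ) (l : List (List ℕ × List ℕ)) : Bool :=
  (mg t (sumP (l.flatMap fun c => shifts c.1 c.2))).isEmpty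

theorem evP_of_certOK {S : Type*} [CommRing S] [CharP S 2] (r : ℕ → S) (t : List ℕ)
    (l : List (List ℕ × List ℕ)) (h : certOK t l = true)
    (hl : ∀ c ∈ l, evP r c.2 = 0) : evP r t = 0 := by
  have h1 : mg t (sumP (l.flatMap fun c => shifts c.1 c.2)) = [] := by
    simpa [certOK] using h
  have h2 := evP_mg r t (sumP (l.flatMap fun c => shifts c.1 c.2))
  rw [h1, evP_nil, evP_sumP] at h2
  have h3 : ((l.flatMap fun c => shifts c.1 c.2).map (evP r)).sum = 0 := by
    clear h h1 h2
    induction l with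
    | nil => simp
    | cons c l ih =>
      rw [List.flatMap_cons, List.map_append, List.sum_append, evP_shifts,
        hl c (by simp), mul_zero, zero_add]
      exact ih fun c' hc' => hl c' (by simp [hc'])
  rw [h3, add_zero] at h2
  exact h2.symm

/-! ### Matrices of polynomial codes -/

/-- Matrices of polynomial codes. -/
abbrev PMat := Fin 4 → Fin 4 → List ℕ

/-- Value of a matrix of polynomial codes. -/
def evMat {S : Type*} [CommRing S] (r : ℕ → S) (A : PMat) : Matrix (Fin 4) (Fin 4) S :=
  fun i j => evP r (A i j)

/-- Product of matrices of polynomial codes. -/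
def mmul (A B : PMat) : PMat := fun i j =>
  sumQ [mulP (A i 0) (B 0 j), mulP (A i 1) (B 1 j), mulP (A i 2) (B 2 j), mulP (A i 3) (B 3 j)]

theorem evMat_mmul {S : Type*} [CommRing S] [CharP S 2] (r : ℕ → S) (A B : PMat) :
    evMat r (mmul A B) = evMat r A * evMat r B := by
  ext i j
  simp [evMat, mmul, evP_sumQ, evP_mulP, Matrix.mul_apply, Fin.sum_univ_four, add_assoc]

/-- The matrix `T * S(α, β, α₀, β₀)`. -/
def PX (a b v w : List ℕ) : PMat :=
  ![![mg (mulP a (mulP a v)) (mg (mulP a b) w), b, a, [1]],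
    ![mg (mulP a v) b, v, [1], []], ![a, [1], [], []], ![[1], [], [], []]]

/-- The inverse of the matrix `T * S(α, β, α₀, β₀)`. -/
def PXi (a b v w : List ℕ) : PMat :=
  ![![[], [], [], [1]], ![[], [], [1], a], ![[], [1], v, b],
    ![[1], a, mg (mulP a v) b, mg (mulP a (mulP a v)) (mg (mulP a b) w)]]

/-- Explicit `T * S`. -/
def EX {S : Type*} [CommRing S] (a b v w : S) : Matrix (Fin 4) (Fin 4) S :=
  !![a * (a * v) + (a * b + w), b, a, 1; a * v + b, v, 1, 0; a, 1, 0, 0; 1, 0, 0, 0]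

/-- Explicit inverse of `T * S` in characteristic two. -/
def EXi {S : Type*} [CommRing S] (a b v w : S) : Matrix (Fin 4) (Fin 4) S :=
  !![0, 0, 0, 1; 0, 0, 1, a; 0, 1, v, b; 1, a, a * v + b, a * (a * v) + (a * b + w)]

theorem evP_one {S : Type*} [CommRing S] (r : ℕ → S) : evP r [1] = 1 := by
  simp [evP, evM_one]

theorem evMat_PX {S : Type*} [CommRing S] [CharP S 2] (r : ℕ → S) (a b v w : List ℕ) :
    evMat r (PX a b v w) = EX (evP r a) (evP r b) (evP r v) (evP r w) := by
  ext i j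
  fin_cases i <;> fin_cases j <;>
    simp [evMat, PX, EX, evP_mg, evP_mulP, evP_one, evP_nil]

theorem evMat_PXi {S : Type*} [CommRing S] [CharP S 2] (r : ℕ → S) (a b v w : List ℕ) :
    evMat r (PXi a b v w) = EXi (evP r a) (evP r b) (evP r v) (evP r w) := by
  ext i j
  fin_cases i <;> fin_cases j <;>
    simp [evMat, PXi, EXi, evP_mg, evP_mulP, evP_one, evP_nil]

theorem EX_mul_EXi {S : Type*} [CommRing S] [CharP S 2] (a b v w : S) :
    EX a b v w * EXi a b v w = 1 := by
  have h2 : (2 : S) = 0 := CharTwo.two_eq_zero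
  ext i j
  fin_cases i <;> fin_cases j <;>
    simp [EX, EXi, Matrix.mul_apply, Fin.sum_univ_four]
  all_goals first
    | done
    | linear_combination (a * (a * v) + a * b + w) * h2
    | linear_combination (a * v + b) * h2
    | linear_combination (a * v) * h2
    | linear_combination (b) * h2
    | linear_combination (a) * h2
    | linear_combination (v) * h2
    | linear_combination (a * a * v + a * b + w) * h2
    | linear_combination (a * a * v + 2 * a * b + w) * h2

/-- The left and right sides of the relation `xYxyXX = YxxyXy`. -/
def E1L (MX MXi MY MYi : PMat) : PMat :=
  mmul (mmul (mmul (mmul MXi MY) MXi) (mmul MYi MX)) MX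
/-- Right side. -/
def E1R (MX MXi MY MYi : PMat) : PMat :=
  mmul (mmul (mmul (mmul MY MXi) MXi) (mmul MYi MX)) MYi
/-- The left and right sides of the relation `XyxYxyX = xyXyx`. -/
def E2L (MX MXi MY MYi : PMat) : PMat :=
  mmul (mmul (mmul (mmul MX MYi) (mmul MXi MY)) MXi) (mmul MYi MX)
/-- Right side. -/
def E2R (MX MXi _MY MYi : PMat) : PMat :=
  mmul (mmul (mmul MXi (mmul MYi MX)) MYi) MXi
/-- The left and right sides of the relation `yXXYxY = XyXYxx`. -/
def E3L (MX MXi MY MYi : PMat) : PMat :=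
  mmul (mmul (mmul (mmul MYi MX) MX) MY) (mmul MXi MY)
/-- Right side. -/
def E3R (MX MXi MY MYi : PMat) : PMat :=
  mmul (mmul (mmul MX (mmul MYi MX)) (mmul MY MXi)) MXi

/-- Difference of the two sides of relation 1, as codes. -/
def E1 (a c v x : List ℕ) : PMat := fun i j =>
  mg (E1L (PX a [3] v [13]) (PXi a [3] v [13]) (PX c [7] x [19]) (PXi c [7] x [19]) i j)
    (E1R (PX a [3] v [13]) (PXi a [3] v [13]) (PX c [7] x [19]) (PXi c [7] x [19]) i j)

/-- Difference of the two sides of relation 2, as codes. -/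
def E2 (a c v x : List ℕ) : PMat := fun i j =>
  mg (E2L (PX a [3] v [13]) (PXi a [3] v [13]) (PX c [7] x [19]) (PXi c [7] x [19]) i j)
    (E2R (PX a [3] v [13]) (PXi a [3] v [13]) (PX c [7] x [19]) (PXi c [7] x [19]) i j)

/-- Difference of the two sides of relation 3, as codes. -/
def E3 (a c v x : List ℕ) : PMat := fun i j =>
  mg (E3L (PX a [3] v [13]) (PXi a [3] v [13]) (PX c [7] x [19]) (PXi c [7] x [19]) i j)
    (E3R (PX a [3] v [13]) (PXi a [3] v [13]) (PX c [7] x [19]) (PXi c [7] x [19]) i j)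

theorem group_forms {G : Type*} [Group G] (x y : G)
    (h : x⁻¹ * y * x⁻¹ * y⁻¹ * x * x = y * x⁻¹ * x⁻¹ * y⁻¹ * x * y⁻¹) :
    x * y⁻¹ * (x⁻¹ * y) * x⁻¹ * (y⁻¹ * x) = x⁻¹ * (y⁻¹ * x) * y⁻¹ * x⁻¹ ∧
    y⁻¹ * x * x * y * (x⁻¹ * y) = x * (y⁻¹ * x) * (y * x⁻¹) * x⁻¹ := by
  constructor
  · calc _ = x * y⁻¹ * (x⁻¹ * y * x⁻¹ * y⁻¹ * x * x) * x⁻¹ := by group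
      _ = _ := by rw [h]; group
  · calc _ = (x⁻¹ * y * x⁻¹)⁻¹ * (x⁻¹ * y * x⁻¹ * y⁻¹ * x * x) * (y * x⁻¹ * y) := by group
      _ = _ := by rw [h]; group

/-- All three forms vanish once the original relation holds. -/
theorem forms_vanish {S : Type*} [CommRing S] [CharP S 2] (r : ℕ → S) (a c v x : List ℕ)
    (MX MXi MY MYi : Matrix (Fin 4) (Fin 4) S)
    (hX : MX = EX (evP r a) (evP r [3]) (evP r v) (evP r [13]))
    (hXi : MXi = EXi (evP r a) (evP r [3]) (evP r v) (evP r [13]))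
    (hY : MY = EX (evP r c) (evP r [7]) (evP r x) (evP r [19]))
    (hYi : MYi = EXi (evP r c) (evP r [7]) (evP r x) (evP r [19]))
    (h : MXi * MY * MXi * MYi * MX * MX = MY * MXi * MXi * MYi * MX * MYi) :
    (∀ i j, evP r (E1 a c v x i j) = 0) ∧ (∀ i j, evP r (E2 a c v x i j) = 0) ∧
      (∀ i j, evP r (E3 a c v x i j) = 0) := by
  have hx : MX * MXi = 1 := by rw [hX, hXi, EX_mul_EXi]
  have hx' : MXi * MX = 1 := mul_eq_one_comm.mp hx
  have hy : MY * MYi = 1 := by rw [hY, hYi, EX_mul_EXi]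
  have hy' : MYi * MY = 1 := mul_eq_one_comm.mp hy
  obtain ⟨h2, h3⟩ := group_forms (⟨MX, MXi, hx, hx'⟩ : (Matrix (Fin 4) (Fin 4) S)ˣ)
    ⟨MY, MYi, hy, hy'⟩ (Units.ext h)
  have h2' := congrArg Units.val h2
  have h3' := congrArg Units.val h3
  simp only [Units.val_mul, Units.inv_mk] at h2' h3'
  have key : ∀ A B : PMat, evMat r A = evMat r B → ∀ i j, evP r (mg (A i j) (B i j)) = 0 := by
    intro A B hAB i j
    have := congrFun (congrFun hAB i) j
    simp only [evMat] at this
    rw [evP_mg, this, CharTwo.add_self_eq_zero]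
  refine ⟨?_, ?_, ?_⟩
  · refine key (E1L _ _ _ _) (E1R _ _ _ _) ?_
    simp only [E1L, E1R, evMat_mmul, evMat_PX, evMat_PXi, ← hX, ← hXi, ← hY, ← hYi]
    simpa only [mul_assoc] using h
  · refine key (E2L _ _ _ _) (E2R _ _ _ _) ?_
    simp only [E2L, E2R, evMat_mmul, evMat_PX, evMat_PXi, ← hX, ← hXi, ← hY, ← hYi]
    exact h2'
  · refine key (E3L _ _ _ _) (E3R _ _ _ _) ?_
    simp only [E3L, E3R, evMat_mmul, evMat_PX, evMat_PXi, ← hX, ← hXi, ← hY, ← hYi]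
    exact h3'

/-! ### Certificates -/

/-- An auxiliary element `a x p` of the ideal. -/
def tgtA : List ℕ := [408, 748, 884, 1292, 2380, 2890, 4624, 7480, 11560, 28900]

/-- Certificate for `tgtA`. -/
def certA : List (List ℕ × List ℕ) := [
  ([10, 66, 154, 195, 266, 323, 455], E1 [2] [5] [11] [17] 0 0),
  ([2, 51, 77, 119, 374, 418, 578, 935, 1615], E1 [2] [5] [11] [17] 0 1),
  ([3], E1 [2] [5] [11] [17] 0 2),
  ([4, 25, 49, 66, 102, 121, 143, 154, 165, 169, 182, 195, 221, 247, 289, 323, 361, 385, 455, 595,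
    665, 748, 884, 1210, 1292, 3025, 3230, 3575, 4675, 7225], E1 [2] [5] [11] [17] 1 1),
  ([13, 15], E1 [2] [5] [11] [17] 1 2),
  ([7], E1 [2] [5] [11] [17] 1 3),
  ([13, 15, 17, 35, 44, 52, 68, 76, 170, 190, 275, 475], E1 [2] [5] [11] [17] 2 1),
  ([1, 4, 21, 49, 66, 78, 102, 165, 169, 247, 255, 285, 289, 361, 484, 572, 595, 1870, 2090], E1 [2]
    [5] [11] [17] 2 2),
  ([5, 45, 77, 91, 133, 1445, 1615], E1 [2] [5] [11] [17] 2 3),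
  ([55, 65, 85, 95], E1 [2] [5] [11] [17] 3 1),
  ([195], E1 [2] [5] [11] [17] 3 3),
  ([6, 13, 15, 17, 19, 44, 68], E2 [2] [5] [11] [17] 1 1),
  ([66, 78, 102, 114, 143, 165, 169, 182, 187, 209, 238, 255, 266, 289, 361, 484, 572, 836, 1210,
    1430, 1870, 2090, 2210, 2890, 3230, 3575, 4675, 5225], E2 [2] [5] [11] [17] 1 2),
  ([5, 8, 91, 125, 242, 286, 374, 715, 935, 1615], E2 [2] [5] [11] [17] 1 3),
  ([4, 10, 49, 78, 102, 114, 121, 154, 169, 182, 209, 221, 238, 255, 266, 289, 323, 361, 572, 748,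
    836, 1210, 1430, 1870, 2090, 3575, 4675, 5225, 5525, 8075], E2 [2] [5] [11] [17] 2 1),
  ([6, 15, 110, 425], E2 [2] [5] [11] [17] 2 2),
  ([3, 26, 28, 30, 55, 70, 75, 85, 95], E2 [2] [5] [11] [17] 2 3),
  ([9, 10, 49, 66, 102, 238, 255, 285, 385, 572, 748, 836, 1210, 1430, 4675, 5525, 8075], E2 [2] [5]
    [11] [17] 3 0),
  ([8, 42, 51, 91, 105, 119, 125, 1105, 1615], E2 [2] [5] [11] [17] 3 1),
  ([7, 26, 55, 65], E2 [2] [5] [11] [17] 3 2),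
  ([5, 91, 119, 133, 1105], E3 [2] [5] [11] [17] 1 0),
  ([4, 9, 10, 21, 49, 66, 78, 169, 187, 209, 247, 255, 285, 361, 595, 748, 836, 1430, 4675], E3 [2]
    [5] [11] [17] 1 1),
  ([6, 13, 15, 35, 52, 76, 190, 475], E3 [2] [5] [11] [17] 1 2),
  ([3], E3 [2] [5] [11] [17] 1 3),
  ([6, 11, 14, 15, 19, 35], E3 [2] [5] [11] [17] 2 1),
  ([1, 4, 21, 25, 49, 66, 143, 154, 169, 182, 195, 221, 247, 323, 361, 455, 665, 748, 884, 1210,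
    1292, 2210, 2890, 3230, 3575, 4675, 8075], E3 [2] [5] [11] [17] 2 2),
  ([2, 33, 77, 119, 286], E3 [2] [5] [11] [17] 2 3),
  ([4, 9, 21, 25, 49, 121, 209, 238, 255, 289, 484, 572, 595, 1156, 1210, 2090, 3025, 3575, 4675,
    8075], E3 [2] [5] [11] [17] 3 3)]

/-- The element `g` of the quotient ideal, with constant term one. -/
def gOne : List ℕ := [1, 9, 10, 16, 21, 40, 49, 66, 165, 169, 187, 195, 238, 255, 289, 884, 1430,
  2210, 3025]

/-- Certificate for `a² x² g`. -/
def certB : List (List ℕ × List ℕ) := [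
  ([9, 10, 16, 21, 25, 49, 84, 100, 121, 143, 165, 182, 187, 195, 210, 289, 455, 484, 490, 665, 748,
    836, 1292, 1430, 1870, 2210, 3025, 4675, 5225, 5525, 7225, 8075], E1 [2] [5] [11] [17] 0 0),
  ([2, 5, 42, 91, 119, 132, 133, 204, 242, 476, 578, 605, 646, 715, 935, 1045, 1105, 1190, 1615,
    2975], E1 [2] [5] [11] [17] 0 1),
  ([21, 36, 49, 66, 78, 84, 114, 165, 187, 196, 225, 238, 266, 285, 289, 323, 490, 572, 665, 952,
    1156, 1292, 1430, 1650, 1870, 2210, 2550, 2890, 3025, 3575, 3850, 4125, 4675, 5225, 5950, 8075],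
    E1 [2] [5] [11] [17] 1 1),
  ([6], E1 [2] [5] [11] [17] 1 2),
  ([55], E1 [2] [5] [11] [17] 1 3),
  ([6, 11, 14, 15, 17, 35, 52, 56, 60, 76, 110, 130, 325, 350, 375, 425, 475], E1 [2] [5] [11] [17]
    2 1),
  ([1, 4, 9, 21, 25, 36, 49, 66, 84, 90, 143, 154, 165, 182, 187, 195, 221, 255, 289, 323, 361, 385,
    455, 484, 572, 665, 836, 1210, 2090, 5525, 8075], E1 [2] [5] [11] [17] 2 2),
  ([33, 39, 51, 57, 119, 1045, 1235], E1 [2] [5] [11] [17] 2 3),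
  ([7, 34], E1 [2] [5] [11] [17] 3 1),
  ([36, 84, 169, 210, 238, 572, 595, 1156, 1210, 1292, 1430, 1870, 2890, 3230, 5525], E1 [2] [5]
    [11] [17] 3 3),
  ([17, 52, 275, 325], E2 [2] [5] [11] [17] 1 1),
  ([1, 16, 21, 25, 36, 84, 100, 114, 169, 182, 195, 209, 221, 238, 255, 266, 455, 572, 595, 1292,
    1870, 2090, 2890, 3025, 3230, 5525, 7225], E2 [2] [5] [11] [17] 1 2),
  ([8, 39, 77, 91, 98, 105, 119, 125, 133, 242, 442, 605, 646, 1235, 1615], E2 [2] [5] [11] [17] 1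
    3),
  ([1, 4, 21, 25, 78, 102, 114, 143, 182, 187, 209, 266, 289, 323, 385, 884, 1292, 2090, 2210, 2890,
    3575, 4675, 5525], E2 [2] [5] [11] [17] 2 1),
  ([6, 11, 13, 14, 19, 24, 56, 110, 130, 140, 176, 272, 440, 680, 1100], E2 [2] [5] [11] [17] 2 2),
  ([3, 12, 26, 28, 30, 38, 55, 95], E2 [2] [5] [11] [17] 2 3),
  ([10, 154, 182, 455], E2 [2] [5] [11] [17] 3 0),
  ([2, 5, 8, 18, 51, 57, 91, 98, 125, 133, 1235], E2 [2] [5] [11] [17] 3 1),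
  ([3, 26, 38], E2 [2] [5] [11] [17] 3 2),
  ([13, 14, 15, 35], E2 [2] [5] [11] [17] 3 3),
  ([5, 91, 119, 1045, 1105, 1235], E3 [2] [5] [11] [17] 1 0),
  ([1, 4, 9, 21, 49, 78, 90, 102, 121, 143, 169, 182, 187, 209, 225, 264, 285, 289, 361, 455, 484,
    525, 665, 1020, 1210, 1430, 1540, 1650, 1870, 2550, 5525, 6375, 8075], E3 [2] [5] [11] [17] 1
    1),
  ([6, 13, 17, 19, 76, 130, 475], E3 [2] [5] [11] [17] 1 2),
  ([3, 7], E3 [2] [5] [11] [17] 1 3),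
  ([7], E3 [2] [5] [11] [17] 2 0),
  ([6, 17, 35, 52, 325, 425], E3 [2] [5] [11] [17] 2 1),
  ([1, 4, 9, 10, 16, 21, 36, 84, 90, 100, 102, 121, 154, 169, 195, 196, 210, 221, 225, 238, 247,
    255, 285, 323, 455, 490, 525, 595, 616, 665, 1020, 1210, 1292, 1540, 1650, 2380, 3025, 3230,
    5225, 5950, 6375], E3 [2] [5] [11] [17] 2 2),
  ([33, 51, 57, 119, 133, 245, 715, 825, 1045, 2975], E3 [2] [5] [11] [17] 2 3),
  ([19], E3 [2] [5] [11] [17] 3 0),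
  ([1, 114, 169, 209, 238, 285, 595, 952, 2550, 5950], E3 [2] [5] [11] [17] 3 3),
  ([1, 9, 16, 21, 40, 66, 84, 100, 114, 143, 165, 169, 209, 225, 238, 247, 250, 266, 285, 289, 361,
    385, 572, 595, 616, 1430, 1650, 2090, 2210, 2890, 3575, 4125, 4675, 5225, 6375, 7225, 8075],
    tgtA)]

/-- Certificate for `a v` when `c = x = 0`. -/
def certC : List (List ℕ × List ℕ) := [
  ([7, 22, 38], E1 [2] [] [11] [] 0 0),
  ([3], E1 [2] [] [11] [] 1 1),
  ([2], E1 [2] [] [11] [] 1 2),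
  ([3], E2 [2] [] [11] [] 1 2),
  ([3, 22], E2 [2] [] [11] [] 2 1),
  ([88], E3 [2] [] [11] [] 3 3)]

/-- Certificate for `v` when `a = c = x = 0`. -/
def certD : List (List ℕ × List ℕ) := [
  ([1, 121, 143], E2 [] [] [11] [] 1 1),
  ([13, 1859, 2299], E2 [] [] [11] [] 1 2),
  ([363, 1001], E2 [] [] [11] [] 2 0),
  ([1, 9, 169, 209], E2 [] [] [11] [] 2 2),
  ([39], E2 [] [] [11] [] 2 3),
  ([3], E2 [] [] [11] [] 3 1),
  ([3, 7], E3 [] [] [11] [] 1 0)]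

/-- Certificate for `a²` when `c = v = x = 0`. -/
def certE : List (List ℕ × List ℕ) := [
  ([49, 78, 182, 247], E1 [2] [] [] [] 1 1),
  ([13], E1 [2] [] [] [] 1 2),
  ([7], E1 [2] [] [] [] 2 0),
  ([117, 273], E1 [2] [] [] [] 2 1),
  ([247, 361], E1 [2] [] [] [] 2 2),
  ([7, 741, 1183], E1 [2] [] [] [] 3 1),
  ([19], E2 [2] [] [] [] 0 0),
  ([247, 361], E2 [2] [] [] [] 0 3),
  ([1729], E2 [2] [] [] [] 1 0),
  ([637, 1482, 3211, 3458, 4693], E2 [2] [] [] [] 1 1),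
  ([1, 9], E2 [2] [] [] [] 1 2),
  ([2, 57], E2 [2] [] [] [] 2 0),
  ([78], E2 [2] [] [] [] 2 1),
  ([6, 14, 52, 273, 637], E2 [2] [] [] [] 2 2),
  ([91], E2 [2] [] [] [] 3 1),
  ([3], E2 [2] [] [] [] 3 2),
  ([13], E3 [2] [] [] [] 0 3),
  ([1], E3 [2] [] [] [] 1 1),
  ([3211, 4693], E3 [2] [] [] [] 1 2),
  ([7], E3 [2] [] [] [] 2 0),
  ([6, 14, 637], E3 [2] [] [] [] 2 1),
  ([1, 988], E3 [2] [] [] [] 2 2)]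

theorem certA_ok : certOK tgtA certA = true := by decide +kernel

theorem certB_ok : certOK (mulP [1156] gOne) certB = true := by decide +kernel

theorem certC_ok : certOK [22] certC = true := by decide +kernel

theorem certD_ok : certOK [11] certD = true := by decide +kernel

theorem certE_ok : certOK [4] certE = true := by decide +kernel

/-! ### From the ideal to the checker -/

/-- The assignment of ring elements to primes given by a point. -/
def env {S : Type*} [CommRing S] (p : Fin 8 → S) (q : ℕ) : S :=
  if q = 2 then p 0 else if q = 3 then p 1 else if q = 5 then p 2 else if q = 7 then p 3
  else if q = 11 then p 4 else if q = 13 then p 5 else if q = 17 then p 6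
  else if q = 19 then p 7 else 0

theorem evP_prime {S : Type*} [CommRing S] (r : ℕ → S) {q : ℕ} (hq : q.Prime) :
    evP r [q] = r q := by
  simp [evP, evM_prime r hq]

theorem map_env {S S' : Type*} [CommRing S] [CommRing S'] (f : S →+* S') (p : Fin 8 → S) :
    (fun q => f (env p q)) = env fun i => f (p i) := by
  funext q
  simp only [env]
  split_ifs <;> simp

theorem det_EX {S : Type*} [CommRing S] (a b v w : S) : (EX a b v w).det = 1 := by
  simp [EX, Matrix.det_succ_row_zero, Fin.sum_univ_succ, Fin.succAbove]
  ring

theorem adjugate_EX {S : Type*} [CommRing S] [CharP S 2] (a b v w : S) :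
    (EX a b v w).adjugate = EXi a b v w := by
  calc (EX a b v w).adjugate = (EX a b v w).adjugate * (EX a b v w * EXi a b v w) := by
        rw [EX_mul_EXi, mul_one]
    _ = EXi a b v w := by
        rw [← mul_assoc, Matrix.adjugate_mul, det_EX, one_smul, one_mul]

theorem Tmat_mul_Smat (a b v w : SuzukiRing) : Tmat * Smat a b v w = EX a b v w := by
  ext i j
  fin_cases i <;> fin_cases j <;>
    simp [Tmat, Smat, EX, Matrix.mul_apply, Fin.sum_univ_four] <;> ring

instance charP_suzukiRing : CharP SuzukiRing 2 :=
  charP_of_injective_algebraMap (MvPolynomial.C_injective (Fin 8) (ZMod 2)) 2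

theorem map_EX {S S' : Type*} [CommRing S] [CommRing S'] (f : S →+* S') (a b v w : S) :
    f.mapMatrix (EX a b v w) = EX (f a) (f b) (f v) (f w) := by
  ext i j
  fin_cases i <;> fin_cases j <;> simp [EX]

theorem map_EXi {S S' : Type*} [CommRing S] [CommRing S'] (f : S →+* S') (a b v w : S) :
    f.mapMatrix (EXi a b v w) = EXi (f a) (f b) (f v) (f w) := by
  ext i j
  fin_cases i <;> fin_cases j <;> simp [EXi]

/-- A ring homomorphism killing `IV` makes all coded forms vanish. -/
theorem forms_of_hom {S : Type*} [CommRing S] [CharP S 2] (f : SuzukiRing →+* S)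
    (hf : ∀ g ∈ IV, f g = 0) (r : ℕ → S) (a c v x : List ℕ)
    (ha : evP r a = f (X 0)) (hb : evP r [3] = f (X 1)) (hc : evP r c = f (X 2))
    (hd : evP r [7] = f (X 3)) (hv : evP r v = f (X 4)) (hw : evP r [13] = f (X 5))
    (hx : evP r x = f (X 6)) (hy : evP r [19] = f (X 7)) :
    (∀ i j, evP r (E1 a c v x i j) = 0) ∧ (∀ i j, evP r (E2 a c v x i j) = 0) ∧
      (∀ i j, evP r (E3 a c v x i j) = 0) := by
  refine forms_vanish r a c v x (f.mapMatrix Xmat) (f.mapMatrix Xmat.adjugate)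
    (f.mapMatrix Ymat) (f.mapMatrix Ymat.adjugate) ?_ ?_ ?_ ?_ ?_
  · rw [Xmat, Tmat_mul_Smat, map_EX, ha, hb, hv, hw]
  · rw [Xmat, Tmat_mul_Smat, adjugate_EX, map_EXi, ha, hb, hv, hw]
  · rw [Ymat, Tmat_mul_Smat, map_EX, hc, hd, hx, hy]
  · rw [Ymat, Tmat_mul_Smat, adjugate_EX, map_EXi, hc, hd, hx, hy]
  · rw [← sub_eq_zero]
    simp only [← map_mul, ← map_sub]
    ext i j
    exact hf _ (Ideal.subset_span ⟨(i, j), rfl⟩)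

/-- The element `g` lies in the quotient ideal. -/
theorem gOne_mem : (X 0 : SuzukiRing) ^ 3 * (X 6) ^ 2 * evP (env X) gOne ∈ IV := by
  by_cases htop : IV = ⊤
  · rw [htop]; trivial
  have : Nontrivial (SuzukiRing ⧸ IV) := Ideal.Quotient.nontrivial_iff.mpr htop
  have : CharP (SuzukiRing ⧸ IV) 2 :=
    charP_of_injective_algebraMap (algebraMap (ZMod 2) (SuzukiRing ⧸ IV)).injective 2
  set f : SuzukiRing →+* SuzukiRing ⧸ IV := Ideal.Quotient.mk IV
  have hr := map_env f (X : Fin 8 → SuzukiRing)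
  set r := env fun i => f (X i : SuzukiRing) with hrdef
  obtain ⟨h1, h2, h3⟩ := forms_of_hom f (fun g hg => Ideal.Quotient.eq_zero_iff_mem.mpr hg) r
    [2] [5] [11] [17]
    (by rw [evP_prime _ (by norm_num)]; rfl) (by rw [evP_prime _ (by norm_num)]; rfl)
    (by rw [evP_prime _ (by norm_num)]; rfl) (by rw [evP_prime _ (by norm_num)]; rfl)
    (by rw [evP_prime _ (by norm_num)]; rfl) (by rw [evP_prime _ (by norm_num)]; rfl)
    (by rw [evP_prime _ (by norm_num)]; rfl) (by rw [evP_prime _ (by norm_num)]; rfl)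
  have hA : evP r tgtA = 0 := by
    apply evP_of_certOK r _ _ certA_ok
    simp only [certA, List.forall_mem_cons, h1, h2, h3, true_and]
    simp
  have hB : evP r (mulP [1156] gOne) = 0 := by
    apply evP_of_certOK r _ _ certB_ok
    simp only [certB, List.forall_mem_cons, h1, h2, h3, hA, true_and]
    simp
  rw [evP_mulP] at hB
  have hm : evP r [1156] = f (X 0) ^ 2 * f (X 6) ^ 2 := by
    have : (1156 : ℕ) = 2 * 2 * (17 * 17) := by norm_num
    simp only [evP, List.map_cons, List.map_nil, List.sum_cons, List.sum_nil, add_zero]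
    rw [this, evM_mul, evM_mul, evM_mul, evM_prime _ (by norm_num), evM_prime _ (by norm_num)]
    simp only [hrdef, env]
    norm_num
    ring
  rw [← Ideal.Quotient.eq_zero_iff_mem]
  change f _ = 0
  rw [map_mul, map_mul, map_pow, map_pow, map_evP, hr]
  rw [hm] at hB
  linear_combination f (X 0) * hB

theorem evM_zero_env {S : Type*} [CommRing S] (m : ℕ) :
    evM (fun _ => (0 : S)) m = if m = 1 then 1 else 0 := by
  split_ifs with h
  · rw [h, evM_one]
  · obtain ⟨q, hq, k, rfl⟩ := Nat.exists_prime_and_dvd h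
    rw [evM_mul, evM_prime _ hq, zero_mul]

/-! ### The operator and the fixed points -/

theorem alphaOp_two {k : Type*} [CommRing k] (p : Fin 8 → k) :
    alphaOp (alphaOp p) = fun i => p i ^ 2 := by
  funext i
  fin_cases i <;> simp [alphaOp]

theorem alphaOp_even {k : Type*} [CommRing k] (p : Fin 8 → k) (m : ℕ) :
    alphaOp^[2 * m] p = fun i => p i ^ 2 ^ m := by
  induction m with
  | zero => simp
  | succ m ih =>
    rw [show 2 * (m + 1) = (2 * m).succ.succ by omega, Function.iterate_succ_apply',
      Function.iterate_succ_apply', ih, alphaOp_two]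
    funext i
    rw [← pow_mul, pow_succ]

/-- `t² + t + 1` has no root fixed by an odd power of Frobenius. -/
theorem no_cube_root {k : Type*} [Field k] [CharP k 2] (t : k) (m : ℕ)
    (ht : t ^ 2 + t + 1 = 0) (hfix : t ^ 2 ^ (2 * m + 1) = t) : False := by
  have h2 : (2 : k) = 0 := CharTwo.two_eq_zero
  have h4 : t ^ 4 = t := by
    linear_combination (t ^ 2 - t) * ht
  have hev : ∀ j : ℕ, t ^ 2 ^ (2 * j) = t := by
    intro j
    induction j with
    | zero => simp
    | succ j ih =>
      rw [show 2 ^ (2 * (j + 1)) = 2 ^ (2 * j) * 4 by ring, pow_mul, ih, h4]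
  rw [pow_succ, pow_mul, hev] at hfix
  have : (1 : k) = 0 := by linear_combination ht - hfix - t * h2
  exact one_ne_zero this

theorem norm_form_zero {k : Type*} [Field k] [CharP k 2] (s t : k) (m : ℕ)
    (h : s ^ 2 + s * t + t ^ 2 = 0) (hs : s ^ 2 ^ (2 * m + 1) = s)
    (ht : t ^ 2 ^ (2 * m + 1) = t) : s = 0 ∧ t = 0 := by
  by_cases ht0 : t = 0
  · subst ht0
    refine ⟨?_, rfl⟩
    have : s ^ 2 = 0 := by linear_combination h
    exact pow_eq_zero_iff (two_ne_zero) |>.mp this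
  · exfalso
    refine no_cube_root (s / t) m ?_ ?_
    · field_simp
      linear_combination h
    · rw [div_pow, hs, ht]

/-- A point of `V(IV)` with `c = x = 0` fixed by an odd power of Frobenius is the origin. -/
theorem origin_of_fixed {k : Type*} [Field k] [CharP k 2] (f : SuzukiRing →+* k)
    (p : Fin 8 → k) (hp : ∀ i, f (X i) = p i) (hf : ∀ g ∈ IV, f g = 0) (hc : p 2 = 0)
    (hx : p 6 = 0) (m : ℕ) (hfix : ∀ i, p i ^ 2 ^ (2 * m + 1) = p i) : p = 0 := by
  have e : ∀ (q : ℕ) (i : Fin 8), q.Prime → env p q = p i → evP (env p) [q] = f (X i) := by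
    intro q i hq h
    rw [evP_prime _ hq, h, hp]
  have z : ∀ i : Fin 8, p i = 0 → evP (env p) [] = f (X i) := by
    intro i h
    rw [evP_nil, hp, h]
  have h22 : evP (env p) [22] = p 0 * p 4 := by
    have : (22 : ℕ) = 2 * 11 := by norm_num
    simp only [evP, List.map_cons, List.map_nil, List.sum_cons, List.sum_nil, add_zero]
    rw [this, evM_mul, evM_prime _ (by norm_num), evM_prime _ (by norm_num)]
    rfl
  have h4 : evP (env p) [4] = p 0 * p 0 := by
    have : (4 : ℕ) = 2 * 2 := by norm_num
    simp only [evP, List.map_cons, List.map_nil, List.sum_cons, List.sum_nil, add_zero]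
    rw [this, evM_mul, evM_prime _ (by norm_num)]
    rfl
  have hav : p 0 * p 4 = 0 := by
    obtain ⟨h1, h2, h3⟩ := forms_of_hom f hf (env p) [2] [] [11] []
      (e 2 0 (by norm_num) rfl) (e 3 1 (by norm_num) rfl) (z 2 hc) (e 7 3 (by norm_num) rfl)
      (e 11 4 (by norm_num) rfl) (e 13 5 (by norm_num) rfl) (z 6 hx) (e 19 7 (by norm_num) rfl)
    rw [← h22]
    apply evP_of_certOK _ _ _ certC_ok
    simp only [certC, List.forall_mem_cons, h1, h2, h3, true_and]
    simp
  have hav' : p 0 = 0 ∧ p 4 = 0 := by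
    rcases mul_eq_zero.mp hav with h | h
    · refine ⟨h, ?_⟩
      obtain ⟨h1, h2, h3⟩ := forms_of_hom f hf (env p) [] [] [11] []
        (z 0 h) (e 3 1 (by norm_num) rfl) (z 2 hc) (e 7 3 (by norm_num) rfl)
        (e 11 4 (by norm_num) rfl) (e 13 5 (by norm_num) rfl) (z 6 hx)
        (e 19 7 (by norm_num) rfl)
      have h11 : evP (env p) [11] = p 4 := evP_prime _ (by norm_num)
      rw [← h11]
      apply evP_of_certOK _ _ _ certD_ok
      simp only [certD, List.forall_mem_cons, h2, h3, true_and]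
      simp
    · refine ⟨?_, h⟩
      obtain ⟨h1, h2, h3⟩ := forms_of_hom f hf (env p) [2] [] [] []
        (e 2 0 (by norm_num) rfl) (e 3 1 (by norm_num) rfl) (z 2 hc) (e 7 3 (by norm_num) rfl)
        (z 4 h) (e 13 5 (by norm_num) rfl) (z 6 hx) (e 19 7 (by norm_num) rfl)
      have : evP (env p) [4] = 0 := by
        apply evP_of_certOK _ _ _ certE_ok
        simp only [certE, List.forall_mem_cons, h1, h2, h3, true_and]
        simp
      rw [h4] at this
      exact mul_self_eq_zero.mp this
  obtain ⟨ha, hv⟩ := hav'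
  obtain ⟨h1, h2, h3⟩ := forms_of_hom f hf (env p) [] [] [] []
    (z 0 ha) (e 3 1 (by norm_num) rfl) (z 2 hc) (e 7 3 (by norm_num) rfl)
    (z 4 hv) (e 13 5 (by norm_num) rfl) (z 6 hx) (e 19 7 (by norm_num) rfl)
  have ev2 : ∀ s t : ℕ, evM (env p) (s * t) = evM (env p) s * evM (env p) t := evM_mul _
  have m3 : evM (env p) 3 = p 1 := evM_prime _ (by norm_num)
  have m7 : evM (env p) 7 = p 3 := evM_prime _ (by norm_num)
  have m13 : evM (env p) 13 = p 5 := evM_prime _ (by norm_num)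
  have m19 : evM (env p) 19 = p 7 := evM_prime _ (by norm_num)
  have hbd : p 1 ^ 2 + p 1 * p 3 + p 3 ^ 2 = 0 := by
    have : evP (env p) [3 * 3, 3 * 7, 7 * 7] = 0 := by
      apply evP_of_certOK _ _ [([1], E1 [] [] [] [] 2 2)] (by decide +kernel)
      simp only [List.forall_mem_cons, h1, true_and]
      simp
    simp only [evP_cons, evP_nil, ev2, m3, m7] at this
    linear_combination this
  have hwy : p 5 ^ 2 + p 5 * p 7 + p 7 ^ 2 = 0 := by
    have : evP (env p) [13 * 13, 13 * 19, 19 * 19] = 0 := by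
      apply evP_of_certOK _ _ [([1], E1 [] [] [] [] 2 2), ([1], E1 [] [] [] [] 3 3)]
        (by decide +kernel)
      simp only [List.forall_mem_cons, h1, true_and]
      simp
    simp only [evP_cons, evP_nil, ev2, m13, m19] at this
    linear_combination this
  obtain ⟨hb, hd⟩ := norm_form_zero _ _ m hbd (hfix 1) (hfix 3)
  obtain ⟨hw, hy⟩ := norm_form_zero _ _ m hwy (hfix 5) (hfix 7)
  funext i
  fin_cases i <;> simp [ha, hb, hc, hd, hv, hw, hx, hy]

/-- For `n` odd, `αⁿ` has no fixed point `p` on `S = V′ ∩ V(xc)`, where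
`V′` is the zero set of the ideal quotient `J = I_V : a³x²`. -/
theorem no_fixed_point_on_S (n : ℕ) (hodd : Odd n) (hpos : 0 < n) :
    ¬ ∃ p : Fin 8 → AlgebraicClosure (ZMod 2),
        (∀ g : SuzukiRing, (X 0) ^ 3 * (X 6) ^ 2 * g ∈ IV →
          MvPolynomial.aeval p g = 0) ∧
        p 6 * p 2 = 0 ∧
        alphaOp^[n] p = p := by
  rintro ⟨p, hJ, hxc, hfix⟩
  have : CharP (AlgebraicClosure (ZMod 2)) 2 :=
    charP_of_injective_algebraMap (algebraMap (ZMod 2) (AlgebraicClosure (ZMod 2))).injective 2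
  obtain ⟨m, rfl⟩ := hodd
  have hstep : alphaOp (fun i => p i ^ 2 ^ m) = p := by
    rw [← alphaOp_even, ← Function.iterate_succ_apply' alphaOp]
    exact hfix
  have hc : p 6 ^ 2 ^ m = p 2 := congrFun hstep 2
  have hx : (p 2 ^ 2 ^ m) ^ 2 = p 6 := congrFun hstep 6
  have hcx : p 2 = 0 ∧ p 6 = 0 := by
    rcases mul_eq_zero.mp hxc with h | h
    · refine ⟨?_, h⟩
      rw [← hc, h, zero_pow (by positivity)]
    · refine ⟨h, ?_⟩
      rw [← hx, h, zero_pow (by positivity), zero_pow (by norm_num)]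
  have hfrob : ∀ i, p i ^ 2 ^ (2 * m + 1) = p i := by
    intro i
    have h := alphaOp_even p (2 * m + 1)
    rw [two_mul (2 * m + 1), Function.iterate_add_apply, hfix, hfix] at h
    exact (congrFun h i).symm
  have hIV : ∀ g ∈ IV, (MvPolynomial.aeval p : SuzukiRing →ₐ[ZMod 2] _).toRingHom g = 0 :=
    fun g hg => hJ g (Ideal.mul_mem_left _ _ hg)
  have hp0 : p = 0 := origin_of_fixed (MvPolynomial.aeval p).toRingHom p
    (fun i => MvPolynomial.aeval_X p i) hIV hcx.1 hcx.2 m hfrob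
  have hg := hJ _ gOne_mem
  have hg' := map_evP (MvPolynomial.aeval p : SuzukiRing →ₐ[ZMod 2] _).toRingHom
    (env (X : Fin 8 → SuzukiRing)) gOne
  have hz : (fun q => (MvPolynomial.aeval p : SuzukiRing →ₐ[ZMod 2] _).toRingHom
      (env (X : Fin 8 → SuzukiRing) q)) = fun _ => 0 := by
    rw [map_env]
    funext q
    have : ∀ i, (MvPolynomial.aeval p : SuzukiRing →ₐ[ZMod 2] _).toRingHom (X i) = 0 := by
      intro i
      change MvPolynomial.aeval p (X i) = 0
      rw [MvPolynomial.aeval_X, hp0]; rfl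
    simp only [env, this]
    simp
  rw [hz] at hg'
  have h1 : evP (fun _ => (0 : AlgebraicClosure (ZMod 2))) gOne = 1 := by
    simp only [gOne, evP_cons, evP_nil, evM_zero_env]
    norm_num
  rw [h1] at hg'
  exact one_ne_zero (hg'.symm.trans hg)

end
end

section
/- Let n = 2m+1 be an odd integer with n ≥ 3 and let F_q be the field with q = 2ⁿ elements. Then there exist a, b, c, d ∈ F_q, not all zero, such that the invertible 4×4 matrices x = T·U(a,b) and y = T·U(c,d) over F_q satisfy x⁻¹yx⁻¹y⁻¹x² = yx⁻²y⁻¹xy⁻¹. (Equivalently, the equation u₁(x,y) = u₂(x,y) has a non-trivial solution in the Suzuki group Sz(q).) -/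
set_option linter.unusedVariables false
set_option linter.unusedSimpArgs false


lemma sz_sum_pow {F : Type*} [Field F] [Fintype F] [CharP F 2] (N : ℕ) (hN : 0 < N) :
    ∑ x : F, x ^ N = if (Fintype.card F - 1) ∣ N then (1 : F) else 0 := by
  classical
  have h := FiniteField.sum_pow_units F N
  have h2 : ∑ x : F, x ^ N = ∑ x : Fˣ, (x ^ N : F) := by
    rw [← Finset.sum_subset (Finset.subset_univ (Finset.univ.map ⟨((↑) : Fˣ → F), Units.val_injective⟩))]
    · simp
    · intro x _ hx
      have : x = 0 := by
        by_contra h0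
        apply hx
        simp only [Finset.mem_map, Finset.mem_univ, true_and, Function.Embedding.coeFn_mk]
        exact ⟨Units.mk0 x h0, rfl⟩
      rw [this, zero_pow hN.ne']
  rw [h2, h]
  have : (-1 : F) = 1 := CharTwo.neg_eq 1
  simp [this]

lemma sz_res (m c i J : ℕ) (hc2 : c < 2 ^ (2 * m + 1) - 1)
    (hi : i < 2 ^ m) (hJ : 1 ≤ J) (hJ2 : J ≤ 2 * m + 1)
    (hd : (2 ^ (2 * m + 1) - 1) ∣ i * 2 ^ J + (2 ^ (2 * m + 1) - 1 - c)) :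
    (J ≤ m + 1 ∧ i * 2 ^ J = c) ∨
    (∃ k w, 1 ≤ k ∧ J = m + 1 + k ∧ m = w + k ∧ i / 2 ^ w < 2 ^ k ∧
      i / 2 ^ w + (i % 2 ^ w) * 2 ^ (m + 1 + k) = c) := by
  set Q := 2 ^ (2 * m + 1) - 1 with hQ
  have hQ1 : Q + 1 = 2 ^ (2 * m + 1) := by
    have : 0 < 2 ^ (2 * m + 1) := by positivity
    omega
  -- residue statement
  have key : ∀ A : ℕ, A < Q → (A ≡ i * 2 ^ J [MOD Q]) → A = c := by
    intro A hA hmod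
    have h1 : Q ∣ A + (Q - c) := by
      have : A + (Q - c) ≡ i * 2 ^ J + (Q - c) [MOD Q] := Nat.ModEq.add_right _ hmod
      exact (Nat.ModEq.dvd_iff this (dvd_refl Q)).mpr hd
    obtain ⟨k, hk⟩ := h1
    have : k = 1 := by
      have h0 : 0 < A + (Q - c) := by omega
      rcases k with _ | _ | k
      · simp at hk; omega
      · rfl
      · exfalso
        have : Q * (k + 1 + 1) = Q * k + Q + Q := by ring
        have h3 : 0 ≤ Q * k := Nat.zero_le _
        omega
    subst this
    omega
  by_cases hJm : J ≤ m + 1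
  · have hlt : i * 2 ^ J < Q := by
      have h1 : (i + 1) * 2 ^ J ≤ 2 ^ m * 2 ^ (m + 1) :=
        Nat.mul_le_mul hi (Nat.pow_le_pow_right (by norm_num) hJm)
      have h2 : 2 ^ m * 2 ^ (m + 1) = 2 ^ (2 * m + 1) := by rw [← pow_add]; congr 1; ring
      have h3 : 2 ^ 1 ≤ 2 ^ J := Nat.pow_le_pow_right (by norm_num) hJ
      have h4 : (i + 1) * 2 ^ J = i * 2 ^ J + 2 ^ J := by ring
      omega
    exact Or.inl ⟨hJm, key _ hlt (Nat.ModEq.refl _)⟩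
  · obtain ⟨k, rfl⟩ : ∃ k, J = m + 1 + k := ⟨J - (m + 1), by omega⟩
    obtain ⟨w, hw⟩ : ∃ w, m = w + k := ⟨m - k, by omega⟩
    set i1 := i / 2 ^ w
    set i0 := i % 2 ^ w
    have hi' : i = 2 ^ w * i1 + i0 := (Nat.div_add_mod i (2 ^ w)).symm
    have hi0 : i0 < 2 ^ w := Nat.mod_lt _ (by positivity)
    have hi1 : i1 < 2 ^ k := by
      apply Nat.div_lt_of_lt_mul
      rw [← pow_add, ← hw]; exact hi
    have e1 : i * 2 ^ (m + 1 + k) = i1 * (Q + 1) + i0 * 2 ^ (m + 1 + k) := by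
      rw [hQ1]
      conv_lhs => rw [hi']
      have : 2 ^ (2 * m + 1) = 2 ^ w * 2 ^ (m + 1 + k) := by
        rw [← pow_add]; congr 1; omega
      rw [this]; ring
    have hmod : i1 + i0 * 2 ^ (m + 1 + k) ≡ i * 2 ^ (m + 1 + k) [MOD Q] := by
      rw [e1]
      apply Nat.ModEq.add_right
      have : i1 * (Q + 1) = i1 + Q * i1 := by ring
      rw [this]
      exact (Nat.ModEq.symm (by simp [Nat.ModEq]))
    have hkm : 2 ^ k ≤ 2 ^ m := Nat.pow_le_pow_right (by norm_num) (by omega)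
    have hmk : 2 ^ m * 2 ≤ 2 ^ (m + 1 + k) := by
      rw [← pow_succ]; exact Nat.pow_le_pow_right (by norm_num) (by omega)
    have hlt : i1 + i0 * 2 ^ (m + 1 + k) < Q := by
      have h1 : (i0 + 1) * 2 ^ (m + 1 + k) ≤ 2 ^ w * 2 ^ (m + 1 + k) :=
        Nat.mul_le_mul_right _ hi0
      have h2 : 2 ^ w * 2 ^ (m + 1 + k) = 2 ^ (2 * m + 1) := by
        rw [← pow_add]; congr 1; omega
      have h4 : (i0 + 1) * 2 ^ (m + 1 + k) = i0 * 2 ^ (m + 1 + k) + 2 ^ (m + 1 + k) := by ring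
      have : 0 < 2 ^ m := by positivity
      omega
    exact Or.inr ⟨k, w, by omega, rfl, hw, hi1, key _ hlt hmod⟩

lemma sz_N1 (m c i J : ℕ) (hm : 2 ≤ m) (hc : 2 ^ m ≤ c) (hc2 : c < 2 ^ (m + 2))
    (hodd : c % 2 = 1) (hi : i < 2 ^ m) (hJ : 1 ≤ J) (hJ2 : J ≤ 2 * m + 1) :
    ¬ (2 ^ (2 * m + 1) - 1) ∣ i * 2 ^ J + (2 ^ (2 * m + 1) - 1 - c) := by
  intro hd
  have hc3 : c < 2 ^ (2 * m + 1) - 1 := by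
    have : 2 ^ (m + 2) ≤ 2 ^ (2 * m) :=
      Nat.pow_le_pow_right (by norm_num) (by omega)
    have h5 : 2 ^ (2 * m + 1) = 2 * 2 ^ (2 * m) := by ring
    omega
  rcases sz_res m c i J hc3 hi hJ hJ2 hd with ⟨-, h⟩ | ⟨k, w, hk, hJk, hmk, hlt, h⟩
  · have h5 : 2 ∣ i * 2 ^ J := Dvd.dvd.mul_left (dvd_pow_self 2 (by omega)) i
    omega
  · have hkm : 2 ^ k ≤ 2 ^ m := Nat.pow_le_pow_right (by norm_num) (by omega)
    rcases Nat.eq_zero_or_pos (i % 2 ^ w) with h0 | h0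
    · rw [h0] at h; omega
    · have h1 : 1 * 2 ^ (m + 2) ≤ (i % 2 ^ w) * 2 ^ (m + 1 + k) :=
        Nat.mul_le_mul h0 (Nat.pow_le_pow_right (by norm_num) (by omega))
      have h2 : (i % 2 ^ w) * 2 ^ (m + 1 + k) ≤ c := h ▸ Nat.le_add_left _ _
      rw [one_mul] at h1
      exact absurd (lt_of_lt_of_le hc2 (h1.trans h2)) (lt_irrefl _)

lemma sz_N2 (m J : ℕ) (hm : 2 ≤ m) (hJ : 1 ≤ J) (hJ2 : J ≤ 2 * m + 1) :
    (2 ^ (2 * m + 1) - 1) ∣ (2 ^ m - 1) * 2 ^ J + (2 ^ (2 * m + 1) - 1 - (2 ^ m - 1) * 2) ↔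
      J = 1 := by
  have h2m : 2 ^ 2 ≤ 2 ^ m := Nat.pow_le_pow_right (by norm_num) hm
  have hc3 : (2 ^ m - 1) * 2 < 2 ^ (2 * m + 1) - 1 := by
    have h5 : 2 ^ (2 * m + 1) = 2 ^ m * 2 ^ m * 2 := by ring
    have : 2 ^ m * 1 ≤ 2 ^ m * 2 ^ m := Nat.mul_le_mul_left _ (by omega)
    omega
  constructor
  · intro hd
    rcases sz_res m _ _ J hc3 (by omega) hJ hJ2 hd with ⟨-, h⟩ | ⟨k, w, hk, hJk, hmk, hlt, h⟩
    · have h1 : 2 ^ J = 2 := Nat.eq_of_mul_eq_mul_left (by omega) h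
      have h2 : 2 ^ J = 2 ^ 1 := by rw [h1, pow_one]
      exact Nat.pow_right_injective (le_refl 2) h2
    · exfalso
      have hw : 0 < 2 ^ w := by positivity
      have hk0 : 0 < 2 ^ k := by positivity
      have hpw : 2 ^ m = 2 ^ w * 2 ^ k := by rw [← pow_add, ← hmk]
      have e1 : (2 ^ m - 1) / 2 ^ w = 2 ^ k - 1 := by
        apply Nat.div_eq_of_lt_le
        · rw [Nat.sub_mul, hpw, Nat.mul_comm (2 ^ k)]; omega
        · rw [Nat.sub_add_cancel hk0, Nat.mul_comm, ← hpw]; omega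
      rw [e1] at h
      have h5 : 2 ∣ ((2 ^ m - 1) % 2 ^ w) * 2 ^ (m + 1 + k) :=
        Dvd.dvd.mul_left (dvd_pow_self 2 (by omega)) _
      have h6 : 2 ∣ 2 ^ k := dvd_pow_self 2 (by omega)
      omega
  · rintro rfl
    rw [pow_one, Nat.add_sub_cancel' hc3.le]


lemma sz_geom {F : Type*} [Field F] [CharP F 2] (m : ℕ) (hm : 1 ≤ m) (r : F) :
    (r + 1) ^ (2 ^ m - 1) = ∑ i ∈ Finset.range (2 ^ m), r ^ i := by
  have h2 : 2 ^ 1 ≤ 2 ^ m := Nat.pow_le_pow_right (by norm_num) hm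
  by_cases hr : r = 1
  · subst hr
    have : (1 + 1 : F) = 0 := CharTwo.add_self_eq_zero 1
    rw [this, zero_pow (by omega)]
    simp only [one_pow, Finset.sum_const, Finset.card_range, nsmul_eq_mul, mul_one]
    push_cast
    rw [CharTwo.two_eq_zero, zero_pow (by omega)]
  · have h0 : r + 1 ≠ 0 := by
      intro h; apply hr; rwa [CharTwo.add_eq_zero] at h
    apply mul_right_cancel₀ h0
    rw [← pow_succ, Nat.sub_add_cancel (by omega), ← CharTwo.sub_eq_add r 1, geom_sum_mul,
      CharTwo.sub_eq_add, CharTwo.sub_eq_add, add_pow_char_pow, one_pow]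

lemma sz_W {F : Type*} [Field F] [Fintype F] [CharP F 2] (m : ℕ) (hm : 2 ≤ m)
    (hcard : Fintype.card F = 2 ^ (2 * m + 1)) (J : ℕ) (hJ : 1 ≤ J) (hJ2 : J ≤ 2 * m + 1) :
    ∑ r : F, ((r + 1) ^ (2 ^ m - 1)) ^ 2 ^ J *
      (r ^ (2 ^ (2 * m + 1) - 1 - (2 ^ (m + 1) - 3)) + r ^ (2 ^ (2 * m + 1) - 1 - (2 ^ (m + 2) - 3))
      + ((r + 1) ^ (2 ^ (2 * m + 1) - 1 - (2 ^ (m + 1) - 3)) +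
        (r + 1) ^ (2 ^ (2 * m + 1) - 1 - (2 ^ m - 1) * 2))) = if J = 1 then 1 else 0 := by
  have h2m : 2 ^ 2 ≤ 2 ^ m := Nat.pow_le_pow_right (by norm_num) hm
  have hm1 : 2 ^ (m + 1) = 2 ^ m * 2 := by ring
  have hm2 : 2 ^ (m + 2) = 2 ^ m * 4 := by ring
  have hmm : 2 ^ (2 * m + 1) = 2 ^ m * 2 ^ m * 2 := by ring
  have hmul : 2 ^ m * 4 ≤ 2 ^ m * 2 ^ m := Nat.mul_le_mul_left _ (by omega)
  have hS1 : ∀ c i, 2 ^ m ≤ c → c < 2 ^ (m + 2) → c % 2 = 1 → i < 2 ^ m →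
      ∑ r : F, r ^ (i * 2 ^ J + (2 ^ (2 * m + 1) - 1 - c)) = 0 := by
    intro c i h1 h2 h3 h4
    rw [sz_sum_pow _ (by omega), hcard, if_neg (sz_N1 m c i J hm h1 h2 h3 h4 hJ hJ2)]
  have hshift : ∀ f : F → F, ∑ r : F, f (r + 1) = ∑ r : F, f r := fun f =>
    Equiv.sum_comp (Equiv.addRight (1 : F)) f
  have hfirst : ∀ c, 2 ^ m ≤ c → c < 2 ^ (m + 2) → c % 2 = 1 →
      ∑ r : F, ((r + 1) ^ (2 ^ m - 1)) ^ 2 ^ J * r ^ (2 ^ (2 * m + 1) - 1 - c) = 0 := by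
    intro c h1 h2 h3
    have : ∀ r : F, ((r + 1) ^ (2 ^ m - 1)) ^ 2 ^ J * r ^ (2 ^ (2 * m + 1) - 1 - c) =
        ∑ i ∈ Finset.range (2 ^ m), r ^ (i * 2 ^ J + (2 ^ (2 * m + 1) - 1 - c)) := by
      intro r
      rw [sz_geom m (by omega), sum_pow_char_pow, Finset.sum_mul]
      apply Finset.sum_congr rfl
      intro i _
      rw [pow_add r, pow_mul r]
    simp_rw [this]
    rw [Finset.sum_comm]
    apply Finset.sum_eq_zero
    intro i hi
    exact hS1 c i h1 h2 h3 (Finset.mem_range.mp hi)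
  have hsecond : ∀ e, ∑ r : F, ((r + 1) ^ (2 ^ m - 1)) ^ 2 ^ J * (r + 1) ^ e =
      ∑ r : F, r ^ ((2 ^ m - 1) * 2 ^ J + e) := by
    intro e
    rw [hshift (fun r => (r ^ (2 ^ m - 1)) ^ 2 ^ J * r ^ e)]
    apply Finset.sum_congr rfl
    intro r _
    rw [pow_add, pow_mul]
  simp_rw [mul_add, Finset.sum_add_distrib]
  rw [hfirst _ (by omega) (by omega) (by omega), hfirst _ (by omega) (by omega) (by omega),
    hsecond, hsecond, hS1 _ _ (by omega) (by omega) (by omega) (by omega),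
    sz_sum_pow _ (by omega), hcard]
  simp only [sz_N2 m J hm hJ hJ2, zero_add]

lemma sz_exists_pow {F : Type*} [Field F] [Fintype F] [CharP F 2] (m : ℕ) (hm : 2 ≤ m)
    (hcard : Fintype.card F = 2 ^ (2 * m + 1)) :
    ∃ r : F, ∑ j ∈ Finset.range (2 * m + 1),
      (r ^ (2 ^ (2 * m + 1) - 1 - (2 ^ (m + 1) - 3)) + r ^ (2 ^ (2 * m + 1) - 1 - (2 ^ (m + 2) - 3))
      + ((r + 1) ^ (2 ^ (2 * m + 1) - 1 - (2 ^ (m + 1) - 3)) +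
        (r + 1) ^ (2 ^ (2 * m + 1) - 1 - (2 ^ m - 1) * 2))) ^ 2 ^ j ≠ 0 := by
  by_contra! hcon
  set f : F → F := fun r => (r ^ (2 ^ (2 * m + 1) - 1 - (2 ^ (m + 1) - 3)) +
      r ^ (2 ^ (2 * m + 1) - 1 - (2 ^ (m + 2) - 3))
      + ((r + 1) ^ (2 ^ (2 * m + 1) - 1 - (2 ^ (m + 1) - 3)) +
        (r + 1) ^ (2 ^ (2 * m + 1) - 1 - (2 ^ m - 1) * 2))) with hf
  have hcon' : ∀ r, ∑ j ∈ Finset.range (2 * m + 1), f r ^ 2 ^ j = 0 := hcon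
  have h0 : ∑ r : F, (r + 1) ^ (2 ^ m - 1) * ∑ j ∈ Finset.range (2 * m + 1), f r ^ 2 ^ j = 0 := by
    apply Finset.sum_eq_zero
    intro r _
    rw [hcon', mul_zero]
  simp_rw [Finset.mul_sum] at h0
  rw [Finset.sum_comm] at h0
  have h1 : ∀ j ∈ Finset.range (2 * m + 1), ∑ r : F, (r + 1) ^ (2 ^ m - 1) * f r ^ 2 ^ j =
      if j = 2 * m then 1 else 0 := by
    intro j hj
    have hj' := Finset.mem_range.mp hj
    have hW := sz_W (F := F) m hm hcard (2 * m + 1 - j) (by omega) (by omega)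
    have : ∑ r : F, (r + 1) ^ (2 ^ m - 1) * f r ^ 2 ^ j =
        (∑ r : F, ((r + 1) ^ (2 ^ m - 1)) ^ 2 ^ (2 * m + 1 - j) * f r) ^ 2 ^ j := by
      rw [sum_pow_char_pow]
      apply Finset.sum_congr rfl
      intro r _
      rw [mul_pow, ← pow_mul _ (2 ^ (2 * m + 1 - j)), ← pow_add, Nat.sub_add_cancel hj'.le,
        ← hcard, FiniteField.pow_card]
    rw [this]
    simp only [hf]
    rw [hW]
    by_cases hjj : j = 2 * m
    · subst hjj; simp
    · rw [if_neg hjj, if_neg (by omega), zero_pow (by positivity)]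
  rw [Finset.sum_congr rfl h1] at h0
  simp at h0

lemma sz_th_th {F : Type*} [Field F] [Fintype F] (m : ℕ)
    (hcard : Fintype.card F = 2 ^ (2 * m + 1)) (z : F) :
    (z ^ 2 ^ (m + 1)) ^ 2 ^ (m + 1) = z ^ 2 := by
  rw [← pow_mul, ← pow_add, show m + 1 + (m + 1) = (2 * m + 1) + 1 by ring, pow_succ, pow_mul,
    ← hcard, FiniteField.pow_card]

lemma sz_half_trace {F : Type*} [Field F] [Fintype F] [CharP F 2] (m : ℕ)
    (hcard : Fintype.card F = 2 ^ (2 * m + 1)) (w : F)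
    (hw : ∑ j ∈ Finset.range (2 * m + 1), w ^ 2 ^ j = 0) :
    ∃ β : F, β + β ^ 2 ^ (m + 1) = w := by
  refine ⟨∑ i ∈ Finset.range m, (w ^ 2 ^ (m + 1)) ^ 2 ^ i, ?_⟩
  rw [sum_pow_char_pow]
  have h1 : ∀ i ∈ Finset.range m, ((w ^ 2 ^ (m + 1)) ^ 2 ^ i) ^ 2 ^ (m + 1) = w ^ 2 ^ (i + 1) := by
    intro i _
    rw [pow_right_comm, sz_th_th m hcard, ← pow_mul, pow_succ' 2 i]
  have h2 : ∀ i ∈ Finset.range m, (w ^ 2 ^ (m + 1)) ^ 2 ^ i = w ^ 2 ^ (m + 1 + i) := by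
    intro i _
    rw [← pow_mul, ← pow_add]
  rw [Finset.sum_congr rfl h1, Finset.sum_congr rfl h2]
  rw [show 2 * m + 1 = (m + 1) + m by ring, Finset.sum_range_add, Finset.sum_range_succ',
    pow_zero, pow_one] at hw
  have h3 : (w : F) + w = 0 := CharTwo.add_self_eq_zero w
  linear_combination hw - h3

lemma sz_tr_add {F : Type*} [Field F] [CharP F 2] (n : ℕ) (x y : F) :
    ∑ j ∈ Finset.range n, (x + y) ^ 2 ^ j =
      ∑ j ∈ Finset.range n, x ^ 2 ^ j + ∑ j ∈ Finset.range n, y ^ 2 ^ j := by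
  rw [← Finset.sum_add_distrib]
  apply Finset.sum_congr rfl
  intro j _
  rw [add_pow_char_pow]

lemma sz_tr_one {F : Type*} [Field F] [CharP F 2] (m : ℕ) :
    ∑ j ∈ Finset.range (2 * m + 1), (1 : F) ^ 2 ^ j = 1 := by
  have : (2 : F) = 0 := CharTwo.two_eq_zero
  simp [this]

lemma sz_tr_val {F : Type*} [Field F] [Fintype F] [CharP F 2] (m : ℕ)
    (hcard : Fintype.card F = 2 ^ (2 * m + 1)) (w : F)
    (hw : ∑ j ∈ Finset.range (2 * m + 1), w ^ 2 ^ j ≠ 0) :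
    ∑ j ∈ Finset.range (2 * m + 1), w ^ 2 ^ j = 1 := by
  set t := ∑ j ∈ Finset.range (2 * m + 1), w ^ 2 ^ j with ht
  have h : t ^ 2 = t := by
    have e1 : t ^ 2 = ∑ j ∈ Finset.range (2 * m + 1), w ^ 2 ^ (j + 1) := by
      rw [ht, sum_pow_char]
      apply Finset.sum_congr rfl
      intro j _
      rw [← pow_mul, ← pow_succ]
    have e2 : ∑ j ∈ Finset.range (2 * m + 1), w ^ 2 ^ (j + 1) + w ^ 2 ^ 0 = t + w ^ 2 ^ (2 * m + 1) := by
      rw [← Finset.sum_range_succ' (fun j => w ^ 2 ^ j), Finset.sum_range_succ]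
    rw [← hcard, FiniteField.pow_card, pow_zero, pow_one] at e2
    rw [e1]; exact add_right_cancel e2
  have h2 : t * (t - 1) = 0 := by linear_combination h
  rcases mul_eq_zero.mp h2 with h3 | h3
  · exact absurd h3 hw
  · exact sub_eq_zero.mp h3

lemma sz_exists_r {F : Type*} [Field F] [Fintype F] [CharP F 2] (m : ℕ) (hm : 1 ≤ m)
    (hcard : Fintype.card F = 2 ^ (2 * m + 1)) :
    ∃ r β : F, r ≠ 0 ∧ r + 1 ≠ 0 ∧ β + β ^ 2 ^ (m + 1) = 1 + (r ^ 3 / r ^ 2 ^ (m + 1) +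
      r ^ 3 / (r ^ 2 ^ (m + 1)) ^ 2 + ((r + 1) ^ 3 / (r ^ 2 ^ (m + 1) + 1) +
      (r + 1) ^ 2 / (r ^ 2 ^ (m + 1) + 1))) := by
  classical
  have two : (2 : F) = 0 := CharTwo.two_eq_zero
  suffices h : ∃ r : F, r ≠ 0 ∧ r + 1 ≠ 0 ∧ ∑ j ∈ Finset.range (2 * m + 1),
      (r ^ 3 / r ^ 2 ^ (m + 1) +
      r ^ 3 / (r ^ 2 ^ (m + 1)) ^ 2 + ((r + 1) ^ 3 / (r ^ 2 ^ (m + 1) + 1) +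
      (r + 1) ^ 2 / (r ^ 2 ^ (m + 1) + 1))) ^ 2 ^ j ≠ 0 by
    obtain ⟨r, h0, h1, h2⟩ := h
    have h3 := sz_tr_val m hcard _ h2
    obtain ⟨β, hβ⟩ := sz_half_trace m hcard (1 + (r ^ 3 / r ^ 2 ^ (m + 1) +
      r ^ 3 / (r ^ 2 ^ (m + 1)) ^ 2 + ((r + 1) ^ 3 / (r ^ 2 ^ (m + 1) + 1) +
      (r + 1) ^ 2 / (r ^ 2 ^ (m + 1) + 1)))) (by
        rw [sz_tr_add, h3, sz_tr_one]; exact CharTwo.add_self_eq_zero 1)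
    exact ⟨r, β, h0, h1, hβ⟩
  rcases Nat.lt_or_ge m 2 with hm2 | hm2
  · obtain rfl : m = 1 := by omega
    obtain ⟨r, hr⟩ : ∃ r : F, r ∉ ({0, 1} : Finset F) := by
      by_contra! hcon
      have h1 : (Finset.univ : Finset F) ⊆ {0, 1} := fun x _ => hcon x
      have h2 := Finset.card_le_card h1
      rw [Finset.card_univ, hcard] at h2
      have := h2.trans (Finset.card_le_two)
      norm_num at this
    simp only [Finset.mem_insert, Finset.mem_singleton, not_or] at hr
    obtain ⟨h0, h1⟩ := hr
    have h1' : r + 1 ≠ 0 := by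
      intro h; apply h1; rwa [CharTwo.add_eq_zero] at h
    refine ⟨r, h0, h1', ?_⟩
    have h8 : r ^ 8 = r := by
      have := FiniteField.pow_card r
      rw [hcard] at this
      simpa using this
    have h7 : r ^ 6 + r ^ 5 + r ^ 4 + r ^ 3 + r ^ 2 + r + 1 = 0 := by
      have : r * (r + 1) * (r ^ 6 + r ^ 5 + r ^ 4 + r ^ 3 + r ^ 2 + r + 1) = 0 := by grind
      simpa [h0, h1'] using this
    have hpc : ∀ z : F, z ≠ 0 → z ^ 7 = 1 := by
      intro z hz
      have := FiniteField.pow_card_sub_one_eq_one z hz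
      rw [hcard] at this
      simpa using this
    have k1 : ∀ z : F, z ≠ 0 → z ^ 3 / z ^ 4 = z ^ 6 := by
      intro z hz
      rw [div_eq_iff (pow_ne_zero _ hz)]
      linear_combination (-z ^ 3) * hpc z hz
    have k2 : ∀ z : F, z ≠ 0 → z ^ 3 / (z ^ 4) ^ 2 = z ^ 2 := by
      intro z hz
      rw [div_eq_iff (pow_ne_zero _ (pow_ne_zero _ hz))]
      linear_combination (-z ^ 3) * hpc z hz
    have k3 : ∀ z : F, z ≠ 0 → z ^ 2 / z ^ 4 = z ^ 5 := by
      intro z hz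
      rw [div_eq_iff (pow_ne_zero _ hz)]
      linear_combination (-z ^ 2) * hpc z hz
    have e4 : r ^ 4 + 1 = (r + 1) ^ 4 := by grind
    norm_num only [Finset.sum_range_succ, Finset.sum_range_zero]
    rw [e4, k1 r h0, k2 r h0, k1 _ h1', k3 _ h1']
    have hfac : (r ^ 3 + r + 1) * (r ^ 3 + r ^ 2 + 1) = 0 := by grind
    intro hz
    rcases mul_eq_zero.mp hfac with h | h
    · grind
    · grind
  · obtain ⟨r, hr⟩ := sz_exists_pow (F := F) m hm2 hcard
    have h2m : 2 ^ 2 ≤ 2 ^ m := Nat.pow_le_pow_right (by norm_num) hm2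
    have hp1 : 2 ^ (m + 1) = 2 ^ m * 2 := by ring
    have hp2 : 2 ^ (m + 2) = 2 ^ m * 4 := by ring
    have hmm : 2 ^ (2 * m + 1) = 2 ^ m * 2 ^ m * 2 := by ring
    have hmul : 2 ^ m * 4 ≤ 2 ^ m * 2 ^ m := Nat.mul_le_mul_left _ (by omega)
    have h0 : r ≠ 0 := by
      rintro rfl
      apply hr
      apply Finset.sum_eq_zero
      intro j _
      rw [zero_pow (by omega), zero_pow (by omega), zero_add, zero_add, zero_add, one_pow, one_pow,
        one_add_one_eq_two, two, zero_pow (by positivity)]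
    have h1 : r + 1 ≠ 0 := by
      intro h
      have : r = 1 := by rwa [CharTwo.add_eq_zero] at h
      subst this
      apply hr
      apply Finset.sum_eq_zero
      intro j _
      rw [h, zero_pow (by omega), zero_pow (by omega), add_zero, one_pow, one_pow, add_zero,
        h, zero_pow (by positivity)]
    refine ⟨r, h0, h1, ?_⟩
    have hpc : ∀ z : F, z ≠ 0 → z ^ (2 ^ (2 * m + 1) - 1) = 1 := by
      intro z hz; rw [← hcard]; exact FiniteField.pow_card_sub_one_eq_one z hz
    have k1 : ∀ z : F, z ≠ 0 → z ^ (2 ^ (2 * m + 1) - 1 - (2 ^ (m + 1) - 3)) =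
        z ^ 3 / z ^ 2 ^ (m + 1) := by
      intro z hz
      rw [eq_div_iff (pow_ne_zero _ hz), ← pow_add,
        show 2 ^ (2 * m + 1) - 1 - (2 ^ (m + 1) - 3) + 2 ^ (m + 1) = (2 ^ (2 * m + 1) - 1) + 3 by
          omega, pow_add, hpc z hz, one_mul]
    have k2 : ∀ z : F, z ≠ 0 → z ^ (2 ^ (2 * m + 1) - 1 - (2 ^ (m + 2) - 3)) =
        z ^ 3 / (z ^ 2 ^ (m + 1)) ^ 2 := by
      intro z hz
      rw [eq_div_iff (pow_ne_zero _ (pow_ne_zero _ hz)), ← pow_mul, ← pow_add,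
        show 2 ^ (2 * m + 1) - 1 - (2 ^ (m + 2) - 3) + 2 ^ (m + 1) * 2 =
          (2 ^ (2 * m + 1) - 1) + 3 by omega, pow_add, hpc z hz, one_mul]
    have k3 : ∀ z : F, z ≠ 0 → z ^ (2 ^ (2 * m + 1) - 1 - (2 ^ m - 1) * 2) =
        z ^ 2 / z ^ 2 ^ (m + 1) := by
      intro z hz
      rw [eq_div_iff (pow_ne_zero _ hz), ← pow_add,
        show 2 ^ (2 * m + 1) - 1 - (2 ^ m - 1) * 2 + 2 ^ (m + 1) = (2 ^ (2 * m + 1) - 1) + 2 by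
          omega, pow_add, hpc z hz, one_mul]
    rw [k1 r h0, k2 r h0, k1 _ h1, k3 _ h1, add_pow_char_pow, one_pow] at hr
    exact hr

lemma sz_mul4 {F : Type*} [Field F] {a00 a01 a02 a03 a10 a11 a12 a13 a20 a21 a22 a23 a30 a31 a32 a33 b00 b01 b02 b03 b10 b11 b12 b13 b20 b21 b22 b23 b30 b31 b32 b33 c00 c01 c02 c03 c10 c11 c12 c13 c20 c21 c22 c23 c30 c31 c32 c33 : F}
    (h00 : a00 * b00 + a01 * b10 + a02 * b20 + a03 * b30 = c00)
    (h01 : a00 * b01 + a01 * b11 + a02 * b21 + a03 * b31 = c01)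
    (h02 : a00 * b02 + a01 * b12 + a02 * b22 + a03 * b32 = c02)
    (h03 : a00 * b03 + a01 * b13 + a02 * b23 + a03 * b33 = c03)
    (h10 : a10 * b00 + a11 * b10 + a12 * b20 + a13 * b30 = c10)
    (h11 : a10 * b01 + a11 * b11 + a12 * b21 + a13 * b31 = c11)
    (h12 : a10 * b02 + a11 * b12 + a12 * b22 + a13 * b32 = c12)
    (h13 : a10 * b03 + a11 * b13 + a12 * b23 + a13 * b33 = c13)
    (h20 : a20 * b00 + a21 * b10 + a22 * b20 + a23 * b30 = c20)
    (h21 : a20 * b01 + a21 * b11 + a22 * b21 + a23 * b31 = c21)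
    (h22 : a20 * b02 + a21 * b12 + a22 * b22 + a23 * b32 = c22)
    (h23 : a20 * b03 + a21 * b13 + a22 * b23 + a23 * b33 = c23)
    (h30 : a30 * b00 + a31 * b10 + a32 * b20 + a33 * b30 = c30)
    (h31 : a30 * b01 + a31 * b11 + a32 * b21 + a33 * b31 = c31)
    (h32 : a30 * b02 + a31 * b12 + a32 * b22 + a33 * b32 = c32)
    (h33 : a30 * b03 + a31 * b13 + a32 * b23 + a33 * b33 = c33)
    : !![a00, a01, a02, a03; a10, a11, a12, a13; a20, a21, a22, a23; a30, a31, a32, a33] * !![b00, b01, b02, b03; b10, b11, b12, b13; b20, b21, b22, b23; b30, b31, b32, b33] = !![c00, c01, c02, c03; c10, c11, c12, c13; c20, c21, c22, c23; c30, c31, c32, c33] := by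
  ext i j
  fin_cases i <;> fin_cases j <;> simp [Matrix.mul_apply, Fin.sum_univ_four, h00, h01, h02, h03, h10, h11, h12, h13, h20, h21, h22, h23, h30, h31, h32, h33]

lemma sz_smul4 {F : Type*} [Field F] (t : F) {a00 a01 a02 a03 a10 a11 a12 a13 a20 a21 a22 a23 a30 a31 a32 a33 : F} :
    t • !![a00, a01, a02, a03; a10, a11, a12, a13; a20, a21, a22, a23; a30, a31, a32, a33] = !![t * a00, t * a01, t * a02, t * a03; t * a10, t * a11, t * a12, t * a13; t * a20, t * a21, t * a22, t * a23; t * a30, t * a31, t * a32, t * a33] := by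
  ext i j
  fin_cases i <;> fin_cases j <;> simp

lemma sz_one4 {F : Type*} [Field F] : (1 : Matrix (Fin 4) (Fin 4) F) = !![1 / 1, 0 / 1, 0 / 1, 0 / 1; 0 / 1, 1 / 1, 0 / 1, 0 / 1; 0 / 1, 0 / 1, 1 / 1, 0 / 1; 0 / 1, 0 / 1, 0 / 1, 1 / 1] := by
  ext i j
  fin_cases i <;> fin_cases j <;> simp

lemma sz_term {F : Type*} [Field F] {n d m e : F} (q E : F) (hE : E ≠ 0)
    (h : n * m = 0 ∨ d * e * q = E) : n / d * (m / e) = n * m * q / E := by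
  rcases h with h | h
  · rw [div_mul_div_comm, h]; simp
  · have h1 : d * e * q ≠ 0 := by rw [h]; exact hE
    have h2 : q ≠ 0 := right_ne_zero_of_mul h1
    rw [div_mul_div_comm, ← h, mul_div_mul_right _ _ h2]

lemma sz_entry {F : Type*} [Field F]
    {n0 d0 m0 e0 n1 d1 m1 e1 n2 d2 m2 e2 n3 d3 m3 e3 n d u v : F}
    (huv : u = v) (q0 q1 q2 q3 q E A : F)
    (H : E ≠ 0 ∧ (n0 * m0 = 0 ∨ d0 * e0 * q0 = E) ∧ (n1 * m1 = 0 ∨ d1 * e1 * q1 = E) ∧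
      (n2 * m2 = 0 ∨ d2 * e2 * q2 = E) ∧ (n3 * m3 = 0 ∨ d3 * e3 * q3 = E) ∧ d * q = E ∧
      n0 * m0 * q0 + n1 * m1 * q1 + n2 * m2 * q2 + n3 * m3 * q3 = n * q + A * (u - v)) :
    n0 / d0 * (m0 / e0) + n1 / d1 * (m1 / e1) + n2 / d2 * (m2 / e2) + n3 / d3 * (m3 / e3) =
      n / d := by
  obtain ⟨hE, h0, h1, h2, h3, h, key⟩ := H
  rw [sub_eq_zero.mpr huv, mul_zero, add_zero] at key
  rw [sz_term q0 E hE h0, sz_term q1 E hE h1, sz_term q2 E hE h2, sz_term q3 E hE h3,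
    ← add_div, ← add_div, ← add_div, key]
  have h1 : d * q ≠ 0 := by rw [h]; exact hE
  rw [← h, mul_div_mul_right _ _ (right_ne_zero_of_mul h1)]

lemma sz_entry_smul {F : Type*} [Field F]
    {n0 d0 m0 e0 n1 d1 m1 e1 n2 d2 m2 e2 n3 d3 m3 e3 n d u v t : F}
    (huv : u = v) (q0 q1 q2 q3 q E A : F)
    (H : E ≠ 0 ∧ (n0 * m0 = 0 ∨ d0 * e0 * q0 = E) ∧ (n1 * m1 = 0 ∨ d1 * e1 * q1 = E) ∧
      (n2 * m2 = 0 ∨ d2 * e2 * q2 = E) ∧ (n3 * m3 = 0 ∨ d3 * e3 * q3 = E) ∧ d * q = E ∧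
      n0 * m0 * q0 + n1 * m1 * q1 + n2 * m2 * q2 + n3 * m3 * q3 = t * n * q + A * (u - v)) :
    n0 / d0 * (m0 / e0) + n1 / d1 * (m1 / e1) + n2 / d2 * (m2 / e2) + n3 / d3 * (m3 / e3) =
      t * (n / d) := by
  rw [sz_entry huv q0 q1 q2 q3 q E A H, mul_div_assoc]

/-- Numerator of the entry (0, 0) of `szX`. -/
def szX00 {F : Type*} [Field F] (r s r1 s1 l p D Z h : F) : F :=
  (s^2+s^3+r^2*s^2+r^3+r^3*s+r^4)*p

/-- Square root of the rescaled conjugate of `x`. -/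
def szX {F : Type*} [Field F] (r s r1 s1 l p D Z h : F) :
    Matrix (Fin 4) (Fin 4) F :=
  !![szX00 r s r1 s1 l p D Z h / (r*D),
     h / (r*s*l*D*Z),
     r^2*r1*l / (s*Z),
     1 / 1;
     (r^2*s^2*r1*s1*l*p^2+p*h) / (r*D),
     s^2*s1*p^2 / (r*l*D),
     p / 1,
     0 / 1;
     r^2*r1*l^2 / 1,
     1 / 1,
     0 / 1,
     0 / 1;
     p / 1,
     0 / 1,
     0 / 1,
     0 / 1]

/-- Numerator of the entry (0, 0) of `szY`. -/
def szY00 {F : Type*} [Field F] (r s r1 s1 l p D Z h : F) : F :=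
  (s^3+r*s^2+r^2*s^2+r^3+r^4+r^4*s)*r*l

/-- Numerator of the entry (1, 0) of `szY`. -/
def szY10 {F : Type*} [Field F] (r s r1 s1 l p D Z h : F) : F :=
  (s^5+s^7+r^3*s^6+r^4*s^2+r^5*s^2+r^5*s^3+r^5*s^5+r^6*s+r^6*s^2+r^6*s^3+r^7+r^7*s+r^7*s^3+r^8+r^9+r^10)*r+r1*l*h

/-- Square root of the rescaled conjugate of `y`. -/
def szY {F : Type*} [Field F] (r s r1 s1 l p D Z h : F) :
    Matrix (Fin 4) (Fin 4) F :=
  !![szY00 r s r1 s1 l p D Z h / (p*D),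
     (r*D*Z+r1*l*h) / (s*l^2*p*D*Z),
     r*s1*p / (l*Z),
     1 / 1;
     szY10 r s r1 s1 l p D Z h / (l*D),
     r*s*r1^2*l / D,
     p / 1,
     0 / 1;
     r*s*s1*p / 1,
     1 / 1,
     0 / 1,
     0 / 1;
     p / 1,
     0 / 1,
     0 / 1,
     0 / 1]

/-- Numerator of the entry (2, 0) of `szT`. -/
def szT20 {F : Type*} [Field F] (r s r1 s1 l p D Z h : F) : F :=
  (s^2+s^3+r^2*s^2+r^3+r^3*s+r^4)*r*Z+l*h

/-- Numerator of the entry (3, 0) of `szT`. -/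
def szT30 {F : Type*} [Field F] (r s r1 s1 l p D Z h : F) : F :=
  (s^5+s^6+r^4*s^2+r^4*s^3+r^4*s^4+r^5*s^3+r^6*s^2+r^6*s^3+r^7+r^7*s+r^8*s+r^9)*l+r*h

/-- Numerator of the entry (3, 1) of `szT`. -/
def szT31 {F : Type*} [Field F] (r s r1 s1 l p D Z h : F) : F :=
  (s^2+r*s^2+r*s^3+r^3+r^3*s+r^4)*r^2*Z+l^2*h

/-- Square root of the conjugate of `t = x⁻¹ y`. -/
def szT {F : Type*} [Field F] (r s r1 s1 l p D Z h : F) :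
    Matrix (Fin 4) (Fin 4) F :=
  !![1 / 1,
     0 / 1,
     0 / 1,
     0 / 1;
     r*D / 1,
     1 / 1,
     0 / 1,
     0 / 1;
     szT20 r s r1 s1 l p D Z h / (r*p*D),
     s*Z / (r*l*p*D),
     1 / 1,
     0 / 1;
     szT30 r s r1 s1 l p D Z h / (r*s*l*p*D),
     szT31 r s r1 s1 l p D Z h / (r*s*l^2*p*D*Z),
     r*D / (s*l*Z),
     1 / 1]

/-- Numerator of the entry (2, 0) of `szTi`. -/
def szTi20 {F : Type*} [Field F] (r s r1 s1 l p D Z h : F) : F :=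
  (s^2+r*s^2+r*s^3+r^3+r^3*s+r^4)*r^2*Z+l^2*h

/-- Numerator of the entry (3, 0) of `szTi`. -/
def szTi30 {F : Type*} [Field F] (r s r1 s1 l p D Z h : F) : F :=
  (s^5+s^6+r^4*s^2+r^4*s^3+r^4*s^4+r^5*s^3+r^6*s^2+r^6*s^3+r^7+r^7*s+r^8*s+r^9)*l+r*h

/-- Numerator of the entry (3, 1) of `szTi`. -/
def szTi31 {F : Type*} [Field F] (r s r1 s1 l p D Z h : F) : F :=
  (s^2+s^3+r^2*s^2+r^3+r^3*s+r^4)*r*Z+l*h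

/-- The inverse of `szT`. -/
def szTi {F : Type*} [Field F] (r s r1 s1 l p D Z h : F) :
    Matrix (Fin 4) (Fin 4) F :=
  !![1 / 1,
     0 / 1,
     0 / 1,
     0 / 1;
     r*D / 1,
     1 / 1,
     0 / 1,
     0 / 1;
     szTi20 r s r1 s1 l p D Z h / (r*l*p*D),
     s*Z / (r*l*p*D),
     1 / 1,
     0 / 1;
     szTi30 r s r1 s1 l p D Z h / (r*s*l*p*D),
     szTi31 r s r1 s1 l p D Z h / (r*s*l*p*D*Z),
     r*D / (s*l*Z),
     1 / 1]

/-- `szT ^ 2`. -/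
def szS {F : Type*} [Field F] (r s r1 s1 l p D Z h : F) :
    Matrix (Fin 4) (Fin 4) F :=
  !![1 / 1,
     0 / 1,
     0 / 1,
     0 / 1;
     0 / 1,
     1 / 1,
     0 / 1,
     0 / 1;
     s*Z / (l*p),
     0 / 1,
     1 / 1,
     0 / 1;
     r*D / (l^2*p),
     1 / (l^2*p),
     0 / 1,
     1 / 1]

/-- Numerator of the entry (0, 0) of `szK`. -/
def szK00 {F : Type*} [Field F] (r s r1 s1 l p D Z h : F) : F :=
  (s^2+s^3+r^2*s^2+r^3+r^3*s+r^4)*p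

/-- Numerator of the entry (2, 0) of `szK`. -/
def szK20 {F : Type*} [Field F] (r s r1 s1 l p D Z h : F) : F :=
  (s^6+s^8+r^2*s^5+r^2*s^7+r^3*s^4+r^3*s^5+r^4*s^3+r^4*s^6+r^5*s^4+r^6*s^2+r^6*s^4+r^7*s+r^8*s+r^8*s^2+r^9+r^11)

/-- Numerator of the entry (3, 0) of `szK`. -/
def szK30 {F : Type*} [Field F] (r s r1 s1 l p D Z h : F) : F :=
  (s^4+s^5+r*s^5+r^2*s^3+r^2*s^4+r^2*s^5+r^3*s^3+r^3*s^4+r^4*s^3+r^4*s^4+r^5*s^3+r^6+r^7+r^7*s)*r+h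

/-- Numerator of the entry (3, 2) of `szK`. -/
def szK32 {F : Type*} [Field F] (r s r1 s1 l p D Z h : F) : F :=
  (s^5+s^6+r^2*s^5+r^3*s^3+r^3*s^4+r^4*s^3+r^4*s^4+r^5*s^2+r^6*s+r^7+r^7*s+r^9)

/-- `szS * szX`. -/
def szK {F : Type*} [Field F] (r s r1 s1 l p D Z h : F) :
    Matrix (Fin 4) (Fin 4) F :=
  !![szK00 r s r1 s1 l p D Z h / (r*D),
     h / (r*s*l*D*Z),
     r^2*r1*l / (s*Z),
     1 / 1;
     (r^2*s^2*r1*s1*l*p^2+p*h) / (r*D),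
     s^2*s1*p^2 / (r*l*D),
     p / 1,
     0 / 1;
     szK20 r s r1 s1 l p D Z h / (r*l*D),
     (r*l^2*p*D+h) / (r*l^2*p*D),
     r^2*r1 / p,
     s*Z / (l*p);
     szK30 r s r1 s1 l p D Z h / (r*l^2*D),
     (s^3*s1*p^2*Z+r*D*h) / (r*s*l^3*p*D*Z),
     szK32 r s r1 s1 l p D Z h / (s*l^2*p*Z),
     r*D / (l^2*p)]

/-- Numerator of the entry (0, 0) of `szP`. -/
def szP00 {F : Type*} [Field F] (r s r1 s1 l p D Z h : F) : F :=
  (s^5+s^6+r*s^5+r*s^6+r^2*s^5+r^3*s^3+r^3*s^4+r^4*s^2+r^4*s^3+r^4*s^4+r^5*s^2+r^5*s^3+r^6*s^3+r^7+r^7*s+r^8)+h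

/-- Numerator of the entry (0, 1) of `szP`. -/
def szP01 {F : Type*} [Field F] (r s r1 s1 l p D Z h : F) : F :=
  (s^7+s^9+r^2*s^7+r^2*s^8+r^3*s^6+r^3*s^7+r^4*s^4+r^4*s^5+r^4*s^7+r^5*s^5+r^5*s^6+r^6*s^3+r^6*s^5+r^7*s^2+r^7*s^3+r^9*s+r^9*s^2+r^10+r^10*s+r^12)+(s^2+r*s^2+r^2*s+r^3)*h

/-- Numerator of the entry (0, 2) of `szP`. -/
def szP02 {F : Type*} [Field F] (r s r1 s1 l p D Z h : F) : F :=
  (s^5+s^7+r^3*s^3+r^3*s^4+r^4*s^2+r^4*s^4+r^4*s^5+r^5*s^2+r^7+r^7*s+r^8*s+r^9)*r*p+l*p*h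

/-- Numerator of the entry (0, 3) of `szP`. -/
def szP03 {F : Type*} [Field F] (r s r1 s1 l p D Z h : F) : F :=
  (s^5+s^6+r^2*s^5+r^4*s^4+r^5*s^2+r^5*s^3+r^6*s^2+r^7+r^7*s+r^8)

/-- Numerator of the entry (1, 0) of `szP`. -/
def szP10 {F : Type*} [Field F] (r s r1 s1 l p D Z h : F) : F :=
  (s^6+s^8+r^2*s^6+r^2*s^7+r^3*s^5+r^3*s^6+r^4*s^3+r^4*s^4+r^4*s^5+r^4*s^6+r^5*s^4+r^6*s^2+r^6*s^3+r^7*s+r^7*s^2+r^7*s^4+r^8*s+r^8*s^3+r^9+r^11)*p+p^2*h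

/-- Numerator of the entry (1, 1) of `szP`. -/
def szP11 {F : Type*} [Field F] (r s r1 s1 l p D Z h : F) : F :=
  (s^8+s^10+r^2*s^8+r^2*s^9+r^3*s^8+r^3*s^9+r^4*s^7+r^4*s^8+r^5*s^5+r^5*s^7+r^5*s^8+r^6*s^6+r^7*s^3+r^7*s^5+r^8*s^2+r^8*s^3+r^8*s^4+r^8*s^5+r^9*s^3+r^9*s^5+r^10*s+r^10*s^2+r^11+r^11*s^3+r^12+r^12*s+r^13+r^14)*p+s*Z*h

/-- Numerator of the entry (1, 2) of `szP`. -/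
def szP12 {F : Type*} [Field F] (r s r1 s1 l p D Z h : F) : F :=
  (s^8+s^10+r^2*s^8+r^2*s^9+r^3*s^6+r^3*s^8+r^4*s^6+r^4*s^7+r^5*s^5+r^5*s^6+r^6*s^4+r^6*s^5+r^6*s^6+r^7*s^3+r^7*s^5+r^7*s^6+r^8*s^2+r^8*s^3+r^8*s^4+r^8*s^5+r^10*s^2+r^10*s^5+r^11+r^11*s+r^11*s^3+r^11*s^4+r^12*s+r^12*s^2+r^13*s+r^13*s^2+r^14*s+r^15)*s+r^2*r1*l^2*p*h

/-- Numerator of the entry (1, 3) of `szP`. -/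
def szP13 {F : Type*} [Field F] (r s r1 s1 l p D Z h : F) : F :=
  (s^5+s^7+r^2*s^5+r^2*s^6+r^3*s^4+r^4*s^2+r^4*s^3+r^4*s^4+r^5*s^4+r^6*s+r^6*s^2+r^6*s^4+r^7+r^8+r^8*s+r^8*s^2+r^9+r^10)*r*s+l*p*h

/-- Numerator of the entry (2, 2) of `szP`. -/
def szP22 {F : Type*} [Field F] (r s r1 s1 l p D Z h : F) : F :=
  (s^5+s^6+r^2*s^5+r^4*s^2+r^4*s^3+r^5*s^2+r^6*s^3+r^7+r^7*s^2+r^9)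

/-- Numerator of the entry (3, 0) of `szP`. -/
def szP30 {F : Type*} [Field F] (r s r1 s1 l p D Z h : F) : F :=
  (s^2+s^3+r^2*s^2+r^3+r^3*s+r^4)*p^2

/-- `szX * szK`. -/
def szP {F : Type*} [Field F] (r s r1 s1 l p D Z h : F) :
    Matrix (Fin 4) (Fin 4) F :=
  !![szP00 r s r1 s1 l p D Z h / (r*l^2*D),
     szP01 r s r1 s1 l p D Z h / (r*s*l^3*D*Z),
     szP02 r s r1 s1 l p D Z h / (r*s*l^2*D*Z),
     szP03 r s r1 s1 l p D Z h / (r*l^2*D);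
     szP10 r s r1 s1 l p D Z h / (r*l*D),
     szP11 r s r1 s1 l p D Z h / (r*s*l^2*D*Z),
     szP12 r s r1 s1 l p D Z h / (r*s*l*D*Z),
     szP13 r s r1 s1 l p D Z h / (r*l*D);
     (r^3*r1*l*p*D+p*h) / (r*D),
     (s^3*s1*p^2*Z+r^2*r1*l^2*h) / (r*s*l*D*Z),
     szP22 r s r1 s1 l p D Z h / (s*Z),
     r^2*r1*l^2 / 1;
     szP30 r s r1 s1 l p D Z h / (r*D),
     p*h / (r*s*l*D*Z),
     r^2*r1*l*p / (s*Z),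
     p / 1]

/-- Numerator of the entry (0, 0) of `szM`. -/
def szM00 {F : Type*} [Field F] (r s r1 s1 l p D Z h : F) : F :=
  (s^2+r+r*s+r^2)*r*p^2

/-- Numerator of the entry (0, 1) of `szM`. -/
def szM01 {F : Type*} [Field F] (r s r1 s1 l p D Z h : F) : F :=
  (s^3+r^2*s^2+r^3*s+r^4+r^4*s+r^5)*s1*D+r1*h

/-- Numerator of the entry (0, 2) of `szM`. -/
def szM02 {F : Type*} [Field F] (r s r1 s1 l p D Z h : F) : F :=
  (s^7+s^9+r^2*s^6+r^2*s^7+r^4*s^4+r^4*s^6+r^4*s^7+r^5*s^5+r^6*s^3+r^6*s^4+r^7*s^4+r^7*s^5+r^8*s^2+r^8*s^5+r^9*s+r^9*s^4+r^10+r^10*s^2+r^11+r^11*s+r^12+r^13)+(s^2+r^2*s+r^3+r^3*s)*h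

/-- Numerator of the entry (0, 3) of `szM`. -/
def szM03 {F : Type*} [Field F] (r s r1 s1 l p D Z h : F) : F :=
  (s^5+s^6+r*s^5+r*s^6+r^2*s^4+r^3*s^4+r^3*s^5+r^4*s^2+r^4*s^3+r^4*s^4+r^5*s^3+r^5*s^4+r^6*s^2+r^7+r^7*s+r^8)+h

/-- Numerator of the entry (1, 0) of `szM`. -/
def szM10 {F : Type*} [Field F] (r s r1 s1 l p D Z h : F) : F :=
  (s^5+s^6+r*s^5+r^2*s^4+r^2*s^5+r^3*s^3+r^4*s^2+r^5*s^2+r^5*s^3+r^6*s^2+r^6*s^3+r^7+r^7*s+r^7*s^2+r^8*s+r^9)*s1*p+r1*p*h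

/-- Numerator of the entry (1, 1) of `szM`. -/
def szM11 {F : Type*} [Field F] (r s r1 s1 l p D Z h : F) : F :=
  (s^7+s^8+r^2*s^6+r^3*s^6+r^3*s^7+r^4*s^4+r^4*s^5+r^4*s^7+r^6*s^3+r^6*s^5+r^8*s^2+r^8*s^3+r^9+r^9*s+r^9*s^2+r^9*s^3+r^10+r^11+r^11*s+r^12)*r*p

/-- Numerator of the entry (1, 2) of `szM`. -/
def szM12 {F : Type*} [Field F] (r s r1 s1 l p D Z h : F) : F :=
  (s^8+s^10+r^2*s^7+r^2*s^8+r^3*s^8+r^3*s^9+r^4*s^6+r^4*s^7+r^5*s^5+r^6*s^4+r^6*s^6+r^7*s^3+r^7*s^4+r^7*s^7+r^8*s^2+r^8*s^3+r^8*s^4+r^8*s^5+r^9*s^2+r^9*s^6+r^10*s+r^10*s^2+r^10*s^3+r^10*s^5+r^11+r^11*s+r^12*s+r^12*s^2+r^13*s+r^15)*s*p+(s^3+s^4+r^2*s^2+r^2*s^3+r^3*s+r^4+r^4*s+r^5)*p^2*h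

/-- Numerator of the entry (1, 3) of `szM`. -/
def szM13 {F : Type*} [Field F] (r s r1 s1 l p D Z h : F) : F :=
  (s^7+s^9+r^2*s^6+r^2*s^8+r^3*s^5+r^3*s^7+r^4*s^4+r^4*s^5+r^4*s^6+r^5*s^4+r^5*s^6+r^6*s^5+r^6*s^6+r^7*s^2+r^7*s^4+r^8*s^2+r^8*s^3+r^9*s+r^9*s^3+r^10+r^10*s+r^12)*p+(s^2+r*s^2+r^2*s+r^3)*p*h

/-- Numerator of the entry (2, 0) of `szM`. -/
def szM20 {F : Type*} [Field F] (r s r1 s1 l p D Z h : F) : F :=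
  (s^7+s^9+r^3*s^5+r^3*s^7+r^4*s^4+r^4*s^5+r^4*s^7+r^5*s^4+r^5*s^5+r^5*s^6+r^6*s^4+r^6*s^6+r^7*s^3+r^7*s^4+r^9*s+r^9*s^2+r^10+r^10*s^2+r^11+r^11*s+r^12+r^13)+(s^2+r^2*s+r^3+r^3*s)*h

/-- Numerator of the entry (2, 1) of `szM`. -/
def szM21 {F : Type*} [Field F] (r s r1 s1 l p D Z h : F) : F :=
  (s^5+s^6+r^2*s^4+r^2*s^5+r^3*s^3+r^4*s^2+r^4*s^3+r^5*s^4+r^6*s+r^6*s^2+r^7+r^7*s+r^7*s^2+r^9)*s*Z+(s^3+s^4+r^2*s^2+r^2*s^3+r^3*s+r^4+r^4*s+r^5)*p*h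

/-- Numerator of the entry (2, 2) of `szM`. -/
def szM22 {F : Type*} [Field F] (r s r1 s1 l p D Z h : F) : F :=
  (s^9+s^11+r^2*s^9+r^2*s^10+r^4*s^6+r^4*s^9+r^5*s^6+r^5*s^7+r^6*s^5+r^6*s^6+r^6*s^8+r^7*s^4+r^7*s^5+r^7*s^6+r^7*s^7+r^8*s^4+r^8*s^6+r^8*s^7+r^9*s^4+r^9*s^5+r^11*s^2+r^11*s^3+r^13+r^13*s+r^13*s^2+r^13*s^3+r^14+r^15+r^15*s+r^16)

/-- Numerator of the entry (2, 3) of `szM`. -/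
def szM23 {F : Type*} [Field F] (r s r1 s1 l p D Z h : F) : F :=
  (s^3+s^4+r^2*s^2+r^2*s^3+r^3*s+r^4+r^4*s+r^5)*r*p*D+l*p*h

/-- Numerator of the entry (3, 0) of `szM`. -/
def szM30 {F : Type*} [Field F] (r s r1 s1 l p D Z h : F) : F :=
  (s^5+s^6+r*s^5+r*s^6+r^2*s^5+r^3*s^3+r^3*s^4+r^4*s^2+r^4*s^3+r^4*s^4+r^5*s^2+r^5*s^3+r^6*s^3+r^7+r^7*s+r^8)*p+p*h

/-- Numerator of the entry (3, 1) of `szM`. -/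
def szM31 {F : Type*} [Field F] (r s r1 s1 l p D Z h : F) : F :=
  (s^7+s^9+r^2*s^7+r^2*s^8+r^3*s^6+r^3*s^7+r^4*s^4+r^4*s^5+r^4*s^7+r^5*s^5+r^5*s^6+r^6*s^3+r^6*s^5+r^7*s^2+r^7*s^3+r^9*s+r^9*s^2+r^10+r^10*s+r^12)*p+(s^2+r*s^2+r^2*s+r^3)*p*h

/-- Numerator of the entry (3, 2) of `szM`. -/
def szM32 {F : Type*} [Field F] (r s r1 s1 l p D Z h : F) : F :=
  (s^5+s^7+r^3*s^3+r^3*s^4+r^4*s^2+r^4*s^4+r^4*s^5+r^5*s^2+r^7+r^7*s+r^8*s+r^9)*r*p^2+l*p^2*h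

/-- Numerator of the entry (3, 3) of `szM`. -/
def szM33 {F : Type*} [Field F] (r s r1 s1 l p D Z h : F) : F :=
  (s^5+s^6+r^2*s^5+r^4*s^4+r^5*s^2+r^5*s^3+r^6*s^2+r^7+r^7*s+r^8)*p

/-- `szX * szP`. -/
def szM {F : Type*} [Field F] (r s r1 s1 l p D Z h : F) :
    Matrix (Fin 4) (Fin 4) F :=
  !![szM00 r s r1 s1 l p D Z h / D,
     szM01 r s r1 s1 l p D Z h / (s*l*D*Z),
     szM02 r s r1 s1 l p D Z h / (r*s*l^2*D*Z),
     szM03 r s r1 s1 l p D Z h / (r*l^2*D);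
     szM10 r s r1 s1 l p D Z h / D,
     szM11 r s r1 s1 l p D Z h / (s*l*D*Z),
     szM12 r s r1 s1 l p D Z h / (r*s*l^2*D*Z),
     szM13 r s r1 s1 l p D Z h / (r*l^2*D);
     szM20 r s r1 s1 l p D Z h / (r*l*D),
     szM21 r s r1 s1 l p D Z h / (r*s*l^2*D*Z),
     szM22 r s r1 s1 l p D Z h / (r*s*l*D*Z),
     szM23 r s r1 s1 l p D Z h / (r*l*D);
     szM30 r s r1 s1 l p D Z h / (r*l^2*D),
     szM31 r s r1 s1 l p D Z h / (r*s*l^3*D*Z),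
     szM32 r s r1 s1 l p D Z h / (r*s*l^2*D*Z),
     szM33 r s r1 s1 l p D Z h / (r*l^2*D)]

/-- Numerator of the entry (0, 0) of `szV`. -/
def szV00 {F : Type*} [Field F] (r s r1 s1 l p D Z h : F) : F :=
  (s^2+s^3+r^2*s^2+r^3+r^3*s+r^4)*p

/-- Numerator of the entry (1, 0) of `szV`. -/
def szV10 {F : Type*} [Field F] (r s r1 s1 l p D Z h : F) : F :=
  (s^4+s^6+r^3*s^3+r^4*s^4+r^5*s+r^5*s^3+r^6+r^6*s^2+r^7*s+r^8)*r*p+p*h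

/-- Numerator of the entry (1, 2) of `szV`. -/
def szV12 {F : Type*} [Field F] (r s r1 s1 l p D Z h : F) : F :=
  (s^5+s^6+r^2*s^5+r^3*s^3+r^3*s^4+r^4*s^3+r^4*s^4+r^5*s^2+r^6*s+r^7+r^7*s+r^9)

/-- Numerator of the entry (2, 0) of `szV`. -/
def szV20 {F : Type*} [Field F] (r s r1 s1 l p D Z h : F) : F :=
  (s^3+r^2*s^2+r^3*s^2+r^4+r^4*s+r^5)*s1*D+s1*h

/-- Numerator of the entry (2, 1) of `szV`. -/
def szV21 {F : Type*} [Field F] (r s r1 s1 l p D Z h : F) : F :=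
  (s^8+s^10+r^3*s^7+r^4*s^6+r^5*s^7+r^6*s^5+r^7*s^3+r^7*s^4+r^8*s^2+r^8*s^5+r^9*s^3+r^9*s^4+r^10*s+r^10*s^4+r^11+r^12+r^12*s+r^12*s^2+r^13+r^14)*s1+(s^3+s^4+r*s^3+r^2*s^2+r^3*s+r^3*s^3+r^4+r^4*s+r^5*s+r^6)*h

/-- Numerator of the entry (2, 2) of `szV`. -/
def szV22 {F : Type*} [Field F] (r s r1 s1 l p D Z h : F) : F :=
  (s^6+s^7+r^2*s^6+r^5*s^2+r^5*s^4+r^6*s^2+r^6*s^4+r^7*s+r^7*s^3+r^8+r^8*s+r^10)*Z+r^2*r1*l^3*h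

/-- Numerator of the entry (2, 3) of `szV`. -/
def szV23 {F : Type*} [Field F] (r s r1 s1 l p D Z h : F) : F :=
  (s^2+r*s^2+r*s^3+r^3+r^3*s+r^4)*r^2*Z+l^2*h

/-- Numerator of the entry (3, 1) of `szV`. -/
def szV31 {F : Type*} [Field F] (r s r1 s1 l p D Z h : F) : F :=
  (s^3+r*s^3+r^2*s^2+r^2*s^3+r^3*s+r^3*s^2+r^4+r^5)*r^2*r1*D+r*r1*l*h

/-- Numerator of the entry (3, 2) of `szV`. -/
def szV32 {F : Type*} [Field F] (r s r1 s1 l p D Z h : F) : F :=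
  (s^7+s^9+r*s^7+r*s^8+r^2*s^7+r^2*s^8+r^3*s^6+r^3*s^7+r^4*s^4+r^4*s^5+r^4*s^7+r^5*s^4+r^6*s^3+r^6*s^4+r^6*s^5+r^6*s^6+r^8*s^2+r^8*s^3+r^8*s^4+r^8*s^5+r^9*s+r^9*s^2+r^10+r^10*s^3+r^11+r^11*s+r^12+r^13)*r+(s^2+r^2*s+r^3+r^4)*l*h

/-- Numerator of the entry (3, 3) of `szV`. -/
def szV33 {F : Type*} [Field F] (r s r1 s1 l p D Z h : F) : F :=
  (s^5+s^6+r^4*s^2+r^4*s^3+r^4*s^4+r^5*s^3+r^6*s^2+r^6*s^3+r^7+r^7*s+r^8*s+r^9)*l+r*h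

/-- `szTi * szX`. -/
def szV {F : Type*} [Field F] (r s r1 s1 l p D Z h : F) :
    Matrix (Fin 4) (Fin 4) F :=
  !![szV00 r s r1 s1 l p D Z h / (r*D),
     h / (r*s*l*D*Z),
     r^2*r1*l / (s*Z),
     1 / 1;
     szV10 r s r1 s1 l p D Z h / (r*D),
     (s^3*s1*p^2*Z+r*D*h) / (r*s*l*D*Z),
     szV12 r s r1 s1 l p D Z h / (s*Z),
     r*D / 1;
     szV20 r s r1 s1 l p D Z h / (l*D),
     szV21 r s r1 s1 l p D Z h / (s*l^2*p*D*Z),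
     szV22 r s r1 s1 l p D Z h / (r*s*l*p*D*Z),
     szV23 r s r1 s1 l p D Z h / (r*l*p*D);
     r*s*r1*s1*p / D,
     szV31 r s r1 s1 l p D Z h / (s^2*l*p*D*Z),
     szV32 r s r1 s1 l p D Z h / (r*s^2*l*p*D*Z),
     szV33 r s r1 s1 l p D Z h / (r*s*l*p*D)]

/-- Numerator of the entry (0, 0) of `szN`. -/
def szN00 {F : Type*} [Field F] (r s r1 s1 l p D Z h : F) : F :=
  (s^5+s^6+r^2*s^4+r^2*s^5+r^3*s^4+r^4*s^2+r^4*s^3+r^4*s^4+r^6*s+r^6*s^2+r^7+r^8)*r1+h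

/-- Numerator of the entry (0, 1) of `szN`. -/
def szN01 {F : Type*} [Field F] (r s r1 s1 l p D Z h : F) : F :=
  (s^3+s^4+r^2*s^2+r^3*s+r^4+r^5)*s*s1*p^2+p*h

/-- Numerator of the entry (0, 2) of `szN`. -/
def szN02 {F : Type*} [Field F] (r s r1 s1 l p D Z h : F) : F :=
  (s^5+s^6+r*s^5+r^3*s^3+r^3*s^4+r^4*s^2+r^4*s^4+r^6*s^2+r^6*s^3+r^7+r^7*s^2+r^9)*s1+r1*h

/-- Numerator of the entry (0, 3) of `szN`. -/
def szN03 {F : Type*} [Field F] (r s r1 s1 l p D Z h : F) : F :=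
  (s^2+r+r*s+r^2)*r*p

/-- Numerator of the entry (1, 0) of `szN`. -/
def szN10 {F : Type*} [Field F] (r s r1 s1 l p D Z h : F) : F :=
  (s^5+s^6+r^2*s^5+r^4*s^2+r^4*s^3+r^5*s^2+r^6*s^3+r^7+r^7*s^2+r^9)*s1*p+r1*p*h

/-- Numerator of the entry (1, 1) of `szN`. -/
def szN11 {F : Type*} [Field F] (r s r1 s1 l p D Z h : F) : F :=
  (s^8+s^10+r^2*s^7+r^2*s^9+r^3*s^7+r^3*s^8+r^4*s^8+r^5*s^6+r^6*s^4+r^6*s^5+r^6*s^6+r^7*s^3+r^7*s^4+r^7*s^7+r^8*s^2+r^8*s^6+r^10*s+r^10*s^2+r^10*s^3+r^10*s^4+r^11+r^11*s^3+r^12*s^2+r^13*s^2+r^14*s+r^15)+Z*h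

/-- Numerator of the entry (1, 2) of `szN`. -/
def szN12 {F : Type*} [Field F] (r s r1 s1 l p D Z h : F) : F :=
  (s^5+s^6+r^2*s^4+r^3*s^4+r^3*s^5+r^4*s^2+r^4*s^4+r^5*s^3+r^5*s^4+r^7+r^7*s^3+r^8+r^8*s+r^9+r^9*s+r^10)*r*r1*l^2+r^2*r1^2*l*h

/-- Numerator of the entry (1, 3) of `szN`. -/
def szN13 {F : Type*} [Field F] (r s r1 s1 l p D Z h : F) : F :=
  (s^5+s^7+r*s^5+r*s^6+r^2*s^4+r^2*s^5+r^3*s^4+r^4*s^2+r^4*s^3+r^4*s^5+r^5*s^2+r^5*s^3+r^5*s^4+r^6*s+r^6*s^2+r^6*s^4+r^7+r^7*s+r^7*s^3+r^8+r^9+r^10)+r1*h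

/-- Numerator of the entry (2, 2) of `szN`. -/
def szN22 {F : Type*} [Field F] (r s r1 s1 l p D Z h : F) : F :=
  (s^2+s^3+r^2*s^2+r^3+r^3*s+r^4)*p^2

/-- Numerator of the entry (3, 0) of `szN`. -/
def szN30 {F : Type*} [Field F] (r s r1 s1 l p D Z h : F) : F :=
  (s^2+s^3+r^2*s^2+r^3+r^3*s+r^4)*p^2

/-- `szX * szV`. -/
def szN {F : Type*} [Field F] (r s r1 s1 l p D Z h : F) :
    Matrix (Fin 4) (Fin 4) F :=
  !![szN00 r s r1 s1 l p D Z h / (r*s*l*D),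
     szN01 r s r1 s1 l p D Z h / (r*s*l^2*D*Z),
     szN02 r s r1 s1 l p D Z h / (s*l*D*Z),
     szN03 r s r1 s1 l p D Z h / D;
     szN10 r s r1 s1 l p D Z h / (r*D),
     szN11 r s r1 s1 l p D Z h / (r*s*l*D*Z),
     szN12 r s r1 s1 l p D Z h / (s*D*Z),
     szN13 r s r1 s1 l p D Z h / D;
     (r*s*s1*p^2*D+p*h) / (r*D),
     (s^2*s1*p^2*Z+r*s1*p*h) / (r*l*D*Z),
     szN22 r s r1 s1 l p D Z h / Z,
     r*s*s1*p / 1;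
     szN30 r s r1 s1 l p D Z h / (r*D),
     p*h / (r*s*l*D*Z),
     r^2*r1*l*p / (s*Z),
     p / 1]

/-- Numerator of the entry (0, 0) of `szR`. -/
def szR00 {F : Type*} [Field F] (r s r1 s1 l p D Z h : F) : F :=
  (s^5+s^6+r^2*s^4+r^2*s^5+r^3*s^4+r^4*s^2+r^4*s^3+r^4*s^4+r^6*s+r^6*s^2+r^7+r^8)*r1+h

/-- Numerator of the entry (0, 1) of `szR`. -/
def szR01 {F : Type*} [Field F] (r s r1 s1 l p D Z h : F) : F :=
  (s^3+s^4+r^2*s^2+r^3*s+r^4+r^5)*s*s1*p^2+p*h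

/-- Numerator of the entry (0, 2) of `szR`. -/
def szR02 {F : Type*} [Field F] (r s r1 s1 l p D Z h : F) : F :=
  (s^5+s^6+r*s^5+r^3*s^3+r^3*s^4+r^4*s^2+r^4*s^4+r^6*s^2+r^6*s^3+r^7+r^7*s^2+r^9)*s1+r1*h

/-- Numerator of the entry (0, 3) of `szR`. -/
def szR03 {F : Type*} [Field F] (r s r1 s1 l p D Z h : F) : F :=
  (s^2+r+r*s+r^2)*r*p

/-- Numerator of the entry (1, 0) of `szR`. -/
def szR10 {F : Type*} [Field F] (r s r1 s1 l p D Z h : F) : F :=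
  (s^8+s^10+r^2*s^7+r^2*s^9+r^3*s^6+r^3*s^7+r^4*s^6+r^4*s^7+r^5*s^6+r^6*s^4+r^7*s^4+r^7*s^6+r^8*s^2+r^8*s^3+r^8*s^5+r^8*s^6+r^9*s^2+r^9*s^4+r^10*s+r^10*s^3+r^11+r^11*s^3+r^12+r^12*s+r^13+r^14)+(s^3+r^2*s^2+r^3*s^2+r^4+r^4*s+r^5)*h

/-- Numerator of the entry (1, 1) of `szR`. -/
def szR11 {F : Type*} [Field F] (r s r1 s1 l p D Z h : F) : F :=
  (s^9+s^11+r^3*s^7+r^3*s^8+r^4*s^7+r^4*s^8+r^4*s^9+r^5*s^5+r^6*s^8+r^7*s^6+r^8*s^3+r^8*s^5+r^9*s^2+r^9*s^4+r^11*s^2+r^11*s^3+r^12+r^12*s+r^12*s^3+r^13+r^13*s+r^13*s^2+r^14+r^15)*r1+(s^4+r^3*s^2+r^5+r^6)*s1*h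

/-- Numerator of the entry (1, 2) of `szR`. -/
def szR12 {F : Type*} [Field F] (r s r1 s1 l p D Z h : F) : F :=
  (s^5+s^8+r*s^5+r*s^7+r^2*s^6+r^3*s^3+r^3*s^4+r^4*s^2+r^4*s^3+r^4*s^5+r^4*s^6+r^5*s^4+r^5*s^5+r^6*s+r^6*s^2+r^6*s^3+r^6*s^4+r^7+r^7*s+r^8+r^8*s+r^9+r^9*s+r^10)*r*p^2+r*s*r1*s1*p*h

/-- Numerator of the entry (1, 3) of `szR`. -/
def szR13 {F : Type*} [Field F] (r s r1 s1 l p D Z h : F) : F :=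
  (s^5+s^6+r*s^5+r^2*s^4+r^2*s^5+r^3*s^3+r^4*s^2+r^5*s^2+r^5*s^3+r^6*s^2+r^6*s^3+r^7+r^7*s+r^7*s^2+r^8*s+r^9)*s1+r1*h

/-- Numerator of the entry (2, 0) of `szR`. -/
def szR20 {F : Type*} [Field F] (r s r1 s1 l p D Z h : F) : F :=
  (s^3+r^2*s^2+r^3*s^2+r^4+r^4*s+r^5)*r^2*r1*l*D+r^2*r1*l*h

/-- Numerator of the entry (2, 1) of `szR`. -/
def szR21 {F : Type*} [Field F] (r s r1 s1 l p D Z h : F) : F :=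
  (s^4+r*s^3+r^2*s^2+r^4*s+r^5+r^6)*r^3*r1^2*s1*l^3+(s^3+s^4+r*s^3+r^2*s^3+r^4+r^4*s^2+r^5*s+r^6)*h

/-- Numerator of the entry (2, 2) of `szR`. -/
def szR22 {F : Type*} [Field F] (r s r1 s1 l p D Z h : F) : F :=
  (s^6+s^8+r^2*s^6+r^2*s^7+r^3*s^5+r^3*s^6+r^4*s^3+r^4*s^6+r^5*s^5+r^6*s^3+r^6*s^4+r^7*s+r^8*s^2+r^8*s^3+r^9+r^9*s+r^9*s^2+r^11)*s*r1*p+(s^3+s^4+r^3*s^2+r^4*s+r^5+r^6)*h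

/-- Numerator of the entry (2, 3) of `szR`. -/
def szR23 {F : Type*} [Field F] (r s r1 s1 l p D Z h : F) : F :=
  (s^7+s^9+r^3*s^5+r^3*s^7+r^4*s^4+r^4*s^5+r^4*s^7+r^5*s^4+r^5*s^5+r^5*s^6+r^6*s^4+r^6*s^6+r^7*s^3+r^7*s^4+r^9*s+r^9*s^2+r^10+r^10*s^2+r^11+r^11*s+r^12+r^13)+(s^2+r^2*s+r^3+r^3*s)*h

/-- Numerator of the entry (3, 1) of `szR`. -/
def szR31 {F : Type*} [Field F] (r s r1 s1 l p D Z h : F) : F :=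
  (s^3+r^3*s+r^4+r^5)*s1*l*D+r*s1*h

/-- Numerator of the entry (3, 2) of `szR`. -/
def szR32 {F : Type*} [Field F] (r s r1 s1 l p D Z h : F) : F :=
  (s^5+s^7+r^2*s^5+r^2*s^6+r^3*s^3+r^3*s^4+r^4*s^2+r^5*s^2+r^5*s^3+r^5*s^4+r^6*s+r^6*s^3+r^7+r^7*s^2+r^8*s+r^9)*p^2+p^2*h

/-- Numerator of the entry (3, 3) of `szR`. -/
def szR33 {F : Type*} [Field F] (r s r1 s1 l p D Z h : F) : F :=
  (s^5+s^6+r*s^5+r*s^6+r^2*s^5+r^3*s^3+r^3*s^4+r^4*s^2+r^4*s^3+r^4*s^4+r^5*s^2+r^5*s^3+r^6*s^3+r^7+r^7*s+r^8)+h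

/-- `szT * szN`. -/
def szR {F : Type*} [Field F] (r s r1 s1 l p D Z h : F) :
    Matrix (Fin 4) (Fin 4) F :=
  !![szR00 r s r1 s1 l p D Z h / (r*s*l*D),
     szR01 r s r1 s1 l p D Z h / (r*s*l^2*D*Z),
     szR02 r s r1 s1 l p D Z h / (s*l*D*Z),
     szR03 r s r1 s1 l p D Z h / D;
     szR10 r s r1 s1 l p D Z h / (r*s*l*D),
     szR11 r s r1 s1 l p D Z h / (r*s*l^2*D*Z),
     szR12 r s r1 s1 l p D Z h / (s*l*D*Z),
     szR13 r s r1 s1 l p D Z h / D;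
     szR20 r s r1 s1 l p D Z h / (s*p*D),
     szR21 r s r1 s1 l p D Z h / (s*l*p*D*Z),
     szR22 r s r1 s1 l p D Z h / (r*s*l*D*Z),
     szR23 r s r1 s1 l p D Z h / (r*l*p*D);
     r^2*s*r1*s1*p / D,
     szR31 r s r1 s1 l p D Z h / (s*l^2*D*Z),
     szR32 r s r1 s1 l p D Z h / (r*s*l^2*D*Z),
     szR33 r s r1 s1 l p D Z h / (r*l^2*D)]

/-- Numerator of the entry (0, 0) of `szL`. -/
def szL00 {F : Type*} [Field F] (r s r1 s1 l p D Z h : F) : F :=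
  (s^5+s^6+r^2*s^4+r^2*s^5+r^3*s^3+r^4*s^2+r^4*s^4+r^5*s^3+r^7+r^9)*s1+r1*h

/-- Numerator of the entry (0, 1) of `szL`. -/
def szL01 {F : Type*} [Field F] (r s r1 s1 l p D Z h : F) : F :=
  (s^7+s^8+r*s^5+r*s^7+r^2*s^7+r^3*s^4+r^3*s^5+r^3*s^6+r^4*s^3+r^4*s^6+r^5*s^3+r^5*s^4+r^6*s^3+r^6*s^4+r^7*s+r^7*s^2+r^8+r^8*s^2+r^9+r^9*s+r^10+r^11)*r+r*r1*l*h

/-- Numerator of the entry (0, 2) of `szL`. -/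
def szL02 {F : Type*} [Field F] (r s r1 s1 l p D Z h : F) : F :=
  (s^5+s^7+r*s^5+r*s^6+r^2*s^5+r^2*s^6+r^3*s^5+r^4*s^2+r^4*s^3+r^4*s^4+r^5*s^3+r^6*s+r^6*s^2+r^6*s^4+r^7+r^7*s^2+r^7*s^3+r^8+r^8*s+r^8*s^2+r^9+r^10)+r1*h

/-- Numerator of the entry (0, 3) of `szL`. -/
def szL03 {F : Type*} [Field F] (r s r1 s1 l p D Z h : F) : F :=
  (s^2+r+r*s+r^2)*r*p

/-- Numerator of the entry (1, 0) of `szL`. -/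
def szL10 {F : Type*} [Field F] (r s r1 s1 l p D Z h : F) : F :=
  (s^5+s^8+r^2*s^6+r^3*s^3+r^3*s^4+r^3*s^5+r^4*s^2+r^4*s^3+r^4*s^4+r^4*s^5+r^5*s^2+r^5*s^3+r^5*s^4+r^5*s^5+r^6*s+r^6*s^3+r^7+r^7*s^2+r^8+r^8*s+r^10+r^11)*r*s+r*r1*p*h

/-- Numerator of the entry (1, 1) of `szL`. -/
def szL11 {F : Type*} [Field F] (r s r1 s1 l p D Z h : F) : F :=
  (s^8+s^9+s^10+s^11+r^2*s^7+r^2*s^8+r^2*s^9+r^2*s^10+r^3*s^7+r^3*s^8+r^4*s^6+r^4*s^7+r^4*s^8+r^4*s^9+r^5*s^6+r^5*s^7+r^5*s^8+r^6*s^4+r^6*s^5+r^6*s^7+r^6*s^8+r^7*s^3+r^7*s^5+r^7*s^6+r^8*s^2+r^8*s^3+r^8*s^5+r^8*s^6+r^9*s^2+r^9*s^3+r^9*s^4+r^9*s^5+r^10*s+r^10*s^2+r^10*s^4+r^10*s^5+r^11+r^11*s+r^11*s^2+r^11*s^4+r^12*s+r^12*s^3+r^13*s+r^15)+(s^3+s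^4+r^2*s^2+r^3*s+r^4+r^5)*r1*h

/-- Numerator of the entry (1, 2) of `szL`. -/
def szL12 {F : Type*} [Field F] (r s r1 s1 l p D Z h : F) : F :=
  (s^8+s^9+r*s^7+r*s^9+r^2*s^9+r^3*s^5+r^3*s^6+r^3*s^7+r^3*s^8+r^4*s^6+r^4*s^7+r^5*s^5+r^5*s^7+r^6*s^3+r^6*s^6+r^6*s^7+r^7*s^2+r^7*s^4+r^8*s^2+r^8*s^3+r^8*s^4+r^8*s^6+r^9*s+r^9*s^5+r^10+r^10*s+r^10*s^2+r^11*s+r^11*s^3+r^12*s+r^12*s^2+r^14)*r+r^2*r1^2*l^2*h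

/-- Numerator of the entry (1, 3) of `szL`. -/
def szL13 {F : Type*} [Field F] (r s r1 s1 l p D Z h : F) : F :=
  (s^5+s^6+r*s^5+r^2*s^4+r^2*s^5+r^3*s^3+r^4*s^2+r^5*s^2+r^5*s^3+r^6*s^2+r^6*s^3+r^7+r^7*s+r^7*s^2+r^8*s+r^9)*s1+r1*h

/-- Numerator of the entry (2, 0) of `szL`. -/
def szL20 {F : Type*} [Field F] (r s r1 s1 l p D Z h : F) : F :=
  (s^8+s^10+r^3*s^8+r^3*s^9+r^4*s^5+r^4*s^7+r^4*s^8+r^5*s^5+r^5*s^6+r^5*s^7+r^6*s^7+r^7*s^3+r^8*s^4+r^8*s^5+r^9*s^3+r^9*s^4+r^10*s^3+r^10*s^4+r^11*s+r^11*s^3+r^12+r^12*s^2+r^12*s^3+r^13+r^13*s+r^13*s^2+r^14+r^15)+(s+s^2+r*s+r^3)*s*p*h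

/-- Numerator of the entry (2, 1) of `szL`. -/
def szL21 {F : Type*} [Field F] (r s r1 s1 l p D Z h : F) : F :=
  (s^10+s^11+s^12+s^13+r^2*s^10+r^2*s^11+r^3*s^8+r^3*s^9+r^3*s^10+r^3*s^11+r^4*s^8+r^4*s^9+r^4*s^10+r^5*s^7+r^5*s^8+r^5*s^9+r^5*s^10+r^6*s^6+r^6*s^8+r^6*s^10+r^7*s^5+r^7*s^7+r^7*s^8+r^7*s^9+r^8*s^4+r^8*s^5+r^8*s^8+r^9*s^4+r^9*s^5+r^9*s^6+r^9*s^7+r^10*s^3+r^10*s^5+r^10*s^7+r^12*s^3+r^13*s+r^13*s^5+r^14+r^14*s+r^14*s^2+r^14*s^3+r^14*s^4+r^15*s+r^15*s^2+r^16*s+r^18)+(s^5+s^6+r^2*s^4+r^3*s^3+r^3*s^4+r^3*s^5+r^4*s^2+r^5*s^2+r^6*s+r^6*s^2+r^6*s^3+r^7+r^8*s+r^9)*h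

/-- Numerator of the entry (2, 2) of `szL`. -/
def szL22 {F : Type*} [Field F] (r s r1 s1 l p D Z h : F) : F :=
  (s^10+s^12+r^2*s^10+r^2*s^11+r^3*s^8+r^3*s^11+r^4*s^7+r^4*s^8+r^4*s^9+r^4*s^10+r^5*s^8+r^5*s^9+r^5*s^10+r^6*s^7+r^7*s^5+r^7*s^7+r^8*s^6+r^8*s^7+r^9*s^4+r^9*s^5+r^9*s^8+r^10*s^5+r^11*s^2+r^11*s^3+r^11*s^4+r^11*s^6+r^13*s^2+r^13*s^4+r^13*s^5+r^14+r^14*s+r^14*s^2+r^15*s+r^15*s^3+r^16*s+r^16*s^2+r^17*s+r^18)+(s^5+s^6+r^2*s^5+r^3*s^3+r^3*s^4+r^4*s^3+r^4*s^4+r^5*s^2+r^6*s+r^7+r^7*s+r^9)*h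

/-- Numerator of the entry (2, 3) of `szL`. -/
def szL23 {F : Type*} [Field F] (r s r1 s1 l p D Z h : F) : F :=
  (s^7+s^9+r^3*s^5+r^3*s^7+r^4*s^4+r^4*s^5+r^4*s^7+r^5*s^4+r^5*s^5+r^5*s^6+r^6*s^4+r^6*s^6+r^7*s^3+r^7*s^4+r^9*s+r^9*s^2+r^10+r^10*s^2+r^11+r^11*s+r^12+r^13)+(s^2+r^2*s+r^3+r^3*s)*h

/-- Numerator of the entry (3, 0) of `szL`. -/
def szL30 {F : Type*} [Field F] (r s r1 s1 l p D Z h : F) : F :=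
  (s^3+s^4+r*s^3+r^2*s^2+r^2*s^3+r^3*s^2+r^4+r^4*s)*p*D+p*h

/-- Numerator of the entry (3, 1) of `szL`. -/
def szL31 {F : Type*} [Field F] (r s r1 s1 l p D Z h : F) : F :=
  (s^8+s^10+r^2*s^8+r^2*s^9+r^3*s^7+r^3*s^9+r^4*s^6+r^4*s^7+r^4*s^8+r^5*s^7+r^6*s^4+r^6*s^7+r^7*s^3+r^7*s^4+r^8*s^2+r^8*s^3+r^9*s^3+r^9*s^4+r^10*s+r^10*s^3+r^11+r^11*s+r^12*s^2+r^13)+(s^3+s^4+r*s^3+r^3*s+r^3*s^2+r^4+r^4*s+r^5)*h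

/-- Numerator of the entry (3, 2) of `szL`. -/
def szL32 {F : Type*} [Field F] (r s r1 s1 l p D Z h : F) : F :=
  (s^8+s^10+r^3*s^7+r^3*s^8+r^4*s^7+r^4*s^8+r^5*s^5+r^5*s^6+r^5*s^7+r^6*s^4+r^6*s^5+r^6*s^7+r^8*s^2+r^8*s^3+r^8*s^4+r^8*s^5+r^9*s^2+r^9*s^3+r^9*s^4+r^9*s^5+r^10*s+r^10*s^3+r^11+r^11*s^3+r^12+r^12*s+r^13+r^14)+(s^3+r*s^3+r^2*s^2+r^3*s+r^4+r^4*s)*h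

/-- Numerator of the entry (3, 3) of `szL`. -/
def szL33 {F : Type*} [Field F] (r s r1 s1 l p D Z h : F) : F :=
  (s^5+s^6+r*s^5+r*s^6+r^2*s^5+r^3*s^3+r^3*s^4+r^4*s^2+r^4*s^3+r^4*s^4+r^5*s^2+r^5*s^3+r^6*s^3+r^7+r^7*s+r^8)+h

/-- `szR * szT`. -/
def szL {F : Type*} [Field F] (r s r1 s1 l p D Z h : F) :
    Matrix (Fin 4) (Fin 4) F :=
  !![szL00 r s r1 s1 l p D Z h / (l^2*p*D),
     szL01 r s r1 s1 l p D Z h / (s*l^2*p*D*Z),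
     szL02 r s r1 s1 l p D Z h / (s*l*D*Z),
     szL03 r s r1 s1 l p D Z h / D;
     szL10 r s r1 s1 l p D Z h / (l^2*D),
     szL11 r s r1 s1 l p D Z h / (s*l^2*D*Z),
     szL12 r s r1 s1 l p D Z h / (s*l*D*Z),
     szL13 r s r1 s1 l p D Z h / D;
     szL20 r s r1 s1 l p D Z h / (r*l^2*p*D),
     szL21 r s r1 s1 l p D Z h / (r*s*l^3*p*D*Z),
     szL22 r s r1 s1 l p D Z h / (r*s*l^2*p*D*Z),
     szL23 r s r1 s1 l p D Z h / (r*l*p*D);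
     szL30 r s r1 s1 l p D Z h / (r*l^3*D),
     szL31 r s r1 s1 l p D Z h / (r*s*l^4*D*Z),
     szL32 r s r1 s1 l p D Z h / (r*s*l^3*D*Z),
     szL33 r s r1 s1 l p D Z h / (r*l^2*D)]

/-- The relations between the parameters of the explicit solution. -/
structure SzRel {F : Type*} [Field F] (r s r1 s1 l p D Z h : F) : Prop where
  hr : r ≠ 0
  hs : s ≠ 0
  hl : l ≠ 0
  hp : p ≠ 0
  hD : D ≠ 0
  hZ : Z ≠ 0
  er1 : r1 = r + 1
  es1 : s1 = s + 1
  el : l = r + s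
  ep : p = s + r ^ 2
  eD : D = l ^ 3 + p ^ 2
  eZ : Z = p ^ 3 + l ^ 4
  hh : h ^ 2 = r^2*s^2*r1*s1*l*p * h + (s^10+s^11+s^12+s^13+r^3*s^8+r^3*s^9+r^3*s^10+r^3*s^11+r^5*s^7+r^5*s^9+r^6*s^6+r^6*s^7+r^6*s^9+r^7*s^5+r^7*s^9+r^8*s^4+r^8*s^8+r^10*s^3+r^10*s^5+r^10*s^6+r^11*s^3+r^11*s^4+r^11*s^5+r^11*s^6+r^12*s^3+r^12*s^4+r^12*s^5+r^12*s^6+r^13*s^3+r^13*s^5+r^14+r^18)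

/-- Numerator of `κ`. -/
def szKn {F : Type*} [Field F] (r s : F) : F :=
  s^10 + s^14 + r^4*s^8 + r^4*s^12 + r^6*s^6 + r^6*s^10 + r^8*s^4 + r^10*s^4 + r^10*s^6 +
  r^12*s^2 + r^12*s^6 + r^12*s^8 + r^14 + r^14*s^4 + r^16 + r^18 + r^18*s^2 + r^20

/-- Numerator of the correction term `z`. -/
def szZn {F : Type*} [Field F] (r s : F) : F :=
  s^10 + s^11 + s^12 + s^13 + r^2*s^9 + r^2*s^11 + r^5*s^8 + r^5*s^9 + r^6*s^10 + r^7*s^8 +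
  r^7*s^9 + r^8*s^4 + r^8*s^6 + r^8*s^7 + r^8*s^9 + r^9*s^4 + r^9*s^5 + r^9*s^6 + r^9*s^7 +
  r^10*s^4 + r^10*s^5 + r^10*s^7 + r^11*s^4 + r^11*s^5 + r^11*s^6 + r^11*s^7 + r^12*s^2 +
  r^12*s^6 + r^13*s^2 + r^13*s^3 + r^14 + r^14*s^2 + r^14*s^4 + r^15*s^2 + r^15*s^3 + r^18

set_option maxRecDepth 100000 in
set_option maxHeartbeats 4000000 in
lemma sz_kappa {F : Type*} [Field F] [CharP F 2] {r s r1 s1 l p : F}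
    (hr : r ≠ 0) (hs : s ≠ 0) (hr1 : r1 ≠ 0) (hs1 : s1 ≠ 0) (hl : l ≠ 0) (hp : p ≠ 0)
    (er1 : r1 = r + 1) (es1 : s1 = s + 1) (el : l = r + s) (ep : p = s + r ^ 2) :
    1 + (r ^ 3 / s + r ^ 3 / s ^ 2 + (r1 ^ 3 / s1 + r1 ^ 2 / s1)) +
      (szZn r s / (r^4*s^4*r1^2*s1^2*l^2*p^2) +
        szZn s (r^2) / (s^4*r^8*s1^2*r1^4*p^2*l^4)) =
      szKn r s / (r^8*s^2*r1^4*s1^2*l^4) := by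
  have key : r^8*s^4*r1^4*s1^2*l^4*p^2 + (r^3*(r^8*s^3*r1^4*s1^2*l^4*p^2) +
      r^3*(r^8*s^2*r1^4*s1^2*l^4*p^2) + (r1^3*(r^8*s^4*r1^4*s1*l^4*p^2) +
        r1^2*(r^8*s^4*r1^4*s1*l^4*p^2))) + (szZn r s * (r^4*r1^2*l^2) + szZn s (r^2)) =
      szKn r s * (s^2*p^2) := by
    clear hr hs hr1 hs1 hl hp
    subst ep el es1 er1
    simp only [szZn, szKn]
    grind
  have hE : r^8*s^4*r1^4*s1^2*l^4*p^2 ≠ 0 := by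
    simp [hr, hs, hr1, hs1, hl, hp]
  have fr : ∀ n d q : F, d * q = r^8*s^4*r1^4*s1^2*l^4*p^2 →
      n / d = n * q / (r^8*s^4*r1^4*s1^2*l^4*p^2) := by
    intro n d q h
    rw [← h] at hE ⊢
    rw [mul_div_mul_right _ _ (right_ne_zero_of_mul hE)]
  rw [← div_self hE, fr (r^3) s (r^8*s^3*r1^4*s1^2*l^4*p^2) (by ring),
    fr (r^3) (s^2) (r^8*s^2*r1^4*s1^2*l^4*p^2) (by ring),
    fr (r1^3) s1 (r^8*s^4*r1^4*s1*l^4*p^2) (by ring),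
    fr (r1^2) s1 (r^8*s^4*r1^4*s1*l^4*p^2) (by ring),
    fr (szZn r s) _ (r^4*r1^2*l^2) (by ring),
    fr (szZn s (r^2)) _ 1 (by ring),
    fr (szKn r s) _ (s^2*p^2) (by ring), ← key]
  ring

set_option maxRecDepth 100000 in
set_option maxHeartbeats 4000000 in
lemma sz_kappa_sq {F : Type*} [Field F] [CharP F 2] {r s r1 s1 l p : F}
    (er1 : r1 = r + 1) (es1 : s1 = s + 1) (el : l = r + s) (ep : p = s + r ^ 2) :
    szKn r s * (s^6*s1^2*p^4) + szKn s (r^2) * (r^4*l^4) =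
      (s^10+s^11+s^12+s^13+r^3*s^8+r^3*s^9+r^3*s^10+r^3*s^11+r^5*s^7+r^5*s^9+r^6*s^6+r^6*s^7+r^6*s^9+r^7*s^5+r^7*s^9+r^8*s^4+r^8*s^8+r^10*s^3+r^10*s^5+r^10*s^6+r^11*s^3+r^11*s^4+r^11*s^5+r^11*s^6+r^12*s^3+r^12*s^4+r^12*s^5+r^12*s^6+r^13*s^3+r^13*s^5+r^14+r^18)^2 := by
  subst ep el es1 er1
  simp only [szKn]
  grind

/-- The relation satisfied by the square root `h`. -/
lemma sz_h_rel {F : Type*} [Field F] [CharP F 2] {r s r1 s1 l p h β : F}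
    (hr : r ≠ 0) (hs : s ≠ 0) (hr1 : r1 ≠ 0) (hs1 : s1 ≠ 0) (hl : l ≠ 0) (hp : p ≠ 0)
    (er1 : r1 = r + 1) (es1 : s1 = s + 1) (el : l = r + s) (ep : p = s + r ^ 2)
    (hh : h ^ 2 = r^4*s^4*r1^2*s1^2*l^2*p^2*β)
    (hβ : β ^ 2 = β + szKn r s / (r^8*s^2*r1^4*s1^2*l^4) +
      szKn s (r^2) / (s^8*r^4*s1^4*r1^4*p^4)) :
    h ^ 2 = r^2*s^2*r1*s1*l*p * h + (s^10+s^11+s^12+s^13+r^3*s^8+r^3*s^9+r^3*s^10+r^3*s^11+r^5*s^7+r^5*s^9+r^6*s^6+r^6*s^7+r^6*s^9+r^7*s^5+r^7*s^9+r^8*s^4+r^8*s^8+r^10*s^3+r^10*s^5+r^10*s^6+r^11*s^3+r^11*s^4+r^11*s^5+r^11*s^6+r^12*s^3+r^12*s^4+r^12*s^5+r^12*s^6+r^13*s^3+r^13*s^5+r^14+r^18) := by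
  have key := sz_kappa_sq er1 es1 el ep
  generalize (s^10+s^11+s^12+s^13+r^3*s^8+r^3*s^9+r^3*s^10+r^3*s^11+r^5*s^7+r^5*s^9+r^6*s^6+r^6*s^7+r^6*s^9+r^7*s^5+r^7*s^9+r^8*s^4+r^8*s^8+r^10*s^3+r^10*s^5+r^10*s^6+r^11*s^3+r^11*s^4+r^11*s^5+r^11*s^6+r^12*s^3+r^12*s^4+r^12*s^5+r^12*s^6+r^13*s^3+r^13*s^5+r^14+r^18) = n at key ⊢
  have e1 : (h ^ 2) ^ 2 = (r^2*s^2*r1*s1*l*p * h + n) ^ 2 := by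
    rw [CharTwo.add_sq, mul_pow, hh, mul_pow, hβ, ← key]
    field_simp
    ring
  exact frobenius_inj F 2 (by simpa [frobenius_def] using e1)


set_option maxRecDepth 100000 in
set_option maxHeartbeats 4000000 in
lemma sz_polyX {F : Type*} [Field F] [CharP F 2] {r s r1 s1 l p Z : F}
    (er1 : r1 = r + 1) (es1 : s1 = s + 1) (el : l = r + s) (ep : p = s + r ^ 2)
    (eZ : Z = p ^ 3 + l ^ 4) :
    r^8*s^2*r1^4*s1^2*l^4 + szKn r s = (s^2+s^3+r^2*s^2+r^3+r^3*s+r^4)^2 * Z^2 := by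
  subst eZ ep el es1 er1
  simp only [szKn]
  grind

set_option maxRecDepth 100000 in
set_option maxHeartbeats 4000000 in
lemma sz_entX {F : Type*} [Field F] [CharP F 2] {r s r1 s1 l p D Z h β : F}
    (H : SzRel r s r1 s1 l p D Z h) (hr1 : r1 ≠ 0) (hs1 : s1 ≠ 0)
    (hh : h ^ 2 = r^4*s^4*r1^2*s1^2*l^2*p^2*β) {a b A B : F}
    (ha : a = r^4*r1^2*l^3 / (s*p*Z)) (hA : A = s^4*s1^2*p^3 / (r^2*l^2*D^2))
    (hb : b = a * A * β) (hB : B = A * a^2 * (β + szKn r s / (r^8*s^2*r1^4*s1^2*l^4))) :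
    p * (a^2*A + a*b + B) = (szX00 r s r1 s1 l p D Z h / (r*D))^2 ∧
    p * b = (h / (r*s*l*D*Z))^2 * (s*l*p*Z) ∧
    p * a = (r^2*r1*l / (s*Z))^2 * (s*l*Z) ∧
    p * (s*l*p*Z) * (a*A + b) = ((r^2*s^2*r1*s1*l*p^2+p*h) / (r*D))^2 ∧
    p * A = (s^2*s1*p^2 / (r*l*D))^2 ∧
    p * (s*l*Z) * a = (r^2*r1*l^2)^2 := by
  obtain ⟨hr, hs, hl, hp, hD, hZ, er1, es1, el, ep, eD, eZ, -⟩ := H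
  have key := sz_polyX er1 es1 el ep eZ
  refine ⟨?_, ?_, ?_, ?_, ?_, ?_⟩
  · have e : a^2*A + a*b + B = a^2*A*(1 + szKn r s / (r^8*s^2*r1^4*s1^2*l^4)) := by
      rw [hb, hB]
      linear_combination (a^2 * A * β) * (CharTwo.two_eq_zero : (2 : F) = 0)
    have e2 : 1 + szKn r s / (r^8*s^2*r1^4*s1^2*l^4) =
        (s^2+s^3+r^2*s^2+r^3+r^3*s+r^4)^2 * Z^2 / (r^8*s^2*r1^4*s1^2*l^4) := by
      rw [← key]; field_simp
    rw [e, e2, ha, hA, szX00]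
    generalize s^2+s^3+r^2*s^2+r^3+r^3*s+r^4 = w
    field_simp
  · rw [div_pow, hh, hb, ha, hA]; field_simp
  · rw [ha]; field_simp
  · rw [div_pow, CharTwo.add_sq, mul_pow p h, hh, hb, ha, hA]; field_simp
  · rw [hA]; field_simp
  · rw [ha]; field_simp

set_option maxRecDepth 100000 in
set_option maxHeartbeats 4000000 in
lemma sz_polyY {F : Type*} [Field F] [CharP F 2] {r s r1 s1 l p D Z : F}
    (er1 : r1 = r + 1) (es1 : s1 = s + 1) (el : l = r + s) (ep : p = s + r ^ 2)
    (eD : D = l ^ 3 + p ^ 2) (eZ : Z = p ^ 3 + l ^ 4) :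
    s^2*s1^2*p^4*(s^2+s^3+r^2*s^2+r^3+r^3*s+r^4)^2 + r^6*s1^2*p^2*D^2 + s^2*D^4 = (s^3+r*s^2+r^2*s^2+r^3+r^4+r^4*s)^2 * (r^4*l^6) ∧
    r^2*s^4*s1^2*r1^4*l^4*p^2 + Z^2*D^2 = (s^5+s^7+r^3*s^6+r^4*s^2+r^5*s^2+r^5*s^3+r^5*s^5+r^6*s+r^6*s^2+r^6*s^3+r^7+r^7*s+r^7*s^3+r^8+r^9+r^10)^2 := by
  subst eZ eD ep el es1 er1
  constructor <;> grind

set_option maxRecDepth 100000 in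
set_option maxHeartbeats 4000000 in
lemma sz_entY {F : Type*} [Field F] [CharP F 2] {r s r1 s1 l p D Z h β : F}
    (H : SzRel r s r1 s1 l p D Z h) (hr1 : r1 ≠ 0) (hs1 : s1 ≠ 0)
    (hh : h ^ 2 = r^4*s^4*r1^2*s1^2*l^2*p^2*β) {c d C E : F}
    (hc : c = r^2*s*s1^2*p / (l*Z)) (hC : C = r^2*s^2*r1^4*l^2 / (p*D^2))
    (hd : d = c * C * β + r^2*Z / (s*l^3*p^2))
    (hE : E = C * c^2 * (β + szKn r s / (r^8*s^2*r1^4*s1^2*l^4)) + s^2*D^2 / (r^2*p^3*l^4)) :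
    p * (c^2*C + c*d + E) = (szY00 r s r1 s1 l p D Z h / (p*D))^2 ∧
    p * d = ((r*D*Z+r1*l*h) / (s*l^2*p*D*Z))^2 * (s*l*p*Z) ∧
    p * c = (r*s1*p / (l*Z))^2 * (s*l*Z) ∧
    p * (s*l*p*Z) * (c*C + d) = (szY10 r s r1 s1 l p D Z h / (l*D))^2 ∧
    p * C = (r*s*r1^2*l / D)^2 ∧
    p * (s*l*Z) * c = (r*s*s1*p)^2 := by
  obtain ⟨hr, hs, hl, hp, hD, hZ, er1, es1, el, ep, eD, eZ, -⟩ := H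
  have key := sz_polyX er1 es1 el ep eZ
  obtain ⟨k1, k2⟩ := sz_polyY er1 es1 el ep eD eZ
  refine ⟨?_, ?_, ?_, ?_, ?_, ?_⟩
  · have e : c^2*C + c*d + E = c^2*C*(1 + szKn r s / (r^8*s^2*r1^4*s1^2*l^4)) +
        (c * (r^2*Z / (s*l^3*p^2)) + s^2*D^2 / (r^2*p^3*l^4)) := by
      rw [hd, hE]
      linear_combination (c^2 * C * β) * (CharTwo.two_eq_zero : (2 : F) = 0)
    have e2 : 1 + szKn r s / (r^8*s^2*r1^4*s1^2*l^4) =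
        (s^2+s^3+r^2*s^2+r^3+r^3*s+r^4)^2 * Z^2 / (r^8*s^2*r1^4*s1^2*l^4) := by
      rw [← key]; field_simp
    rw [e, e2, hc, hC, szY00]
    clear key e e2 hE hd k2 hc hC hh
    generalize (s^2+s^3+r^2*s^2+r^3+r^3*s+r^4) = w at *
    generalize (s^3+r*s^2+r^2*s^2+r^3+r^4+r^4*s) = v at *
    field_simp
    linear_combination k1
  · rw [div_pow, CharTwo.add_sq, mul_pow _ h, hh, hd, hc, hC]; field_simp; ring
  · rw [hc]; field_simp
  · rw [div_pow, szY10, CharTwo.add_sq, mul_pow _ h, mul_pow _ r, ← k2, hh, hd, hc, hC]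
    field_simp
    ring
  · rw [hC]; field_simp
  · rw [hc]; field_simp

set_option maxRecDepth 100000 in
set_option maxHeartbeats 4000000 in
lemma sz_prod_Y {F : Type*} [Field F] [CharP F 2] {r s r1 s1 l p D Z h : F}
    (H : SzRel r s r1 s1 l p D Z h) :
    szX r s r1 s1 l p D Z h * szT r s r1 s1 l p D Z h = szY r s r1 s1 l p D Z h := by
  obtain ⟨hr, hs, hl, hp, hD, hZ, er1, es1, el, ep, eD, eZ, hh⟩ := H
  unfold szX szT szY
  refine sz_mul4
    (sz_entry hh (s*l*p*Z) p l Z (r*s*l*Z) (r*s*l*p*D*Z) 0 ?_)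
    (sz_entry hh 1 (l*p) l 1 r (r*s*l^2*p*D*Z) 0 ?_)
    (sz_entry hh 1 1 l 1 s (s*l*Z) 0 ?_)
    (sz_entry hh 1 1 1 1 1 1 0 ?_)
    (sz_entry hh (l*p) p l 1 (r*p) (r*l*p*D) 0 ?_)
    (sz_entry hh 1 p 1 1 (r*l*p) (r*l*p*D) 0 ?_)
    (sz_entry hh 1 1 1 1 1 1 0 ?_)
    (sz_entry hh 1 1 1 1 1 1 0 ?_)
    (sz_entry hh 1 1 1 1 1 1 0 ?_)
    (sz_entry hh 1 1 1 1 1 1 0 ?_)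
    (sz_entry hh 1 1 1 1 1 1 0 ?_)
    (sz_entry hh 1 1 1 1 1 1 0 ?_)
    (sz_entry hh 1 1 1 1 1 1 0 ?_)
    (sz_entry hh 1 1 1 1 1 1 0 ?_)
    (sz_entry hh 1 1 1 1 1 1 0 ?_)
    (sz_entry hh 1 1 1 1 1 1 0 ?_)
  all_goals
    refine ⟨by simp [hr, hs, hl, hp, hD, hZ], ?_, ?_, ?_, ?_, by ring, ?_⟩
    iterate 4 first | exact Or.inl (by ring1) | exact Or.inr (by ring1)
    clear hh hr hs hl hp hD hZ
    subst eZ eD ep el es1 er1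
    try simp only [szX00, szT20, szT30, szT31, szY00, szY10]
    grind

set_option maxRecDepth 100000 in
set_option maxHeartbeats 4000000 in
lemma sz_prod_one {F : Type*} [Field F] [CharP F 2] {r s r1 s1 l p D Z h : F}
    (H : SzRel r s r1 s1 l p D Z h) :
    szT r s r1 s1 l p D Z h * szTi r s r1 s1 l p D Z h = 1 := by
  obtain ⟨hr, hs, hl, hp, hD, hZ, er1, es1, el, ep, eD, eZ, hh⟩ := H
  unfold szT szTi
  rw [sz_one4]
  refine sz_mul4
    (sz_entry hh 1 1 1 1 1 1 0 ?_)
    (sz_entry hh 1 1 1 1 1 1 0 ?_)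
    (sz_entry hh 1 1 1 1 1 1 0 ?_)
    (sz_entry hh 1 1 1 1 1 1 0 ?_)
    (sz_entry hh 1 1 1 1 1 1 0 ?_)
    (sz_entry hh 1 1 1 1 1 1 0 ?_)
    (sz_entry hh 1 1 1 1 1 1 0 ?_)
    (sz_entry hh 1 1 1 1 1 1 0 ?_)
    (sz_entry hh l 1 1 1 (r*l*p*D) (r*l*p*D) 0 ?_)
    (sz_entry hh 1 1 1 1 (r*l*p*D) (r*l*p*D) 0 ?_)
    (sz_entry hh 1 1 1 1 1 1 0 ?_)
    (sz_entry hh 1 1 1 1 1 1 0 ?_)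
    (sz_entry hh (l*Z) 1 1 (l*Z) (r*s*l^2*p*D*Z) (r*s*l^2*p*D*Z) 0 ?_)
    (sz_entry hh 1 1 1 l (r*s*l^2*p*D*Z) (r*s*l^2*p*D*Z) 0 ?_)
    (sz_entry hh 1 1 1 1 (s*l*Z) (s*l*Z) 0 ?_)
    (sz_entry hh 1 1 1 1 1 1 0 ?_)
  all_goals
    refine ⟨by simp [hr, hs, hl, hp, hD, hZ], ?_, ?_, ?_, ?_, by ring, ?_⟩
    iterate 4 first | exact Or.inl (by ring1) | exact Or.inr (by ring1)
    clear hh hr hs hl hp hD hZ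
    subst eZ eD ep el es1 er1
    try simp only [szT20, szT30, szT31, szTi20, szTi30, szTi31]
    grind

set_option maxRecDepth 100000 in
set_option maxHeartbeats 4000000 in
lemma sz_prod_S {F : Type*} [Field F] [CharP F 2] {r s r1 s1 l p D Z h : F}
    (H : SzRel r s r1 s1 l p D Z h) :
    szT r s r1 s1 l p D Z h * szT r s r1 s1 l p D Z h = szS r s r1 s1 l p D Z h := by
  obtain ⟨hr, hs, hl, hp, hD, hZ, er1, es1, el, ep, eD, eZ, hh⟩ := H
  unfold szT szS
  refine sz_mul4
    (sz_entry hh 1 1 1 1 1 1 0 ?_)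
    (sz_entry hh 1 1 1 1 1 1 0 ?_)
    (sz_entry hh 1 1 1 1 1 1 0 ?_)
    (sz_entry hh 1 1 1 1 1 1 0 ?_)
    (sz_entry hh 1 1 1 1 1 1 0 ?_)
    (sz_entry hh 1 1 1 1 1 1 0 ?_)
    (sz_entry hh 1 1 1 1 1 1 0 ?_)
    (sz_entry hh 1 1 1 1 1 1 0 ?_)
    (sz_entry hh l 1 l 1 (r*D) (r*l*p*D) 0 ?_)
    (sz_entry hh 1 1 1 1 (r*l*p*D) (r*l*p*D) 0 ?_)
    (sz_entry hh 1 1 1 1 1 1 0 ?_)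
    (sz_entry hh 1 1 1 1 1 1 0 ?_)
    (sz_entry hh (l*Z) 1 l (l*Z) (r*s*D*Z) (r*s*l^2*p*D*Z) 0 ?_)
    (sz_entry hh 1 1 1 1 (r*s*D*Z) (r*s*l^2*p*D*Z) 0 ?_)
    (sz_entry hh 1 1 1 1 (s*l*Z) (s*l*Z) 0 ?_)
    (sz_entry hh 1 1 1 1 1 1 0 ?_)
  all_goals
    refine ⟨by simp [hr, hs, hl, hp, hD, hZ], ?_, ?_, ?_, ?_, by ring, ?_⟩
    iterate 4 first | exact Or.inl (by ring1) | exact Or.inr (by ring1)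
    clear hh hr hs hl hp hD hZ
    subst eZ eD ep el es1 er1
    try simp only [szT20, szT30, szT31]
    grind

set_option maxRecDepth 100000 in
set_option maxHeartbeats 4000000 in
lemma sz_prod_K {F : Type*} [Field F] [CharP F 2] {r s r1 s1 l p D Z h : F}
    (H : SzRel r s r1 s1 l p D Z h) :
    szS r s r1 s1 l p D Z h * szX r s r1 s1 l p D Z h = szK r s r1 s1 l p D Z h := by
  obtain ⟨hr, hs, hl, hp, hD, hZ, er1, es1, el, ep, eD, eZ, hh⟩ := H
  unfold szS szX szK
  refine sz_mul4
    (sz_entry hh 1 1 1 1 1 (r*D) 0 ?_)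
    (sz_entry hh 1 1 1 1 1 (r*s*l*D*Z) 0 ?_)
    (sz_entry hh 1 1 1 1 1 (s*Z) 0 ?_)
    (sz_entry hh 1 1 1 1 1 1 0 ?_)
    (sz_entry hh 1 1 1 1 1 (r*D) 0 ?_)
    (sz_entry hh 1 1 1 1 1 (r*l*D) 0 ?_)
    (sz_entry hh 1 1 1 1 1 1 0 ?_)
    (sz_entry hh 1 1 1 1 1 1 0 ?_)
    (sz_entry hh 1 1 (r*l*p*D) 1 p (r*l*p*D) 0 ?_)
    (sz_entry hh 1 1 (r*s*l^2*p*D*Z) 1 (s*Z) (r*s*l^2*p*D*Z) 0 ?_)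
    (sz_entry hh 1 1 1 1 (s*l*Z) (s*l*p*Z) 0 ?_)
    (sz_entry hh 1 1 1 1 1 (l*p) 0 ?_)
    (sz_entry hh 1 1 1 (r*l^2*p*D) p (r*l^2*p*D) 0 ?_)
    (sz_entry hh 1 (s*Z) 1 1 1 (r*s*l^3*p*D*Z) 0 ?_)
    (sz_entry hh 1 (s*Z) 1 1 1 (s*l^2*p*Z) 0 ?_)
    (sz_entry hh 1 1 1 1 1 (l^2*p) 0 ?_)
  all_goals
    refine ⟨by simp [hr, hs, hl, hp, hD, hZ], ?_, ?_, ?_, ?_, by ring, ?_⟩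
    iterate 4 first | exact Or.inl (by ring1) | exact Or.inr (by ring1)
    clear hh hr hs hl hp hD hZ
    subst eZ eD ep el es1 er1
    try simp only [szX00, szK00, szK20, szK30, szK32]
    grind

set_option maxRecDepth 100000 in
set_option maxHeartbeats 4000000 in
lemma sz_prod_P {F : Type*} [Field F] [CharP F 2] {r s r1 s1 l p D Z h : F}
    (H : SzRel r s r1 s1 l p D Z h) :
    szX r s r1 s1 l p D Z h * szK r s r1 s1 l p D Z h = szP r s r1 s1 l p D Z h := by
  obtain ⟨hr, hs, hl, hp, hD, hZ, er1, es1, el, ep, eD, eZ, hh⟩ := H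
  unfold szX szK szP
  refine sz_mul4
    (sz_entry hh (s*l^2*Z) l (r*l*D) (r*s*D*Z) (r*s*D*Z) (r^2*s*l^2*D^2*Z) (l*p) ?_)
    (sz_entry hh (l^2*p) (l*p) (r*l*D) (r*D) (r*p*D) (r^2*s*l^3*p*D^2*Z) 0 ?_)
    (sz_entry hh (l^2*p) (l*p) (r*l^2*D) (r*D) p (r*s*l^2*p*D*Z) 0 ?_)
    (sz_entry hh (s*l^2*p*Z) 1 (r*l*D) (r*s*D*Z) (s*p*Z) (r*s*l^2*p*D*Z) 0 ?_)
    (sz_entry hh l 1 (r*D) 1 (r*D) (r^2*l*D^2) 0 ?_)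
    (sz_entry hh (l*p) (s*p*Z) (r*s*D*Z) 1 (r*p*D) (r^2*s*l^2*p*D^2*Z) (l*p^2) ?_)
    (sz_entry hh (l*p) (s*p*Z) (r*s*l*D*Z) 1 p (r*s*l*p*D*Z) 0 ?_)
    (sz_entry hh (l*p) 1 (r*D) 1 p (r*l*p*D) 0 ?_)
    (sz_entry hh 1 1 1 1 1 (r*D) 0 ?_)
    (sz_entry hh 1 (s*Z) 1 1 1 (r*s*l*D*Z) 0 ?_)
    (sz_entry hh 1 (s*Z) 1 1 1 (s*Z) 0 ?_)
    (sz_entry hh 1 1 1 1 1 1 0 ?_)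
    (sz_entry hh 1 1 1 1 1 (r*D) 0 ?_)
    (sz_entry hh 1 1 1 1 1 (r*s*l*D*Z) 0 ?_)
    (sz_entry hh 1 1 1 1 1 (s*Z) 0 ?_)
    (sz_entry hh 1 1 1 1 1 1 0 ?_)
  all_goals
    refine ⟨by simp [hr, hs, hl, hp, hD, hZ], ?_, ?_, ?_, ?_, by ring, ?_⟩
    iterate 4 first | exact Or.inl (by ring1) | exact Or.inr (by ring1)
    clear hh hr hs hl hp hD hZ
    subst eZ eD ep el es1 er1
    try simp only [szX00, szK00, szK20, szK30, szK32, szP00, szP01, szP02, szP03, szP10, szP11, szP12, szP13, szP22, szP30]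
    grind

set_option maxRecDepth 100000 in
set_option maxHeartbeats 4000000 in
lemma sz_prod_M {F : Type*} [Field F] [CharP F 2] {r s r1 s1 l p D Z h : F}
    (H : SzRel r s r1 s1 l p D Z h) :
    szX r s r1 s1 l p D Z h * szP r s r1 s1 l p D Z h = szM r s r1 s1 l p D Z h := by
  obtain ⟨hr, hs, hl, hp, hD, hZ, er1, es1, el, ep, eD, eZ, hh⟩ := H
  unfold szX szP szM
  refine sz_mul4
    (sz_entry hh (s*Z) 1 (r*l^2*D) (r*s*l^2*D*Z) (r^2*s*l^2*D*Z) (r^2*s*l^2*D^2*Z) (p^2) ?_)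
    (sz_entry hh (s*Z) 1 (r*l^2*D) (r*s*l^2*D*Z) (r^2*s*l^2*D*Z) (r^2*s^2*l^3*D^2*Z^2) (s*Z) ?_)
    (sz_entry hh (s*Z) 1 (r^2*l^2*D^2) (r^2*s*l^2*D^2*Z) (r*s*D*Z) (r^2*s^2*l^2*D^2*Z^2) (r^2*r1*l^2*p) ?_)
    (sz_entry hh (s*Z) 1 (r^2*l^2*D^2) (r^2*s*l^2*D^2*Z) (r*s*D*Z) (r^2*s*l^2*D^2*Z) (l*p) ?_)
    (sz_entry hh 1 1 (r*l^2*D) 1 (r^2*l^2*D) (r^2*l^2*D^2) p ?_)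
    (sz_entry hh 1 1 (r*l^2*D) 1 (r^2*l^2*D) (r^2*s*l^3*D^2*Z) ((s^2+r*s^2+r^2*s+r^3)*p) ?_)
    (sz_entry hh 1 1 (r^2*l^2*D^2) 1 (r*D) (r^2*s*l^2*D^2*Z) (l*p^2) ?_)
    (sz_entry hh 1 1 (r^2*l^2*D^2) 1 (r*D) (r^2*l^2*D^2) 0 ?_)
    (sz_entry hh 1 l 1 1 l (r*l^2*D) 0 ?_)
    (sz_entry hh 1 l 1 1 l (r*s*l^3*D*Z) 0 ?_)
    (sz_entry hh 1 l 1 1 l (r*s*l^2*D*Z) 0 ?_)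
    (sz_entry hh 1 l 1 1 l (r*l^2*D) 0 ?_)
    (sz_entry hh 1 1 1 1 1 (r*l^2*D) 0 ?_)
    (sz_entry hh 1 1 1 1 1 (r*s*l^3*D*Z) 0 ?_)
    (sz_entry hh 1 1 1 1 1 (r*s*l^2*D*Z) 0 ?_)
    (sz_entry hh 1 1 1 1 1 (r*l^2*D) 0 ?_)
  all_goals
    refine ⟨by simp [hr, hs, hl, hp, hD, hZ], ?_, ?_, ?_, ?_, by ring, ?_⟩
    iterate 4 first | exact Or.inl (by ring1) | exact Or.inr (by ring1)
    clear hh hr hs hl hp hD hZ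
    subst eZ eD ep el es1 er1
    try simp only [szX00, szP00, szP01, szP02, szP03, szP10, szP11, szP12, szP13, szP22, szP30, szM00, szM01, szM02, szM03, szM10, szM11, szM12, szM13, szM20, szM21, szM22, szM23, szM30, szM31, szM32, szM33]
    grind

set_option maxRecDepth 100000 in
set_option maxHeartbeats 4000000 in
lemma sz_prod_V {F : Type*} [Field F] [CharP F 2] {r s r1 s1 l p D Z h : F}
    (H : SzRel r s r1 s1 l p D Z h) :
    szTi r s r1 s1 l p D Z h * szX r s r1 s1 l p D Z h = szV r s r1 s1 l p D Z h := by
  obtain ⟨hr, hs, hl, hp, hD, hZ, er1, es1, el, ep, eD, eZ, hh⟩ := H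
  unfold szTi szX szV
  refine sz_mul4
    (sz_entry hh 1 1 1 1 1 (r*D) 0 ?_)
    (sz_entry hh 1 1 1 1 1 (r*s*l*D*Z) 0 ?_)
    (sz_entry hh 1 1 1 1 1 (s*Z) 0 ?_)
    (sz_entry hh 1 1 1 1 1 1 0 ?_)
    (sz_entry hh 1 1 1 1 1 (r*D) 0 ?_)
    (sz_entry hh 1 (s*Z) 1 1 1 (r*s*l*D*Z) 0 ?_)
    (sz_entry hh 1 (s*Z) 1 1 1 (s*Z) 0 ?_)
    (sz_entry hh 1 1 1 1 1 1 0 ?_)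
    (sz_entry hh 1 1 (r^2*l*p*D^2) 1 (r^2*p*D) (r^2*l*p*D^2) 0 ?_)
    (sz_entry hh 1 (s*Z) (r^2*s*l^2*p*D^2*Z) 1 (r^2*D) (r^2*s*l^2*p*D^2*Z) (l^2) ?_)
    (sz_entry hh 1 (s*Z) 1 1 1 (r*s*l*p*D*Z) 0 ?_)
    (sz_entry hh 1 1 1 1 1 (r*l*p*D) 0 ?_)
    (sz_entry hh Z 1 (r^2*p*D^2) (r^2*s*l*p*D^2*Z) (r^2*s*l*p*D*Z) (r^2*s*l*p*D^2*Z) (l*p) ?_)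
    (sz_entry hh 1 s (r^2*s*l*p*D^2) 1 (r^2*l*D) (r^2*s^2*l^2*p*D^2*Z) r ?_)
    (sz_entry hh 1 s 1 1 1 (r*s^2*l*p*D*Z) 0 ?_)
    (sz_entry hh 1 1 1 1 1 (r*s*l*p*D) 0 ?_)
  all_goals
    refine ⟨by simp [hr, hs, hl, hp, hD, hZ], ?_, ?_, ?_, ?_, by ring, ?_⟩
    iterate 4 first | exact Or.inl (by ring1) | exact Or.inr (by ring1)
    clear hh hr hs hl hp hD hZ
    subst eZ eD ep el es1 er1
    try simp only [szTi20, szTi30, szTi31, szX00, szV00, szV10, szV12, szV20, szV21, szV22, szV23, szV31, szV32, szV33]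
    grind

set_option maxRecDepth 100000 in
set_option maxHeartbeats 4000000 in
lemma sz_prod_N {F : Type*} [Field F] [CharP F 2] {r s r1 s1 l p D Z h : F}
    (H : SzRel r s r1 s1 l p D Z h) :
    szX r s r1 s1 l p D Z h * szV r s r1 s1 l p D Z h = szN r s r1 s1 l p D Z h := by
  obtain ⟨hr, hs, hl, hp, hD, hZ, er1, es1, el, ep, eD, eZ, hh⟩ := H
  unfold szX szV szN
  refine sz_mul4
    (sz_entry hh (s*l*Z) 1 (r^2*D) (r^2*s*l*D*Z) (r*D*Z) (r^2*s*l*D^2*Z) p ?_)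
    (sz_entry hh (s*l*p*Z) p (r^2*D) (r^2*l*D*Z) (r*s*p*D*Z) (r^2*s^2*l^2*p*D^2*Z^2) (r*p*D) ?_)
    (sz_entry hh (s*l*p*Z) p 1 Z (r*s*p*Z) (r*s^2*l*p*D*Z^2) 0 ?_)
    (sz_entry hh (s*l*p*Z) p 1 Z (r*s*l*p*Z) (r*s*l*p*D*Z) 0 ?_)
    (sz_entry hh l 1 (r^2*D) 1 (r*l*D) (r^2*l*D^2) 0 ?_)
    (sz_entry hh (l*p) p (r^2*D) 1 (r*l*p*D) (r^2*s*l^2*p*D^2*Z) (l*p^2) ?_)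
    (sz_entry hh (l*p) p 1 1 (r*l*p) (r*s*l*p*D*Z) 0 ?_)
    (sz_entry hh (l*p) p 1 1 (r*l*p) (r*l*p*D) 0 ?_)
    (sz_entry hh 1 1 1 1 1 (r*D) 0 ?_)
    (sz_entry hh 1 1 1 1 s (r*s*l*D*Z) 0 ?_)
    (sz_entry hh 1 1 1 1 s (s*Z) 0 ?_)
    (sz_entry hh 1 1 1 1 1 1 0 ?_)
    (sz_entry hh 1 1 1 1 1 (r*D) 0 ?_)
    (sz_entry hh 1 1 1 1 1 (r*s*l*D*Z) 0 ?_)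
    (sz_entry hh 1 1 1 1 1 (s*Z) 0 ?_)
    (sz_entry hh 1 1 1 1 1 1 0 ?_)
  all_goals
    refine ⟨by simp [hr, hs, hl, hp, hD, hZ], ?_, ?_, ?_, ?_, by ring, ?_⟩
    iterate 4 first | exact Or.inl (by ring1) | exact Or.inr (by ring1)
    clear hh hr hs hl hp hD hZ
    subst eZ eD ep el es1 er1
    try simp only [szX00, szV00, szV10, szV12, szV20, szV21, szV22, szV23, szV31, szV32, szV33, szN00, szN01, szN02, szN03, szN10, szN11, szN12, szN13, szN22, szN30]
    grind

set_option maxRecDepth 100000 in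
set_option maxHeartbeats 4000000 in
lemma sz_prod_R {F : Type*} [Field F] [CharP F 2] {r s r1 s1 l p D Z h : F}
    (H : SzRel r s r1 s1 l p D Z h) :
    szT r s r1 s1 l p D Z h * szN r s r1 s1 l p D Z h = szR r s r1 s1 l p D Z h := by
  obtain ⟨hr, hs, hl, hp, hD, hZ, er1, es1, el, ep, eD, eZ, hh⟩ := H
  unfold szT szN szR
  refine sz_mul4
    (sz_entry hh 1 1 1 1 1 (r*s*l*D) 0 ?_)
    (sz_entry hh 1 1 1 1 1 (r*s*l^2*D*Z) 0 ?_)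
    (sz_entry hh 1 1 1 1 1 (s*l*D*Z) 0 ?_)
    (sz_entry hh 1 1 1 1 1 D 0 ?_)
    (sz_entry hh 1 (s*l) 1 1 1 (r*s*l*D) 0 ?_)
    (sz_entry hh 1 l 1 1 1 (r*s*l^2*D*Z) 0 ?_)
    (sz_entry hh 1 l 1 1 1 (s*l*D*Z) 0 ?_)
    (sz_entry hh 1 1 1 1 1 D 0 ?_)
    (sz_entry hh 1 s (r*s*l*p*D) 1 (r^2*l*D) (r^2*s*l*p*D^2) l ?_)
    (sz_entry hh 1 1 (r*s*l*p*D) 1 (r^2*l*D) (r^2*s*l^2*p*D^2*Z) (l*p) ?_)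
    (sz_entry hh 1 1 (r*s*l*p*D^2) 1 (p*D) (r*s*l*p*D^2*Z) (r1*l) ?_)
    (sz_entry hh l 1 (r*l*p*D^2) 1 D (r*l*p*D^2) 0 ?_)
    (sz_entry hh Z s (r*s*l*p*D) (r*s^2*l^2*p*D*Z) (r^2*s^2*l^2*p*D*Z) (r^2*s^2*l^2*p*D^2*Z) ((s^4+r*s^3+r^2*s^2+r^2*s^3+r^3*s^3+r^4*s+r^5+r^7)) ?_)
    (sz_entry hh Z 1 (r*s*l*p*D) (r*s*l^2*p*D*Z) (r^2*s*l*p*D*Z) (r^2*s^2*l^3*p*D^2*Z^2) ((s^2+r*s+r^2+r^3)*Z) ?_)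
    (sz_entry hh Z 1 (r*s*l*p*D^2) (r*s*l^2*p*D^2*Z) (s*p*D*Z) (r*s^2*l^2*p*D^2*Z^2) (r*r1*p*D) ?_)
    (sz_entry hh (l*Z) 1 (r*l*p*D^2) (r*s*l^2*p*D^2*Z) (s*p*D*Z) (r*s*l^2*p*D^2*Z) (r1*l^2) ?_)
  all_goals
    refine ⟨by simp [hr, hs, hl, hp, hD, hZ], ?_, ?_, ?_, ?_, by ring, ?_⟩
    iterate 4 first | exact Or.inl (by ring1) | exact Or.inr (by ring1)
    clear hh hr hs hl hp hD hZ
    subst eZ eD ep el es1 er1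
    try simp only [szT20, szT30, szT31, szN00, szN01, szN02, szN03, szN10, szN11, szN12, szN13, szN22, szN30, szR00, szR01, szR02, szR03, szR10, szR11, szR12, szR13, szR20, szR21, szR22, szR23, szR31, szR32, szR33]
    grind

set_option maxRecDepth 100000 in
set_option maxHeartbeats 4000000 in
lemma sz_prod_L {F : Type*} [Field F] [CharP F 2] {r s r1 s1 l p D Z h : F}
    (H : SzRel r s r1 s1 l p D Z h) :
    szR r s r1 s1 l p D Z h * szT r s r1 s1 l p D Z h = szL r s r1 s1 l p D Z h := by
  obtain ⟨hr, hs, hl, hp, hD, hZ, er1, es1, el, ep, eD, eZ, hh⟩ := H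
  unfold szR szT szL
  refine sz_mul4
    (sz_entry hh (l*p*D*Z) (p*D) l (l*Z) (r*s*D*Z) (r*s*l^2*p*D^2*Z) (r1*l^2) ?_)
    (sz_entry hh 1 (p*D) 1 1 (r*D) (r*s*l^2*p*D^2*Z) 0 ?_)
    (sz_entry hh 1 1 1 1 1 (s*l*D*Z) 0 ?_)
    (sz_entry hh 1 1 1 1 1 D 0 ?_)
    (sz_entry hh (l*p*D*Z) (p*D) l (l*Z) (r*s*p*D*Z) (r*s*l^2*p*D^2*Z) (r^2*r1^2*l*D) ?_)
    (sz_entry hh 1 (p*D) 1 1 (r*p*D) (r*s*l^2*p*D^2*Z) (r1*l^2) ?_)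
    (sz_entry hh 1 1 1 1 1 (s*l*D*Z) 0 ?_)
    (sz_entry hh 1 1 1 1 1 D 0 ?_)
    (sz_entry hh (r^2*l^2*p*D*Z) (r^2*l*p*D) (l*p) Z (r*s*p*D*Z) (r^2*s*l^2*p^2*D^2*Z) ((s^6+s^7+r*s^5+r*s^6+r^2*s^4+r^2*s^6+r^4*s^5+r^5*s^2+r^5*s^4+r^6*s^3+r^8+r^9+r^9*s+r^10*s)) ?_)
    (sz_entry hh 1 (r^2*l^2*p*D) (l*p) 1 (r*p*D) (r^2*s*l^3*p^2*D^2*Z) ((s^2+r^2*s+r^3+r^3*s)*l^2) ?_)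
    (sz_entry hh 1 1 (l*p) 1 1 (r*s*l^2*p*D*Z) 0 ?_)
    (sz_entry hh 1 1 1 1 1 (r*l*p*D) 0 ?_)
    (sz_entry hh (r^2*s*l^3*p*D*Z) (r^2*l*p*D) l Z (r*s*p*D*Z) (r^2*s*l^3*p*D^2*Z) ((s^4+r*s^3+r*s^4+r^2*s^2+r^3*s^2+r^4*s^2+r^5+r^5*s+r^6+r^7)) ?_)
    (sz_entry hh 1 (r^2*l^2*p*D) l 1 (r*p*D) (r^2*s*l^4*p*D^2*Z) (l^2) ?_)
    (sz_entry hh 1 1 l 1 1 (r*s*l^3*D*Z) 0 ?_)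
    (sz_entry hh 1 1 1 1 1 (r*l^2*D) 0 ?_)
  all_goals
    refine ⟨by simp [hr, hs, hl, hp, hD, hZ], ?_, ?_, ?_, ?_, by ring, ?_⟩
    iterate 4 first | exact Or.inl (by ring1) | exact Or.inr (by ring1)
    clear hh hr hs hl hp hD hZ
    subst eZ eD ep el es1 er1
    try simp only [szR00, szR01, szR02, szR03, szR10, szR11, szR12, szR13, szR20, szR21, szR22, szR23, szR31, szR32, szR33, szT20, szT30, szT31, szL00, szL01, szL02, szL03, szL10, szL11, szL12, szL13, szL20, szL21, szL22, szL23, szL30, szL31, szL32, szL33]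
    grind

set_option maxRecDepth 100000 in
set_option maxHeartbeats 4000000 in
lemma sz_prod_L2 {F : Type*} [Field F] [CharP F 2] {r s r1 s1 l p D Z h : F}
    (H : SzRel r s r1 s1 l p D Z h) :
    szM r s r1 s1 l p D Z h * szX r s r1 s1 l p D Z h = p • szL r s r1 s1 l p D Z h := by
  obtain ⟨hr, hs, hl, hp, hD, hZ, er1, es1, el, ep, eD, eZ, hh⟩ := H
  unfold szM szX szL
  rw [sz_smul4]
  refine sz_mul4
    (sz_entry_smul hh (s*l^2*p*Z) (l*p) (p*D) (s*p*D*Z) (r*s*D*Z) (r*s*l^2*p*D^2*Z) (r1*l*p^2) ?_)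
    (sz_entry_smul hh (l*p) p (p*D) 1 (r*D) (r*s*l^2*p*D^2*Z) 0 ?_)
    (sz_entry_smul hh l 1 1 1 1 (s*l*D*Z) 0 ?_)
    (sz_entry_smul hh 1 1 1 1 1 D 0 ?_)
    (sz_entry_smul hh (s*l^2*Z) l D (s*D*Z) (r*s*D*Z) (r*s*l^2*D^2*Z) 0 ?_)
    (sz_entry_smul hh l 1 D 1 (r*D) (r*s*l^2*D^2*Z) (r1*l*p) ?_)
    (sz_entry_smul hh l 1 1 1 1 (s*l*D*Z) 0 ?_)
    (sz_entry_smul hh 1 1 1 1 1 D 0 ?_)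
    (sz_entry_smul hh (s*l*p*Z) p (r*l*p*D) (r*s*l*p*D*Z) (r*s*D*Z) (r^2*s*l^2*p*D^2*Z) ((s^3+s^4+r^2*s^2+r^2*s^3+r^3*s+r^4+r^4*s+r^5)*p^3) ?_)
    (sz_entry_smul hh (l*p) p (r*l^2*p*D) 1 (r*D) (r^2*s*l^3*p*D^2*Z) ((s^2+r^2*s+r^3+r^3*s)*l*p) ?_)
    (sz_entry_smul hh (l*p) p 1 1 1 (r*s*l^2*p*D*Z) 0 ?_)
    (sz_entry_smul hh p 1 1 1 1 (r*l*p*D) 0 ?_)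
    (sz_entry_smul hh (s*l*Z) 1 (r*l*D) (r*s*l*D*Z) (r*s*D*Z) (r^2*s*l^3*D^2*Z) ((s^2+r*s^2+r^2*s+r^3)*p^2) ?_)
    (sz_entry_smul hh l 1 (r*l^2*D) 1 (r*D) (r^2*s*l^4*D^2*Z) (l*p) ?_)
    (sz_entry_smul hh l 1 1 1 1 (r*s*l^3*D*Z) 0 ?_)
    (sz_entry_smul hh 1 1 1 1 1 (r*l^2*D) 0 ?_)
  all_goals
    refine ⟨by simp [hr, hs, hl, hp, hD, hZ], ?_, ?_, ?_, ?_, by ring, ?_⟩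
    iterate 4 first | exact Or.inl (by ring1) | exact Or.inr (by ring1)
    clear hh hr hs hl hp hD hZ
    subst eZ eD ep el es1 er1
    try simp only [szM00, szM01, szM02, szM03, szM10, szM11, szM12, szM13, szM20, szM21, szM22, szM23, szM30, szM31, szM32, szM33, szX00, szL00, szL01, szL02, szL03, szL10, szL11, szL12, szL13, szL20, szL21, szL22, szL23, szL30, szL31, szL32, szL33]
    grind

lemma sz_big {F : Type*} [Field F] [CharP F 2] {r s r1 s1 l p D Z h : F}
    (H : SzRel r s r1 s1 l p D Z h) :
    let X := szX r s r1 s1 l p D Z h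
    let T := szT r s r1 s1 l p D Z h
    let Ti := szTi r s r1 s1 l p D Z h
    X * (X * (T * T * X)) * X = p • (T * (X * (Ti * X)) * T) := by
  intro X T Ti
  simp only [X, T, Ti]
  rw [sz_prod_S H, sz_prod_K H, sz_prod_P H, sz_prod_M H, sz_prod_L2 H, sz_prod_V H, sz_prod_N H,
    sz_prod_R H, sz_prod_L H]

/-- Abstract deduction of the relation from the rescaled one. -/
lemma sz_abstract {F R : Type*} [Field F] [Ring R] [Algebra F R] (Ψ : R →+* R) (p : F)
    (hp : p ≠ 0) (hΨ : ∀ M, Ψ (p • M) = p ^ 2 • Ψ M) (X T Ti : R)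
    (hX : X * (X * (T * T * X)) * X = p • (T * (X * (Ti * X)) * T)) (x t ti : R)
    (hx : x = p⁻¹ • Ψ X) (ht : t = Ψ T) (hti : ti = Ψ Ti) :
    x * (x * (t * t * x)) * x = t * (x * (ti * x)) * t := by
  have h := congrArg Ψ hX
  rw [hΨ] at h
  simp only [map_mul] at h
  subst hx ht hti
  simp only [smul_mul_assoc, mul_smul_comm, h, smul_smul]
  congr 1
  field_simp

lemma sz_group {G : Type*} [Group G] (x t : G)
    (h : x * (x * (t * t * x)) * x = t * (x * (t⁻¹ * x)) * t) :
    x⁻¹ * (x * t) * x⁻¹ * (x * t)⁻¹ * x ^ 2 =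
      (x * t) * x⁻¹ * x⁻¹ * (x * t)⁻¹ * x * (x * t)⁻¹ := by
  have h1 : x * (t * t * x) * x = x⁻¹ * (t * (x * (t⁻¹ * x)) * t) := by
    rw [← h]; group
  have h2 : x * t * t = x⁻¹ * (t * (x * (t⁻¹ * x)) * t) * x⁻¹ * x⁻¹ := by
    rw [← h1]; group
  have h3 : x * t * x⁻¹ * x⁻¹ * (x * t)⁻¹ * x * (x * t)⁻¹ = x * t * x⁻¹ * x⁻¹ * (x * t * t)⁻¹ := by
    group
  rw [h3, h2]
  group

lemma sz_matrix_group {F : Type*} [Field F] (x t ti y : Matrix (Fin 4) (Fin 4) F)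
    (hx : IsUnit x) (hti : t * ti = 1) (hy : y = x * t)
    (h : x * (x * (t * t * x)) * x = t * (x * (ti * x)) * t) :
    x⁻¹ * y * x⁻¹ * y⁻¹ * x ^ 2 = y * x⁻¹ * x⁻¹ * y⁻¹ * x * y⁻¹ := by
  obtain ⟨u, rfl⟩ := hx
  let w : (Matrix (Fin 4) (Fin 4) F)ˣ := ⟨t, ti, hti, mul_eq_one_comm.mp hti⟩
  have hw : t = w := rfl
  have hg := sz_group u w (by
    apply Units.ext
    exact h)
  have hg' := congrArg Units.val hg
  have hyw : y = ((u * w : (Matrix (Fin 4) (Fin 4) F)ˣ) : Matrix (Fin 4) (Fin 4) F) := by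
    rw [hy, hw]; rfl
  rw [hyw, ← Matrix.coe_units_inv, ← Matrix.coe_units_inv]
  exact_mod_cast hg'

/-- Entrywise squaring followed by conjugation by a diagonal matrix. -/
def szPsi {F : Type*} [Field F] [CharP F 2] (v : Fin 4 → F) (hv : ∀ i, v i ≠ 0) :
    Matrix (Fin 4) (Fin 4) F →+* Matrix (Fin 4) (Fin 4) F where
  toFun M := Matrix.of fun i j => (v i)⁻¹ * M i j ^ 2 * v j
  map_one' := by
    ext i j
    by_cases h : i = j
    · subst h; simp [hv]
    · simp [h]
  map_mul' M N := by
    ext i j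
    simp only [Matrix.of_apply, Matrix.mul_apply, CharTwo.sum_sq, Finset.mul_sum, Finset.sum_mul]
    refine Finset.sum_congr rfl fun k _ => ?_
    have := hv k
    field_simp
  map_zero' := by ext i j; simp
  map_add' M N := by
    ext i j
    simp only [Matrix.of_apply, Matrix.add_apply, CharTwo.add_sq]
    ring

lemma sz_unit {F : Type*} [Field F] (x00 x01 x02 x10 x11 x20 : F) :
    IsUnit !![x00, x01, x02, 1; x10, x11, 1, 0; x20, 1, 0, 0; 1, 0, 0, 0] := by
  rw [Matrix.isUnit_iff_isUnit_det]
  simp [Matrix.det_succ_row_zero, Fin.sum_univ_succ, Fin.succAbove]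

lemma sz_lit {F : Type*} [Field F] [CharP F 2] {p v1 v2 : F} (hv : ∀ i, ![1, v1, v2, p] i ≠ 0)
    (hv12 : v1 = p * v2) {X00 X01 X02 X10 X11 X20 x00 x01 x02 x10 x11 : F}
    (h00 : p * x00 = X00 ^ 2) (h01 : p * x01 = X01 ^ 2 * v1) (h02 : p * x02 = X02 ^ 2 * v2)
    (h10 : p * v1 * x10 = X10 ^ 2) (h11 : p * x11 = X11 ^ 2) (h20 : p * v2 * x02 = X20 ^ 2) :
    !![x00, x01, x02, 1; x10, x11, 1, 0; x02, 1, 0, 0; 1, 0, 0, 0] =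
      p⁻¹ • szPsi ![1, v1, v2, p] hv !![X00, X01, X02, 1 / 1; X10, X11, p / 1, 0 / 1;
        X20 / 1, 1 / 1, 0 / 1, 0 / 1; p / 1, 0 / 1, 0 / 1, 0 / 1] := by
  have hp : p ≠ 0 := hv 3
  have h1 : v1 ≠ 0 := hv 1
  have h2 : v2 ≠ 0 := hv 2
  have e00 : x00 = p⁻¹ * X00 ^ 2 := by rw [← h00]; field_simp
  have e01 : x01 = p⁻¹ * (X01 ^ 2 * v1) := by rw [← h01]; field_simp
  have e02 : x02 = p⁻¹ * (X02 ^ 2 * v2) := by rw [← h02]; field_simp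
  have e10 : x10 = p⁻¹ * (v1⁻¹ * X10 ^ 2) := by rw [← h10]; field_simp
  have e11 : x11 = p⁻¹ * (v1⁻¹ * X11 ^ 2 * v1) := by rw [← h11]; field_simp
  have e20 : x02 = p⁻¹ * (v2⁻¹ * X20 ^ 2) := by rw [← h20]; field_simp
  have e12 : p⁻¹ * (v1⁻¹ * p ^ 2 * v2) = 1 := by rw [hv12]; field_simp
  have e21 : p⁻¹ * (v2⁻¹ * v1) = 1 := by rw [hv12]; field_simp
  have e30 : p⁻¹ * (p⁻¹ * p ^ 2) = 1 := by field_simp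
  ext i j
  fin_cases i <;> fin_cases j
  · simpa [szPsi] using e00
  · simpa [szPsi] using e01
  · simpa [szPsi] using e02
  · simp [szPsi, hp]
  · simpa [szPsi] using e10
  · exact e11
  · have e12' : (1 : F) = p⁻¹ * (v1⁻¹ * (p / 1) ^ 2 * v2) := by rw [div_one, e12]
    exact e12'
  · simp [szPsi]
  · simpa [szPsi] using e20
  · simpa [szPsi] using e21.symm
  · simp [szPsi]
  · simp [szPsi]
  · have e30' : (1 : F) = p⁻¹ * (p⁻¹ * (p / 1) ^ 2 * 1) := by rw [div_one, mul_one, e30]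
    exact e30'
  · simp [szPsi]
  · simp [szPsi]
  · simp [szPsi]

lemma sz_TU {F : Type*} [Field F] (a b A B : F) :
    !![0, 0, 0, 1; 0, 0, 1, 0; 0, 1, 0, 0; 1, 0, 0, 0] *
      !![1, 0, 0, 0; a, 1, 0, 0; a * A + b, A, 1, 0; a ^ 2 * A + a * b + B, b, a, 1] =
    !![a ^ 2 * A + a * b + B, b, a, 1; a * A + b, A, 1, 0; a, 1, 0, 0; 1, 0, 0, 0] := by
  ext i j
  fin_cases i <;> fin_cases j <;> simp [Matrix.mul_apply, Fin.sum_univ_four]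

/-- The equation for the explicit matrices. -/
lemma sz_eqn {F : Type*} [Field F] [CharP F 2] {r s r1 s1 l p D Z h β : F}
    (H : SzRel r s r1 s1 l p D Z h) (hr1 : r1 ≠ 0) (hs1 : s1 ≠ 0)
    (hh : h ^ 2 = r^4*s^4*r1^2*s1^2*l^2*p^2*β) {a b A B c d C E : F}
    (ha : a = r^4*r1^2*l^3 / (s*p*Z)) (hA : A = s^4*s1^2*p^3 / (r^2*l^2*D^2))
    (hb : b = a * A * β) (hB : B = A * a^2 * (β + szKn r s / (r^8*s^2*r1^4*s1^2*l^4)))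
    (hc : c = r^2*s*s1^2*p / (l*Z)) (hC : C = r^2*s^2*r1^4*l^2 / (p*D^2))
    (hd : d = c * C * β + r^2*Z / (s*l^3*p^2))
    (hE : E = C * c^2 * (β + szKn r s / (r^8*s^2*r1^4*s1^2*l^4)) + s^2*D^2 / (r^2*p^3*l^4))
    (x y : Matrix (Fin 4) (Fin 4) F)
    (hx : x = !![a ^ 2 * A + a * b + B, b, a, 1; a * A + b, A, 1, 0; a, 1, 0, 0; 1, 0, 0, 0])
    (hy : y = !![c ^ 2 * C + c * d + E, d, c, 1; c * C + d, C, 1, 0; c, 1, 0, 0; 1, 0, 0, 0]) :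
    x⁻¹ * y * x⁻¹ * y⁻¹ * x ^ 2 = y * x⁻¹ * x⁻¹ * y⁻¹ * x * y⁻¹ := by
  obtain ⟨x1, x2, x3, x4, x5, x6⟩ := sz_entX H hr1 hs1 hh ha hA hb hB
  obtain ⟨y1, y2, y3, y4, y5, y6⟩ := sz_entY H hr1 hs1 hh hc hC hd hE
  have hp := H.hp
  have hv : ∀ i, ![1, s*l*p*Z, s*l*Z, p] i ≠ 0 := by
    intro i
    fin_cases i <;> simp [H.hs, H.hl, H.hp, H.hZ]
  have hv12 : s*l*p*Z = p * (s*l*Z) := by ring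
  have ux : x = p⁻¹ • szPsi _ hv (szX r s r1 s1 l p D Z h) := by
    rw [hx]; exact sz_lit hv hv12 x1 x2 x3 x4 x5 x6
  have uy : y = p⁻¹ • szPsi _ hv (szY r s r1 s1 l p D Z h) := by
    rw [hy]; exact sz_lit hv hv12 y1 y2 y3 y4 y5 y6
  refine sz_matrix_group x (szPsi _ hv (szT r s r1 s1 l p D Z h))
    (szPsi _ hv (szTi r s r1 s1 l p D Z h)) y ?_ ?_ ?_ ?_
  · rw [hx]; exact sz_unit _ _ _ _ _ _
  · rw [← map_mul, sz_prod_one H, map_one]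
  · rw [uy, ux, smul_mul_assoc, ← map_mul, sz_prod_Y H]
  · refine sz_abstract (szPsi _ hv) p hp ?_ _ _ _ (sz_big H) x _ _ ux rfl rfl
    intro M
    ext i j
    simp only [szPsi, RingHom.coe_mk, MonoidHom.coe_mk, OneHom.coe_mk, Matrix.of_apply,
      Matrix.smul_apply, smul_eq_mul]
    ring

lemma sz_theta {F : Type*} [Field F] [CharP F 2] (θ : F →+* F) (hθ : ∀ z, θ (θ z) = z ^ 2)
    (hsqrt : ∀ z : F, ∃ h, h ^ 2 = z) {r β₀ : F} (hr : r ≠ 0) (hr1 : r + 1 ≠ 0)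
    (hβ₀ : β₀ + θ β₀ = 1 + (r ^ 3 / θ r + r ^ 3 / (θ r) ^ 2 +
      ((r + 1) ^ 3 / (θ r + 1) + (r + 1) ^ 2 / (θ r + 1)))) :
    ∃ a b c d : F, a ≠ 0 ∧ ∀ x y : Matrix (Fin 4) (Fin 4) F,
      x = !![a ^ 2 * θ a + a * b + θ b, b, a, 1; a * θ a + b, θ a, 1, 0; a, 1, 0, 0; 1, 0, 0, 0] →
      y = !![c ^ 2 * θ c + c * d + θ d, d, c, 1; c * θ c + d, θ c, 1, 0; c, 1, 0, 0; 1, 0, 0, 0] →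
      x⁻¹ * y * x⁻¹ * y⁻¹ * x ^ 2 = y * x⁻¹ * x⁻¹ * y⁻¹ * x * y⁻¹ := by
  have two : (2 : F) = 0 := CharTwo.two_eq_zero
  obtain ⟨s, hsr⟩ : ∃ s, θ r = s := ⟨_, rfl⟩
  have hss : θ s = r ^ 2 := by rw [← hsr, hθ]
  rw [hsr] at hβ₀
  obtain ⟨r1, er1⟩ : ∃ r1, r1 = r + 1 := ⟨_, rfl⟩
  obtain ⟨s1, es1⟩ : ∃ s1, s1 = s + 1 := ⟨_, rfl⟩
  obtain ⟨l, el⟩ : ∃ l, l = r + s := ⟨_, rfl⟩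
  obtain ⟨p, ep⟩ : ∃ p, p = s + r ^ 2 := ⟨_, rfl⟩
  obtain ⟨D, eD⟩ : ∃ D, D = l ^ 3 + p ^ 2 := ⟨_, rfl⟩
  obtain ⟨Z, eZ⟩ : ∃ Z, Z = p ^ 3 + l ^ 4 := ⟨_, rfl⟩
  have tr1 : θ r1 = s1 := by rw [er1, es1, map_add, hsr, map_one]
  have ts1 : θ s1 = r1 ^ 2 := by rw [← tr1, hθ]
  have tl : θ l = p := by rw [el, ep, map_add, hsr, hss]
  have tp : θ p = l ^ 2 := by rw [← tl, hθ]
  have tD : θ D = Z := by rw [eD, eZ, map_add, map_pow, map_pow, tl, tp]; ring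
  have tZ : θ Z = D ^ 2 := by rw [← tD, hθ]
  have nz : ∀ z, z ≠ 0 → θ z ≠ 0 := fun z hz => (map_ne_zero θ).mpr hz
  have hr1' : r1 ≠ 0 := by rwa [er1]
  have hs : s ≠ 0 := hsr ▸ nz r hr
  have hs1 : s1 ≠ 0 := tr1 ▸ nz r1 hr1'
  have hrr : r ^ 2 + r ≠ 0 := by
    rw [show r ^ 2 + r = r * (r + 1) by ring]
    exact mul_ne_zero hr hr1
  have hl : l ≠ 0 := by
    intro h0
    have hp0 : p = 0 := by rw [← tl, h0, map_zero]
    apply hrr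
    linear_combination hp0 - ep + h0 - el - s * two
  have hp : p ≠ 0 := tl ▸ nz l hl
  have hD : D ≠ 0 := by
    intro h0
    have hZ0 : Z = 0 := by rw [← tD, h0, map_zero]
    have e1 : l ^ 3 = p ^ 2 := by linear_combination h0 - eD - p ^ 2 * two
    have e2 : p ^ 3 = l ^ 4 := by linear_combination hZ0 - eZ - l ^ 4 * two
    have e3 : l ^ 8 * l = l ^ 8 * 1 := by
      calc l ^ 8 * l = (l ^ 3) ^ 3 := by ring
        _ = (p ^ 3) ^ 2 := by rw [e1]; ring
        _ = l ^ 8 * 1 := by rw [e2]; ring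
    have e4 : l = 1 := mul_left_cancel₀ (pow_ne_zero _ hl) e3
    have e5 : p = 1 := by rw [← tl, e4, map_one]
    apply hrr
    linear_combination e5 - ep + e4 - el + (1 - s) * two
  have hZ : Z ≠ 0 := tD ▸ nz D hD
  -- the element `β`
  obtain ⟨κ, hκ⟩ : ∃ κ, κ = szKn r s / (r^8*s^2*r1^4*s1^2*l^4) := ⟨_, rfl⟩
  obtain ⟨β, hβdef⟩ : ∃ β, β = β₀ + szZn r s / (r^4*s^4*r1^2*s1^2*l^2*p^2) := ⟨_, rfl⟩
  have tκ : θ κ = szKn s (r^2) / (s^8*r^4*s1^4*r1^4*p^4) := by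
    rw [hκ, map_div₀]
    congr 1
    · simp only [szKn, map_add, map_mul, map_pow, hsr, hss]
    · simp only [map_mul, map_pow, hsr, hss, tr1, ts1, tl]; ring
  have tz : θ (szZn r s / (r^4*s^4*r1^2*s1^2*l^2*p^2)) =
      szZn s (r^2) / (s^4*r^8*s1^2*r1^4*p^2*l^4) := by
    rw [map_div₀]
    congr 1
    · simp only [szZn, map_add, map_mul, map_pow, hsr, hss]
    · simp only [map_mul, map_pow, hsr, hss, tr1, ts1, tl, tp]; ring
  have hβ1 : β + θ β = κ := by
    rw [hκ, ← sz_kappa hr hs hr1' hs1 hl hp er1 es1 el ep, hβdef, map_add, tz, er1, es1, ← hβ₀]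
    ring
  have tβ : θ β = β + κ := by linear_combination hβ1 - β * two
  have hβ2 : β ^ 2 = β + κ + θ κ := by rw [← hθ β, tβ, map_add, tβ]
  obtain ⟨h, hh⟩ := hsqrt (r^4*s^4*r1^2*s1^2*l^2*p^2*β)
  have hrel := sz_h_rel hr hs hr1' hs1 hl hp er1 es1 el ep hh (by rw [hβ2, tκ, hκ])
  have H : SzRel r s r1 s1 l p D Z h :=
    ⟨hr, hs, hl, hp, hD, hZ, er1, es1, el, ep, eD, eZ, hrel⟩
  obtain ⟨a, ha⟩ : ∃ a, a = r^4*r1^2*l^3 / (s*p*Z) := ⟨_, rfl⟩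
  obtain ⟨c, hc⟩ : ∃ c, c = r^2*s*s1^2*p / (l*Z) := ⟨_, rfl⟩
  have hA : θ a = s^4*s1^2*p^3 / (r^2*l^2*D^2) := by
    rw [ha]
    simp only [map_div₀, map_mul, map_pow, hsr, hss, tr1, tl, tp, tZ]
  have hC : θ c = r^2*s^2*r1^4*l^2 / (p*D^2) := by
    rw [hc]
    simp only [map_div₀, map_mul, map_pow, hsr, hss, ts1, tl, tp, tZ]
    ring
  obtain ⟨b, hb⟩ : ∃ b, b = a * θ a * β := ⟨_, rfl⟩
  obtain ⟨d, hd⟩ : ∃ d, d = c * θ c * β + r^2*Z / (s*l^3*p^2) := ⟨_, rfl⟩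
  have hB : θ b = θ a * a^2 * (β + szKn r s / (r^8*s^2*r1^4*s1^2*l^4)) := by
    rw [hb, map_mul, map_mul, hθ, tβ, hκ]
  have hE : θ d = θ c * c^2 * (β + szKn r s / (r^8*s^2*r1^4*s1^2*l^4)) +
      s^2*D^2 / (r^2*p^3*l^4) := by
    rw [hd, map_add, map_mul, map_mul, hθ, tβ, hκ]
    congr 1
    simp only [map_div₀, map_mul, map_pow, hsr, hss, tl, tp, tZ]
    congr 1
    ring
  refine ⟨a, b, c, d, ?_, fun x y hx hy => ?_⟩
  · rw [ha]
    exact div_ne_zero (by simp [hr, hr1', hl]) (by simp [hs, hp, hZ])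
  · exact sz_eqn H hr1' hs1 hh ha hA hb hB hc hC hd hE x y hx hy

/-- For `n = 2m+1 ≥ 3` odd and `F` the field with `q = 2ⁿ` elements, the equation
`x⁻¹yx⁻¹y⁻¹x² = yx⁻²y⁻¹xy⁻¹` has a non-trivial solution with `x = T·U(a,b)`,
`y = T·U(c,d)`, where `U` is built using the automorphism `θ(z) = z^{2^{m+1}}`.
(Equivalently, `u₁ = u₂` has a non-trivial solution in the Suzuki group `Sz(q)`.) -/
theorem suzuki_exists_nontrivial_solution (m : ℕ) (hm : 1 ≤ m)
    (F : Type*) [Field F] [Fintype F] (hcard : Fintype.card F = 2 ^ (2 * m + 1)) :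
    ∃ a b c d : F, ¬ (a = 0 ∧ b = 0 ∧ c = 0 ∧ d = 0) ∧
      let U : F → F → Matrix (Fin 4) (Fin 4) F := fun α β =>
        !![1, 0, 0, 0;
           α, 1, 0, 0;
           α * α ^ 2 ^ (m + 1) + β, α ^ 2 ^ (m + 1), 1, 0;
           α ^ 2 * α ^ 2 ^ (m + 1) + α * β + β ^ 2 ^ (m + 1), β, α, 1]
      let T : Matrix (Fin 4) (Fin 4) F :=
        !![0, 0, 0, 1; 0, 0, 1, 0; 0, 1, 0, 0; 1, 0, 0, 0]
      let x := T * U a b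
      let y := T * U c d
      x⁻¹ * y * x⁻¹ * y⁻¹ * x ^ 2 = y * x⁻¹ * x⁻¹ * y⁻¹ * x * y⁻¹ := by
  haveI : Fact (Nat.Prime 2) := ⟨Nat.prime_two⟩
  haveI : CharP F 2 := charP_of_card_eq_prime_pow hcard
  obtain ⟨r, β₀, hr, hr1, hβ⟩ := sz_exists_r m hm hcard
  have hθ : ∀ z : F, iterateFrobenius F 2 (m + 1) (iterateFrobenius F 2 (m + 1) z) = z ^ 2 := by
    intro z
    simp only [iterateFrobenius_def]
    exact sz_th_th m hcard z
  have hsqrt : ∀ z : F, ∃ h, h ^ 2 = z := by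
    intro z
    obtain ⟨h, hh⟩ := (bijective_frobenius F 2).surjective z
    exact ⟨h, by rw [← frobenius_def, hh]⟩
  obtain ⟨a, b, c, d, ha, hx⟩ := sz_theta (iterateFrobenius F 2 (m + 1)) hθ hsqrt hr hr1
    (by simpa only [iterateFrobenius_def] using hβ)
  refine ⟨a, b, c, d, fun h => ha h.1, ?_⟩
  intro U T x y
  simp only [iterateFrobenius_def] at hx
  exact hx x y (sz_TU _ _ _ _) (sz_TU _ _ _ _)
end
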